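/- Algebraic decay of travelling waves (Gravejat): let c ∈ [0, √2) and let U ∈ ℰ be a solution of (TW_c)(U) = 0 with U(x) → 1 as |x| → ∞. Then there exists a constant M > 0 (depending on U and c) such that for all x ∈ ℝ²: |U(x) − 1| ≤ M/(1 + |x|), |∇U(x)| ≤ M/(1 + |x|)², and ||U(x)| − 1| ≤ M/(1 + |x|)². -/

import Mathlib

open MeasureTheory Filter Metric

noncomputable section

/-- First partial derivative (direction `x₁`), identifying `ℝ²` with `ℂ`. -/
def pd1 (u : ℂ → ℂ) (z : ℂ) : ℂ := fderiv ℝ u z 1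

/-- Second partial derivative (direction `x₂`). -/
def pd2 (u : ℂ → ℂ) (z : ℂ) : ℂ := fderiv ℝ u z Complex.I

/-- Laplacian `Δu`. -/
def lap (u : ℂ → ℂ) (z : ℂ) : ℂ := fderiv ℝ (pd1 u) z 1 + fderiv ℝ (pd2 u) z Complex.I

/-- `|∇u|²`. -/
def gradSq (u : ℂ → ℂ) (z : ℂ) : ℝ := ‖pd1 u z‖ ^ 2 + ‖pd2 u z‖ ^ 2

/-- Ginzburg–Landau energy density. -/
def energyDensity (u : ℂ → ℂ) (z : ℂ) : ℝ :=
  (1 / 2) * gradSq u z + (1 / 4) * (1 - ‖u z‖ ^ 2) ^ 2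

/-- Ginzburg–Landau energy, valued in `[0,∞]`. -/
def energy (u : ℂ → ℂ) : ENNReal := ∫⁻ z : ℂ, ENNReal.ofReal (energyDensity u z)

/-- `E(u)`, real valued. -/
def Efun (u : ℂ → ℂ) : ℝ := (energy u).toReal

/-- The energy space `ℰ`: (smooth) maps with finite Ginzburg–Landau energy. -/
def memE (u : ℂ → ℂ) : Prop := ContDiff ℝ (⊤ : ℕ∞) u ∧ energy u < ⊤

/-- Momentum density `Re(i ∂₂u (conj u − 1))`. -/
def momDensity (u : ℂ → ℂ) (z : ℂ) : ℝ :=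
  (Complex.I * pd2 u z * ((starRingEnd ℂ) (u z) - 1)).re

/-- Integrability of the momentum density. -/
def momInt (u : ℂ → ℂ) : Prop := Integrable (momDensity u)

/-- The momentum `P₂(u)`. -/
def P2 (u : ℂ → ℂ) : ℝ := (1 / 2) * ∫ z : ℂ, momDensity u z

/-- `(TW_c)(u) = 0`: the travelling wave equation `−ic∂₂u − Δu − (1−|u|²)u = 0`. -/
def TW (c : ℝ) (u : ℂ → ℂ) : Prop :=
  ∀ z : ℂ, -(Complex.I * (c : ℂ) * pd2 u z) - lap u z - ((1 - ‖u z‖ ^ 2 : ℝ) : ℂ) * u z = 0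

/-- `E_min(p)`. -/
def Emin (p : ℝ) : ℝ := sInf (Efun '' {u : ℂ → ℂ | memE u ∧ P2 u = p})

/-- Evenness in `x₁`: `u(−x₁, x₂) = u(x₁, x₂)`. -/
def evenX1 (u : ℂ → ℂ) : Prop := ∀ z : ℂ, u (-((starRingEnd ℂ) z)) = u z

/-- Quasi-minimizer hypotheses (with symmetry), momentum `p` and speed `c`. -/
def QuasiMin (Λ₀ : ℝ) (u : ℂ → ℂ) (p c : ℝ) : Prop :=
  memE u ∧ evenX1 u ∧ 0 < c ∧ TW c u ∧ momInt u ∧ P2 u = p ∧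
  Efun u ≤ 2 * Real.pi * Real.log p + Λ₀

/-- `V1` is the degree-one vortex with (increasing) modulus profile `ρ`. -/
def IsVortex (V1 : ℂ → ℂ) (ρ : ℝ → ℝ) : Prop :=
  ContDiff ℝ (⊤ : ℕ∞) V1 ∧
  (∀ z : ℂ, lap V1 z + V1 z * ((1 - ‖V1 z‖ ^ 2 : ℝ) : ℂ) = 0) ∧
  V1 0 = 0 ∧
  (∀ z : ℂ, z ≠ 0 → V1 z = ((ρ ‖z‖ : ℝ) : ℂ) * (z / (‖z‖ : ℂ))) ∧
  ρ 0 = 0 ∧ StrictMonoOn ρ (Set.Ici 0) ∧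
  (∀ r : ℝ, 0 ≤ r → 0 ≤ ρ r ∧ ρ r < 1) ∧
  Filter.Tendsto ρ Filter.atTop (nhds 1)

namespace TravellingWave

open scoped ContDiff

section

/-- The standard basis `1, i` of `ℂ` over `ℝ`. -/
def dir (j : Fin 2) : ℂ := if j = 0 then 1 else Complex.I

/-- Partial derivative in the direction `dir j` of a real-valued function. -/
def D (j : Fin 2) (f : ℂ → ℝ) (z : ℂ) : ℝ := fderiv ℝ f z (dir j)

@[fun_prop]
theorem contDiff_D {f : ℂ → ℝ} (hf : ContDiff ℝ ∞ f) (j : Fin 2) : ContDiff ℝ ∞ (D j f) := by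
  unfold D
  exact (hf.fderiv_right (m := ∞) (by simp)).clm_apply contDiff_const

theorem diffAt {f : ℂ → ℝ} (hf : ContDiff ℝ ∞ f) {z : ℂ} : DifferentiableAt ℝ f z :=
  (hf.differentiable (by simp)).differentiableAt

theorem D_add {f g : ℂ → ℝ} (hf : ContDiff ℝ ∞ f) (hg : ContDiff ℝ ∞ g) (j : Fin 2) :
    D j (fun z => f z + g z) = fun z => D j f z + D j g z := by
  funext z
  simp [D, fderiv_fun_add (diffAt hf) (diffAt hg)]

theorem D_sub {f g : ℂ → ℝ} (hf : ContDiff ℝ ∞ f) (hg : ContDiff ℝ ∞ g) (j : Fin 2) :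
    D j (fun z => f z - g z) = fun z => D j f z - D j g z := by
  funext z
  simp [D, fderiv_fun_sub (diffAt hf) (diffAt hg)]

theorem D_neg (f : ℂ → ℝ) (j : Fin 2) :
    D j (fun z => - f z) = fun z => - D j f z := by
  funext z
  simp [D]

theorem D_const (c : ℝ) (j : Fin 2) : D j (fun _ => c) = fun _ => 0 := by
  funext z
  simp [D]

theorem D_mul {f g : ℂ → ℝ} (hf : ContDiff ℝ ∞ f) (hg : ContDiff ℝ ∞ g) (j : Fin 2) :
    D j (fun z => f z * g z) = fun z => D j f z * g z + f z * D j g z := by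
  funext z
  simp [D, fderiv_fun_mul (diffAt hf) (diffAt hg)]
  ring

theorem D_pow {f : ℂ → ℝ} (hf : ContDiff ℝ ∞ f) (n : ℕ) (j : Fin 2) :
    D j (fun z => f z ^ n) = fun z => n * f z ^ (n - 1) * D j f z := by
  funext z
  simp [D, fderiv_fun_pow n (diffAt hf)]

theorem D_exp {f : ℂ → ℝ} (hf : ContDiff ℝ ∞ f) (j : Fin 2) :
    D j (fun z => Real.exp (f z)) = fun z => Real.exp (f z) * D j f z := by
  funext z
  simp [D, fderiv_exp (diffAt hf)]

theorem D_cos {f : ℂ → ℝ} (hf : ContDiff ℝ ∞ f) (j : Fin 2) :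
    D j (fun z => Real.cos (f z)) = fun z => - (Real.sin (f z) * D j f z) := by
  funext z
  simp [D, fderiv_cos (diffAt hf)]

theorem D_sin {f : ℂ → ℝ} (hf : ContDiff ℝ ∞ f) (j : Fin 2) :
    D j (fun z => Real.sin (f z)) = fun z => Real.cos (f z) * D j f z := by
  funext z
  simp [D, fderiv_sin (diffAt hf)]

theorem D_comm {f : ℂ → ℝ} (hf : ContDiff ℝ ∞ f) (i j : Fin 2) :
    D i (D j f) = D j (D i f) := by
  have key : ∀ (v w : ℂ) (z : ℂ), fderiv ℝ (fun y => fderiv ℝ f y v) z w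
      = fderiv ℝ (fderiv ℝ f) z w v := by
    intro v w z
    have h1 : DifferentiableAt ℝ (fderiv ℝ f) z :=
      ((hf.fderiv_right (m := ∞) (by simp)).differentiable (by simp)).differentiableAt
    rw [fderiv_clm_apply h1 (differentiableAt_const v)]
    simp
  funext z
  have hs : IsSymmSndFDerivAt ℝ f z :=
    hf.contDiffAt.isSymmSndFDerivAt
      (by rw [minSmoothness_of_isRCLikeNormedField]; 
          exact WithTop.coe_le_coe.2 (le_top : (2 : ℕ∞) ≤ ⊤))
  change fderiv ℝ (fun y => fderiv ℝ f y (dir j)) z (dir i)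
    = fderiv ℝ (fun y => fderiv ℝ f y (dir i)) z (dir j)
  rw [key, key]
  exact hs _ _

theorem D_eq_of_eqOn {f g : ℂ → ℝ} {s : Set ℂ} (hs : IsOpen s) (h : ∀ z ∈ s, f z = g z)
    (j : Fin 2) {z : ℂ} (hz : z ∈ s) : D j f z = D j g z := by
  have : f =ᶠ[nhds z] g := Filter.eventually_of_mem (hs.mem_nhds hz) h
  simp [D, this.fderiv_eq]

theorem D_eq_zero_of_notMem {f : ℂ → ℝ} {z : ℂ} (h : z ∉ tsupport f) (j : Fin 2) :
    D j f z = 0 := by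
  have h0 : (0 : ℂ →L[ℝ] ℝ) = fderiv ℝ f z :=
    ((image_eq_zero_of_notMem_tsupport
      (fun h' => h (tsupport_fderiv_subset ℝ h'))) : fderiv ℝ f z = 0).symm
  simp [D, ← h0]

theorem hasCompactSupport_D {f : ℂ → ℝ} (hf : HasCompactSupport f) (j : Fin 2) :
    HasCompactSupport (D j f) := by
  unfold D
  exact (hf.fderiv ℝ).comp_left (g := fun L : ℂ →L[ℝ] ℝ => L (dir j)) (by simp)

theorem integrable_of_smooth {f : ℂ → ℝ} (hf : ContDiff ℝ ∞ f) (hc : HasCompactSupport f) :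
    Integrable f := hf.continuous.integrable_of_hasCompactSupport hc

theorem integral_D_eq_zero {f : ℂ → ℝ} (hf : ContDiff ℝ ∞ f) (hc : HasCompactSupport f)
    (j : Fin 2) : ∫ z, D j f z = 0 := by
  have hd := hasCompactSupport_D hc j
  have := integral_mul_fderiv_eq_neg_fderiv_mul_of_integrable (μ := (volume : Measure ℂ))
    (f := fun _ : ℂ => (1 : ℝ)) (g := f) (v := dir j) (by simp)
    (by simpa [D] using! integrable_of_smooth (contDiff_D hf j) hd)
    (by simpa using integrable_of_smooth hf hc)
    (fun x _ => differentiableAt_const _) (fun x _ => diffAt hf)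
  simpa [D] using this

theorem integral_le_of_le_add_div {A B F G : ℂ → ℝ} (hA : Integrable A) (hB : Integrable B)
    (hF : ContDiff ℝ ∞ F) (hG : ContDiff ℝ ∞ G)
    (hFc : HasCompactSupport F) (hGc : HasCompactSupport G)
    (h : ∀ z, A z ≤ B z + D 0 F z + D 1 G z) : ∫ z, A z ≤ ∫ z, B z := by
  have h1 := integrable_of_smooth (contDiff_D hF 0) (hasCompactSupport_D hFc 0)
  have h2 := integrable_of_smooth (contDiff_D hG 1) (hasCompactSupport_D hGc 1)
  have := integral_mono (g := fun z => B z + D 0 F z + D 1 G z) hA ((hB.add h1).add h2) h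
  rw [integral_add (f := fun z => B z + D 0 F z) (hB.add h1) h2, integral_add hB h1,
    integral_D_eq_zero hF hFc, integral_D_eq_zero hG hGc] at this
  simpa using this

theorem abs_le_integral_abs_deriv {h : ℝ → ℝ} (hh : ContDiff ℝ 1 h) (hc : HasCompactSupport h)
    (x : ℝ) : |h x| ≤ ∫ t, |deriv h t| := by
  have hi : Integrable (deriv h) :=
    (hh.continuous_deriv le_rfl).integrable_of_hasCompactSupport hc.deriv
  rw [← hc.integral_Iic_deriv_eq hh x]
  calc |∫ t in Set.Iic x, deriv h t| ≤ ∫ t in Set.Iic x, |deriv h t| :=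
        abs_integral_le_integral_abs
    _ ≤ ∫ t, |deriv h t| :=
        setIntegral_le_integral hi.abs (Eventually.of_forall fun _ => abs_nonneg _)

theorem integral_complex_eq {f : ℂ → ℝ} (hf : Integrable f) :
    ∫ z, f z = ∫ x : ℝ, ∫ y : ℝ, f (⟨x, y⟩ : ℂ) := by
  have h1 := Complex.volume_preserving_equiv_real_prod.symm
  rw [← h1.integral_comp (Complex.measurableEquivRealProd.symm.measurableEmbedding) f]
  rw [Measure.volume_eq_prod, integral_prod]
  · rfl
  · exact (h1.integrable_comp_emb
      (Complex.measurableEquivRealProd.symm.measurableEmbedding)).2 hf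

theorem hasCompactSupport_line {f : ℂ → ℝ} (hc : HasCompactSupport f) (w : ℂ) (j : Fin 2) :
    HasCompactSupport (fun t : ℝ => f (w + t * dir j)) := by
  have hd : ‖dir j‖ = 1 := by unfold dir; split_ifs <;> simp
  have hiso : Isometry (fun t : ℝ => w + t * dir j) := by
    refine Isometry.of_dist_eq fun s t => ?_
    rw [dist_add_left, dist_eq_norm, ← sub_mul, norm_mul, hd, ← Complex.ofReal_sub,
      Complex.norm_real]
    simp [Real.dist_eq]
  exact hc.comp_isClosedEmbedding hiso.isClosedEmbedding

theorem deriv_line {f : ℂ → ℝ} (hf : ContDiff ℝ ∞ f) (w : ℂ) (j : Fin 2) (t : ℝ) :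
    HasDerivAt (fun t : ℝ => f (w + t * dir j)) (D j f (w + t * dir j)) t := by
  have h1 : HasDerivAt (fun t : ℝ => w + t * dir j) (dir j) t := by
    have := ((Complex.ofRealCLM.hasDerivAt (x := t)).mul_const (dir j)).const_add w
    simpa using this
  exact (diffAt hf (z := w + t * dir j)).hasFDerivAt.comp_hasDerivAt t h1

theorem contDiff_line {f : ℂ → ℝ} (hf : ContDiff ℝ ∞ f) (w : ℂ) (j : Fin 2) :
    ContDiff ℝ ∞ (fun t : ℝ => f (w + t * dir j)) := by
  have : ContDiff ℝ ∞ (fun t : ℝ => (t : ℂ)) := Complex.ofRealCLM.contDiff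
  exact hf.comp (contDiff_const.add (this.mul contDiff_const))

/-- Two-dimensional Sobolev inequality `W^{2,1} ⊂ L^∞`. -/
theorem abs_le_integral_abs_D_D {g : ℂ → ℝ} (hg : ContDiff ℝ ∞ g) (hc : HasCompactSupport g)
    (z : ℂ) : |g z| ≤ ∫ w, |D 1 (D 0 g) w| := by
  have hcd : ContDiff ℝ ∞ (D 1 (D 0 g)) := contDiff_D (contDiff_D hg 0) 1
  have hcc := hasCompactSupport_D (hasCompactSupport_D hc 0) 1
  have hi : Integrable (fun w => |D 1 (D 0 g) w|) := (integrable_of_smooth hcd hcc).abs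
  have hline : ∀ (f : ℂ → ℝ), ContDiff ℝ ∞ f → HasCompactSupport f → ∀ (w : ℂ) (j : Fin 2) (t : ℝ),
      |f (w + t * dir j)| ≤ ∫ r : ℝ, |D j f (w + r * dir j)| := by
    intro f hf hfc w j t
    have h := abs_le_integral_abs_deriv ((contDiff_line hf w j).of_le (by simp))
      (hasCompactSupport_line hfc w j) t
    have e : deriv (fun t : ℝ => f (w + t * dir j)) = fun t : ℝ => D j f (w + t * dir j) :=
      funext fun t => (deriv_line hf w j t).deriv
    rwa [e] at h
  rw [integral_complex_eq hi]
  have h0 := hline g hg hc (Complex.I * z.im) 0 z.re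
  have e0 : Complex.I * (z.im : ℂ) + z.re * dir 0 = z := by
    simp [dir]; rw [add_comm, mul_comm]; exact Complex.re_add_im z
  rw [e0] at h0
  refine h0.trans (integral_mono_of_nonneg (Eventually.of_forall fun _ => abs_nonneg _) ?_
    (Eventually.of_forall fun r => ?_))
  · have h1 := Complex.volume_preserving_equiv_real_prod.symm
    have h2 : Integrable (fun p : ℝ × ℝ => |D 1 (D 0 g) (⟨p.1, p.2⟩ : ℂ)|)
        ((volume : Measure ℝ).prod volume) :=
      (h1.integrable_comp_emb
      (Complex.measurableEquivRealProd.symm.measurableEmbedding)).2 hi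
    exact h2.integral_prod_left
  · have h1 := hline (D 0 g) (contDiff_D hg 0) (hasCompactSupport_D hc 0) r 1 z.im
    have e1 : ∀ t : ℝ, (r : ℂ) + t * dir 1 = ⟨r, t⟩ := by
      intro t; simp [dir, Complex.ext_iff]
    simp only [e1] at h1
    have e2 : Complex.I * (z.im : ℂ) + r * dir 0 = ⟨r, z.im⟩ := by
      simp [dir, Complex.ext_iff]
    simpa only [e2] using h1

end

section

/-- Laplacian of a real-valued function. -/
def lapR (f : ℂ → ℝ) (z : ℂ) : ℝ := D 0 (D 0 f) z + D 1 (D 1 f) z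

/-- Squared length of the gradient of a real-valued function. -/
def gsq (f : ℂ → ℝ) (z : ℂ) : ℝ := D 0 f z ^ 2 + D 1 f z ^ 2

/-- Inner product of two gradients. -/
def gdot (f g : ℂ → ℝ) (z : ℂ) : ℝ := D 0 f z * D 0 g z + D 1 f z * D 1 g z

@[fun_prop]
theorem contDiff_lapR {f : ℂ → ℝ} (hf : ContDiff ℝ ∞ f) : ContDiff ℝ ∞ (lapR f) := by
  unfold lapR; fun_prop

@[fun_prop]
theorem contDiff_gsq {f : ℂ → ℝ} (hf : ContDiff ℝ ∞ f) : ContDiff ℝ ∞ (gsq f) := by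
  unfold gsq; fun_prop

@[fun_prop]
theorem contDiff_gdot {f g : ℂ → ℝ} (hf : ContDiff ℝ ∞ f) (hg : ContDiff ℝ ∞ g) :
    ContDiff ℝ ∞ (gdot f g) := by
  unfold gdot; fun_prop

theorem gsq_nonneg (f : ℂ → ℝ) (z : ℂ) : 0 ≤ gsq f z := by unfold gsq; positivity

theorem two_mul_le_weighted {a b : ℝ} (ha : 0 < a) (hab : a * b = 1) (x y : ℝ) :
    2 * (x * y) ≤ a * x ^ 2 + b * y ^ 2 := by
  have h : a * x ^ 2 + b * y ^ 2 - 2 * (x * y) = a * (x - b * y) ^ 2 := by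
    linear_combination (- b * y ^ 2 + 2 * (x * y)) * hab
  have := mul_nonneg ha.le (sq_nonneg (x - b * y))
  linarith

/-- Pointwise form of the Caccioppoli inequality for the linearised system. -/
theorem caccioppoli_pointwise {c μ k : ℝ} (hμ : 0 < μ) (hμ1 : μ ≤ 1) (hk : μ / 2 * k = 1)
    (hcoer : ∀ x y : ℝ, μ * (x ^ 2 + y ^ 2) ≤ 2 * x ^ 2 + 2 * c * (x * y) + y ^ 2)
    (hc2 : c ^ 2 ≤ 2) {p q χ : ℂ → ℝ}
    (hp : ContDiff ℝ ∞ p) (hq : ContDiff ℝ ∞ q) (hχ : ContDiff ℝ ∞ χ) (z : ℂ) :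
    μ / 2 * (χ z ^ 2 * (p z ^ 2 + gsq p z + gsq q z)) ≤
      - (χ z ^ 2 * ((lapR p z - 2 * p z - c * D 1 q z) * p z
          + (lapR q z + c * D 1 p z) * q z))
      + 3 * k * (gsq χ z * (p z ^ 2 + q z ^ 2))
      + D 0 (fun z => χ z ^ 2 * (p z * D 0 p z + q z * D 0 q z)) z
      + D 1 (fun z => χ z ^ 2 * (p z * D 1 p z + q z * D 1 q z + c * (p z * q z))) z := by
  simp (disch := fun_prop) only [D_mul, D_add, D_pow, D_const, lapR, gsq]
  have hk0 : 0 < k := by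
    by_contra h
    have : μ / 2 * k ≤ 0 := mul_nonpos_of_nonneg_of_nonpos (by positivity) (not_lt.1 h)
    linarith
  generalize χ z = X
  generalize D 0 χ z = X0
  generalize D 1 χ z = X1
  generalize D 0 (D 0 p) z = p00
  generalize D 1 (D 1 p) z = p11
  generalize D 0 (D 0 q) z = q00
  generalize D 1 (D 1 q) z = q11
  generalize p z = P
  generalize D 0 p z = p0
  generalize D 1 p z = p1
  generalize q z = Q
  generalize D 0 q z = q0
  generalize D 1 q z = q1
  have hco := mul_le_mul_of_nonneg_left (hcoer P q1) (sq_nonneg X)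
  have hm : 0 < μ / 2 := by positivity
  have a1 := two_mul_le_weighted hm hk (X * p0) (-(X0 * P))
  have a2 := two_mul_le_weighted hm hk (X * p1) (-(X1 * P))
  have a3 := two_mul_le_weighted hm hk (X * q0) (-(X0 * Q))
  have a4 := two_mul_le_weighted hm hk (X * q1) (-(X1 * Q))
  have a5 := two_mul_le_weighted hm hk (X * P) (-(c * X1 * Q))
  have b1 : 0 ≤ (1 - μ) * (X ^ 2 * (p0 ^ 2 + p1 ^ 2 + q0 ^ 2)) :=
    mul_nonneg (by linarith) (by positivity)
  have b2 : 0 ≤ (2 - c ^ 2) * (k * (X1 * Q) ^ 2) := mul_nonneg (by linarith) (by positivity)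
  have b3 : 0 ≤ k * (X0 * Q) ^ 2 := by positivity
  have b4 : 0 ≤ k * ((X0 * P) ^ 2 + (X1 * P) ^ 2) := by positivity
  push_cast
  norm_num
  nlinarith [hco, a1, a2, a3, a4, a5, b1, b2, b3, b4]

/-- Pointwise Gagliardo–Nirenberg inequality, up to a divergence. -/
theorem gagliardo_nirenberg_pointwise {r χ : ℂ → ℝ}
    (hr : ContDiff ℝ ∞ r) (hχ : ContDiff ℝ ∞ χ) (j : Fin 2) (z : ℂ) :
    χ z ^ 4 * D j r z ^ 4 ≤
      r z ^ 2 * (18 * (χ z ^ 4 * D j (D j r) z ^ 2) + 32 * (χ z ^ 2 * D j χ z ^ 2 * D j r z ^ 2))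
      + D j (fun z => 2 * (χ z ^ 4 * (r z * D j r z ^ 3))) z := by
  simp (disch := fun_prop) only [D_mul, D_pow, D_const]
  generalize χ z = X
  generalize D j χ z = X1
  generalize D j (D j r) z = R2
  generalize D j r z = R1
  generalize r z = R
  have a1 := sq_nonneg (X ^ 2 * R1 ^ 2 + 8 * (X * X1 * R * R1))
  have a2 := sq_nonneg (X ^ 2 * R1 ^ 2 + 6 * (X ^ 2 * R * R2))
  push_cast
  norm_num
  nlinarith [a1, a2]

end

section

theorem hasCompactSupport_of_eq_zero {χ F : ℂ → ℝ} (hχ : HasCompactSupport χ)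
    (h : ∀ z, χ z = 0 → F z = 0) : HasCompactSupport F :=
  hχ.mono fun z hz hz' => hz (h z hz')

/-- `A ≤ B` up to the divergence of a smooth compactly supported vector field. -/
def DivLE (A B : ℂ → ℝ) : Prop :=
  ∃ F G : ℂ → ℝ, ContDiff ℝ ∞ F ∧ ContDiff ℝ ∞ G ∧ HasCompactSupport F ∧ HasCompactSupport G ∧
    ∀ z, A z ≤ B z + D 0 F z + D 1 G z

theorem DivLE.integral_le {A B : ℂ → ℝ} (h : DivLE A B) (hA : Integrable A) (hB : Integrable B) :
    ∫ z, A z ≤ ∫ z, B z := by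
  obtain ⟨F, G, hF, hG, hFc, hGc, h⟩ := h
  exact integral_le_of_le_add_div hA hB hF hG hFc hGc h

theorem DivLE.add {A B A' B' : ℂ → ℝ} (h : DivLE A B) (h' : DivLE A' B') :
    DivLE (fun z => A z + A' z) (fun z => B z + B' z) := by
  obtain ⟨F, G, hF, hG, hFc, hGc, h⟩ := h
  obtain ⟨F', G', hF', hG', hFc', hGc', h'⟩ := h'
  refine ⟨fun z => F z + F' z, fun z => G z + G' z, by fun_prop, by fun_prop,
    hFc.add hFc', hGc.add hGc', fun z => ?_⟩
  rw [D_add hF hF', D_add hG hG']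
  linarith [h z, h' z]

theorem DivLE.smul {A B : ℂ → ℝ} (h : DivLE A B) {a : ℝ} (ha : 0 ≤ a) :
    DivLE (fun z => a * A z) (fun z => a * B z) := by
  obtain ⟨F, G, hF, hG, hFc, hGc, h⟩ := h
  refine ⟨fun z => a * F z, fun z => a * G z, by fun_prop, by fun_prop,
    hFc.mul_left, hGc.mul_left, fun z => ?_⟩
  rw [D_mul contDiff_const hF, D_mul contDiff_const hG]
  simp only [D_const]
  linarith [mul_le_mul_of_nonneg_left (h z) ha]

theorem DivLE.trans {A B C : ℂ → ℝ} (h : DivLE A B) (h' : DivLE B C) : DivLE A C := by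
  obtain ⟨F, G, hF, hG, hFc, hGc, h⟩ := h
  obtain ⟨F', G', hF', hG', hFc', hGc', h'⟩ := h'
  refine ⟨fun z => F z + F' z, fun z => G z + G' z, by fun_prop, by fun_prop,
    hFc.add hFc', hGc.add hGc', fun z => ?_⟩
  rw [D_add hF hF', D_add hG hG']
  linarith [h z, h' z]

theorem DivLE.of_dir {A B F : ℂ → ℝ} (j : Fin 2) (hF : ContDiff ℝ ∞ F) (hFc : HasCompactSupport F)
    (h : ∀ z, A z ≤ B z + D j F z) : DivLE A B := by
  fin_cases j
  · exact ⟨F, fun _ => 0, hF, contDiff_const, hFc, HasCompactSupport.zero,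
      fun z => by simpa [D_const] using h z⟩
  · exact ⟨fun _ => 0, F, contDiff_const, hF, HasCompactSupport.zero, hFc,
      fun z => by simpa [D_const] using h z⟩

theorem D_lapR {f : ℂ → ℝ} (hf : ContDiff ℝ ∞ f) (j : Fin 2) : D j (lapR f) = lapR (D j f) := by
  unfold lapR
  rw [D_add (by fun_prop) (by fun_prop), D_comm (by fun_prop) j 0, D_comm (by fun_prop) j 1,
    D_comm hf j 0, D_comm hf j 1]

/-- Squared norm of the Hessian. -/
def hsq (f : ℂ → ℝ) (z : ℂ) : ℝ := gsq (D 0 f) z + gsq (D 1 f) z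

/-- Squared norm of the third derivative. -/
def tsq (f : ℂ → ℝ) (z : ℂ) : ℝ := hsq (D 0 f) z + hsq (D 1 f) z

@[fun_prop]
theorem contDiff_hsq {f : ℂ → ℝ} (hf : ContDiff ℝ ∞ f) : ContDiff ℝ ∞ (hsq f) := by
  unfold hsq; fun_prop

@[fun_prop]
theorem contDiff_tsq {f : ℂ → ℝ} (hf : ContDiff ℝ ∞ f) : ContDiff ℝ ∞ (tsq f) := by
  unfold tsq; fun_prop

theorem hsq_nonneg (f : ℂ → ℝ) (z : ℂ) : 0 ≤ hsq f z := add_nonneg (gsq_nonneg _ _) (gsq_nonneg _ _)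

theorem tsq_nonneg (f : ℂ → ℝ) (z : ℂ) : 0 ≤ tsq f z := add_nonneg (hsq_nonneg _ _) (hsq_nonneg _ _)

/-- The nonlinearity of the modulus equation. -/
def nlF (s φ : ℂ → ℝ) (z : ℂ) : ℝ := gsq φ z - gsq s z + (Real.exp (2 * s z) - 1 - 2 * s z)

/-- The nonlinearity of the phase equation. -/
def nlG (s φ : ℂ → ℝ) (z : ℂ) : ℝ := -2 * gdot s φ z

@[fun_prop]
theorem contDiff_nlG {s φ : ℂ → ℝ} (hs : ContDiff ℝ ∞ s) (hφ : ContDiff ℝ ∞ φ) :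
    ContDiff ℝ ∞ (nlG s φ) := by
  unfold nlG; fun_prop

/-- The hydrodynamic travelling-wave system for `log U = s + iφ` on an open set, together with
smallness of the unknowns and their gradients. -/
structure HydroSystem (c ε : ℝ) (Ω : Set ℂ) (s φ : ℂ → ℝ) : Prop where
  smooth_s : ContDiff ℝ ∞ s
  smooth_φ : ContDiff ℝ ∞ φ
  isOpen : IsOpen Ω
  eq_s : ∀ z ∈ Ω, lapR s z - 2 * s z - c * D 1 φ z = nlF s φ z
  eq_φ : ∀ z ∈ Ω, lapR φ z + c * D 1 s z = nlG s φ z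
  small_s : ∀ z ∈ Ω, |s z| ≤ ε
  small_φ : ∀ z ∈ Ω, |φ z| ≤ ε
  small_Ds : ∀ z ∈ Ω, ∀ j, |D j s z| ≤ ε
  small_Dφ : ∀ z ∈ Ω, ∀ j, |D j φ z| ≤ ε

/-- Quantitative ellipticity of the linearised system. -/
structure Elliptic (c μ : ℝ) : Prop where
  pos : 0 < μ
  le_one : μ ≤ 1
  sq_le : c ^ 2 ≤ 2
  coercive : ∀ x y : ℝ, μ * (x ^ 2 + y ^ 2) ≤ 2 * x ^ 2 + 2 * c * (x * y) + y ^ 2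

variable {c ε μ : ℝ} {Ω : Set ℂ} {s φ χ : ℂ → ℝ}

theorem Elliptic.divLE (hE : Elliptic c μ) {p q : ℂ → ℝ}
    (hp : ContDiff ℝ ∞ p) (hq : ContDiff ℝ ∞ q) (hχ : ContDiff ℝ ∞ χ)
    (hχc : HasCompactSupport χ) :
    DivLE (fun z => μ / 2 * (χ z ^ 2 * (p z ^ 2 + gsq p z + gsq q z)))
      (fun z => - (χ z ^ 2 * ((lapR p z - 2 * p z - c * D 1 q z) * p z
          + (lapR q z + c * D 1 p z) * q z))
      + 6 / μ * (gsq χ z * (p z ^ 2 + q z ^ 2))) := by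
  have hμ := hE.pos
  refine ⟨fun z => χ z ^ 2 * (p z * D 0 p z + q z * D 0 q z),
    fun z => χ z ^ 2 * (p z * D 1 p z + q z * D 1 q z + c * (p z * q z)), ?_, ?_, ?_, ?_,
    fun z => ?_⟩
  rotate_left 4
  · have := caccioppoli_pointwise (k := 2 / μ) hE.pos hE.le_one (by field_simp) hE.coercive
      hE.sq_le hp hq hχ z
    rw [show 3 * (2 / μ) = 6 / μ by ring] at this
    exact this
  · fun_prop
  · fun_prop
  · exact hasCompactSupport_of_eq_zero hχc fun z hz => by simp [hz]
  · exact hasCompactSupport_of_eq_zero hχc fun z hz => by simp [hz]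

theorem abs_exp_bounds {x : ℝ} (hε : |x| ≤ ε) (hε1 : ε ≤ 1 / 2) :
    |Real.exp (2 * x) - 1 - 2 * x| ≤ 4 * x ^ 2 ∧ |Real.exp (2 * x) - 1| ≤ 4 * ε ∧
      Real.exp (2 * x) ≤ 3 := by
  have h1 : |2 * x| ≤ 1 := by rw [abs_mul]; norm_num; linarith
  have h2 := Real.abs_exp_sub_one_le h1
  rw [abs_mul, abs_two] at h2
  refine ⟨by have := Real.abs_exp_sub_one_sub_id_le h1; nlinarith, by linarith, ?_⟩
  have := (abs_le.1 h2).2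
  linarith

theorem HydroSystem.divLE_zero (hE : Elliptic c μ) (hS : HydroSystem c ε Ω s φ)
    (hε : 10000 * ε ≤ μ) (hχ : ContDiff ℝ ∞ χ) (hχc : HasCompactSupport χ)
    (hχΩ : ∀ z, χ z ≠ 0 → z ∈ Ω) :
    DivLE (fun z => μ / 4 * (χ z ^ 2 * (s z ^ 2 + gsq s z + gsq φ z)))
      (fun z => 6 / μ * (gsq χ z * (s z ^ 2 + φ z ^ 2))) := by
  have hs := hS.smooth_s
  have hφ := hS.smooth_φ
  obtain ⟨F, G, hF, hG, hFc, hGc, h⟩ := hE.divLE hs hφ hχ hχc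
  refine ⟨F, G, hF, hG, hFc, hGc, fun z => ?_⟩
  have h := h z
  suffices H : - (χ z ^ 2 * ((lapR s z - 2 * s z - c * D 1 φ z) * s z
      + (lapR φ z + c * D 1 s z) * φ z)) ≤ μ / 4 * (χ z ^ 2 * (s z ^ 2 + gsq s z + gsq φ z)) by
    linarith
  by_cases hz : χ z = 0
  · simp [hz]
  have hz := hχΩ z hz
  simp only [hS.eq_s z hz, hS.eq_φ z hz]
  have e1 := hS.small_s z hz
  have e2 := hS.small_φ z hz
  have hε0 : 0 ≤ ε := (abs_nonneg _).trans e1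
  have hμ1 := hE.le_one
  obtain ⟨h1, -, -⟩ := abs_exp_bounds e1 (by linarith)
  have hf : |nlF s φ z| ≤ gsq φ z + gsq s z + 4 * s z ^ 2 := by
    unfold nlF
    have := gsq_nonneg φ z
    have := gsq_nonneg s z
    rw [abs_le] at h1 ⊢
    constructor <;> linarith
  have hg : |nlG s φ z| ≤ gsq φ z + gsq s z := by
    unfold nlG gdot gsq
    rw [abs_le]
    constructor <;> nlinarith [sq_nonneg (D 0 s z - D 0 φ z), sq_nonneg (D 1 s z - D 1 φ z),
      sq_nonneg (D 0 s z + D 0 φ z), sq_nonneg (D 1 s z + D 1 φ z)]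
  have hfs : |nlF s φ z * s z| ≤ (gsq φ z + gsq s z + 4 * s z ^ 2) * ε := by
    rw [abs_mul]; gcongr
    linarith [hf, abs_nonneg (nlF s φ z)]
  have hgφ : |nlG s φ z * φ z| ≤ (gsq φ z + gsq s z) * ε := by
    rw [abs_mul]; gcongr
    linarith [hg, abs_nonneg (nlG s φ z)]
  have key : -(nlF s φ z * s z + nlG s φ z * φ z)
      ≤ μ / 4 * (s z ^ 2 + gsq s z + gsq φ z) := by
    have := (abs_le.1 hfs).1
    have := (abs_le.1 hgφ).1
    have hA := gsq_nonneg φ z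
    have hB := gsq_nonneg s z
    nlinarith [mul_nonneg (sub_nonneg.2 hε) hA, mul_nonneg (sub_nonneg.2 hε) hB,
      mul_nonneg (sub_nonneg.2 hε) (sq_nonneg (s z)), mul_nonneg hε0 hA, mul_nonneg hε0 hB,
      mul_nonneg hε0 (sq_nonneg (s z))]
  have := mul_le_mul_of_nonneg_left key (sq_nonneg (χ z))
  linarith

end

section

variable {c ε μ : ℝ} {Ω : Set ℂ} {s φ χ : ℂ → ℝ}

theorem DivLE.absorb {A B A' B' : ℂ → ℝ} (h : DivLE A B)
    (h' : ∀ z, A' z + B z ≤ B' z + A z) : DivLE A' B' := by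
  obtain ⟨F, G, hF, hG, hFc, hGc, h⟩ := h
  exact ⟨F, G, hF, hG, hFc, hGc, fun z => by linarith [h z, h' z]⟩

theorem D_gdot {f g : ℂ → ℝ} (hf : ContDiff ℝ ∞ f) (hg : ContDiff ℝ ∞ g) (j : Fin 2) :
    D j (gdot f g) = fun z => gdot (D j f) g z + gdot f (D j g) z := by
  unfold gdot
  simp (disch := fun_prop) only [D_add, D_mul]
  rw [D_comm hf j 0, D_comm hf j 1, D_comm hg j 0, D_comm hg j 1]
  funext z
  ring

theorem gsq_eq_gdot (f : ℂ → ℝ) : gsq f = gdot f f := by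
  funext z; unfold gsq gdot; ring

theorem gdot_comm (f g : ℂ → ℝ) (z : ℂ) : gdot f g z = gdot g f z := by
  unfold gdot; ring

theorem D_nlF (hs : ContDiff ℝ ∞ s) (hφ : ContDiff ℝ ∞ φ) (j : Fin 2) :
    D j (nlF s φ) = fun z => 2 * gdot φ (D j φ) z - 2 * gdot s (D j s) z
      + 2 * ((Real.exp (2 * s z) - 1) * D j s z) := by
  unfold nlF
  rw [gsq_eq_gdot, gsq_eq_gdot]
  simp (disch := fun_prop) only [D_add, D_sub, D_mul, D_exp, D_const, D_gdot]
  funext z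
  simp only [gdot_comm (D j φ), gdot_comm (D j s)]
  ring

theorem D_nlG (hs : ContDiff ℝ ∞ s) (hφ : ContDiff ℝ ∞ φ) (j : Fin 2) :
    D j (nlG s φ) = fun z => -2 * (gdot φ (D j s) z + gdot s (D j φ) z) := by
  unfold nlG
  simp (disch := fun_prop) only [D_mul, D_const, D_gdot]
  funext z
  simp only [gdot_comm (D j s)]
  ring

theorem D_D_nlF (hs : ContDiff ℝ ∞ s) (hφ : ContDiff ℝ ∞ φ) (i j : Fin 2) :
    D i (D j (nlF s φ)) = fun z => 2 * gdot φ (D i (D j φ)) z - 2 * gdot s (D i (D j s)) z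
      + 2 * ((Real.exp (2 * s z) - 1) * D i (D j s) z)
      + (2 * gdot (D i φ) (D j φ) z - 2 * gdot (D i s) (D j s) z
        + 4 * (Real.exp (2 * s z) * (D i s z * D j s z))) := by
  rw [D_nlF hs hφ]
  simp (disch := fun_prop) only [D_add, D_sub, D_mul, D_exp, D_const, D_gdot]
  funext z
  ring

theorem D_lin_s {f p q : ℂ → ℝ} (hΩ : IsOpen Ω) (hp : ContDiff ℝ ∞ p) (hq : ContDiff ℝ ∞ q)
    (h : ∀ z ∈ Ω, lapR p z - 2 * p z - c * D 1 q z = f z) (j : Fin 2) :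
    ∀ z ∈ Ω, lapR (D j p) z - 2 * D j p z - c * D 1 (D j q) z = D j f z := by
  intro z hz
  rw [← D_eq_of_eqOn hΩ h j hz]
  simp (disch := fun_prop) only [D_sub, D_mul, D_const, D_lapR, D_comm hq j 1]
  ring

theorem D_lin_φ {f p q : ℂ → ℝ} (hΩ : IsOpen Ω) (hp : ContDiff ℝ ∞ p) (hq : ContDiff ℝ ∞ q)
    (h : ∀ z ∈ Ω, lapR q z + c * D 1 p z = f z) (j : Fin 2) :
    ∀ z ∈ Ω, lapR (D j q) z + c * D 1 (D j p) z = D j f z := by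
  intro z hz
  rw [← D_eq_of_eqOn hΩ h j hz]
  simp (disch := fun_prop) only [D_add, D_mul, D_const, D_lapR, D_comm hp j 1]
  ring

theorem abs_dot_mul_le {a b x y p : ℝ} (ha : |a| ≤ ε) (hb : |b| ≤ ε) :
    |(a * x + b * y) * p| ≤ ε * (x ^ 2 + y ^ 2 + p ^ 2) := by
  have h1 : |a * (x * p)| ≤ ε * ((x ^ 2 + p ^ 2) / 2) := by
    rw [abs_mul]
    refine mul_le_mul ha ?_ (abs_nonneg _) ((abs_nonneg _).trans ha)
    rw [abs_le]; constructor <;> nlinarith [sq_nonneg (x - p), sq_nonneg (x + p)]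
  have h2 : |b * (y * p)| ≤ ε * ((y ^ 2 + p ^ 2) / 2) := by
    rw [abs_mul]
    refine mul_le_mul hb ?_ (abs_nonneg _) ((abs_nonneg _).trans hb)
    rw [abs_le]; constructor <;> nlinarith [sq_nonneg (y - p), sq_nonneg (y + p)]
  have := abs_add_le (a * (x * p)) (b * (y * p))
  have h0 : 0 ≤ ε := (abs_nonneg _).trans ha
  have h3 : 0 ≤ ε * (x ^ 2 + y ^ 2) := by positivity
  rw [show (a * x + b * y) * p = a * (x * p) + b * (y * p) by ring]
  linarith

theorem abs_gdot_mul_le {f g : ℂ → ℝ} {z : ℂ} (h : ∀ j, |D j f z| ≤ ε) (p : ℝ) :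
    |gdot f g z * p| ≤ ε * (gsq g z + p ^ 2) := abs_dot_mul_le (h 0) (h 1)

theorem D_sq_le_gsq (f : ℂ → ℝ) (j : Fin 2) (z : ℂ) : D j f z ^ 2 ≤ gsq f z := by
  unfold gsq
  fin_cases j
  · exact le_add_of_nonneg_right (sq_nonneg _)
  · exact le_add_of_nonneg_left (sq_nonneg _)

theorem gsq_D_le_hsq (f : ℂ → ℝ) (j : Fin 2) (z : ℂ) : gsq (D j f) z ≤ hsq f z := by
  unfold hsq
  fin_cases j
  · exact le_add_of_nonneg_right (gsq_nonneg _ _)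
  · exact le_add_of_nonneg_left (gsq_nonneg _ _)

theorem HydroSystem.divLE_D (hE : Elliptic c μ) (hS : HydroSystem c ε Ω s φ)
    (hε : 10000 * ε ≤ μ) (hχ : ContDiff ℝ ∞ χ) (hχc : HasCompactSupport χ)
    (hχΩ : ∀ z, χ z ≠ 0 → z ∈ Ω) (j : Fin 2) :
    DivLE (fun z => μ / 2 * (χ z ^ 2 * (D j s z ^ 2 + gsq (D j s) z + gsq (D j φ) z)))
      (fun z => μ / 8 * (χ z ^ 2 * (gsq s z + hsq s z + hsq φ z))
        + 7 / μ * (gsq χ z * (D j s z ^ 2 + D j φ z ^ 2))) := by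
  have hs := hS.smooth_s
  have hφ := hS.smooth_φ
  refine (hE.divLE (contDiff_D hs j) (contDiff_D hφ j) hχ hχc).trans
    (.of_dir j (F := fun z => - (χ z ^ 2 * (nlG s φ z * D j φ z))) (by fun_prop)
      (hasCompactSupport_of_eq_zero hχc fun z hz => by simp [hz]) fun z => ?_)
  simp (disch := fun_prop) only [D_neg, D_mul, D_pow]
  have hX := gsq_nonneg χ z
  have hμ := hE.pos
  have hμ1 := hE.le_one
  have hinv : 1 ≤ 1 / μ := by rw [le_div_iff₀ hμ]; linarith
  have hPQ : 0 ≤ gsq χ z * (D j s z ^ 2 + D j φ z ^ 2) := by positivity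
  have h76 : 7 / μ * (gsq χ z * (D j s z ^ 2 + D j φ z ^ 2)) = 6 / μ *
      (gsq χ z * (D j s z ^ 2 + D j φ z ^ 2)) + 1 / μ *
      (gsq χ z * (D j s z ^ 2 + D j φ z ^ 2)) := by ring
  have h1P : 1 * (gsq χ z * (D j s z ^ 2 + D j φ z ^ 2)) ≤ 1 / μ *
      (gsq χ z * (D j s z ^ 2 + D j φ z ^ 2)) := by gcongr
  by_cases hz : χ z = 0
  · simp only [hz]
    norm_num
    linarith
  have hz := hχΩ z hz
  rw [D_lin_s hS.isOpen hs hφ hS.eq_s j z hz, D_lin_φ hS.isOpen hs hφ hS.eq_φ j z hz, D_nlF hs hφ]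
  have hε0 : 0 ≤ ε := (abs_nonneg _).trans (hS.small_s z hz)
  have b1 := abs_gdot_mul_le (g := D j φ) (hS.small_Dφ z hz) (D j s z)
  have b2 := abs_gdot_mul_le (g := D j s) (hS.small_Ds z hz) (D j s z)
  have b3 : |(Real.exp (2 * s z) - 1) * D j s z ^ 2| ≤ 4 * ε * D j s z ^ 2 := by
    rw [abs_mul, abs_of_nonneg (sq_nonneg (D j s z))]
    gcongr
    exact (abs_exp_bounds (hS.small_s z hz) (by linarith)).2.1
  have b4 := abs_gdot_mul_le (g := s) (hS.small_Dφ z hz) (D j (D j φ) z)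
  have b5 : |(D 0 φ z * (χ z * D 0 s z) + D 1 φ z * (χ z * D 1 s z)) * (D j χ z * D j φ z)|
      ≤ ε * ((χ z * D 0 s z) ^ 2 + (χ z * D 1 s z) ^ 2 + (D j χ z * D j φ z) ^ 2) :=
    abs_dot_mul_le (hS.small_Dφ z hz 0) (hS.small_Dφ z hz 1)
  have e5 : (D 0 φ z * (χ z * D 0 s z) + D 1 φ z * (χ z * D 1 s z)) * (D j χ z * D j φ z)
      = χ z * gdot φ s z * (D j χ z * D j φ z) := by unfold gdot; ring
  have e6 : (χ z * D 0 s z) ^ 2 + (χ z * D 1 s z) ^ 2 = χ z ^ 2 * gsq s z := by unfold gsq; ring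
  rw [e5, e6] at b5
  have hG : nlG s φ z = -2 * gdot φ s z := by unfold nlG; rw [gdot_comm]
  rw [hG]
  have c1 := D_sq_le_gsq s j z
  have c2 := D_sq_le_gsq χ j z
  have c3 := D_sq_le_gsq (D j φ) j z
  have c4 := gsq_D_le_hsq s j z
  have c5 := gsq_D_le_hsq φ j z
  have c6 : (D j χ z * D j φ z) ^ 2 ≤ gsq χ z * (D j s z ^ 2 + D j φ z ^ 2) := by
    rw [mul_pow]; gcongr; exact le_add_of_nonneg_left (sq_nonneg _)
  have hA := gsq_nonneg s z
  have hB := hsq_nonneg s z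
  have hC := hsq_nonneg φ z
  have hW : ε * (D j χ z * D j φ z) ^ 2 ≤ ε * (gsq χ z * (D j s z ^ 2 + D j φ z ^ 2)) := by gcongr
  have hW2 : 4 * ε * (gsq χ z * (D j s z ^ 2 + D j φ z ^ 2)) ≤
      1 * (gsq χ z * (D j s z ^ 2 + D j φ z ^ 2)) := by gcongr; linarith
  generalize gsq χ z * (D j s z ^ 2 + D j φ z ^ 2) = W at *
  have key : - ((2 * gdot φ (D j φ) z - 2 * gdot s (D j s) z
      + 2 * ((Real.exp (2 * s z) - 1) * D j s z)) * D j s z) - 2 * (gdot φ s z * D j (D j φ) z)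
      + 4 * ε * gsq s z ≤ μ / 8 * (gsq s z + hsq s z + hsq φ z) := by
    have d1 := (abs_le.1 b1).1
    have d2 := (abs_le.1 b2).2
    have d3 := (abs_le.1 b3).1
    have d4 := (abs_le.1 b4).1
    have f1 : ε * D j s z ^ 2 ≤ ε * gsq s z := by gcongr
    have f2 : ε * gsq (D j s) z ≤ ε * hsq s z := by gcongr
    have f3 : ε * gsq (D j φ) z ≤ ε * hsq φ z := by gcongr
    have f4 : ε * D j (D j φ) z ^ 2 ≤ ε * hsq φ z := by gcongr; linarith
    have f5 : 10000 * ε * (gsq s z + hsq s z + hsq φ z) ≤ μ * (gsq s z + hsq s z + hsq φ z) := by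
      gcongr
    have f6 := mul_nonneg hε0 hA
    have f7 := mul_nonneg hε0 hB
    have f8 := mul_nonneg hε0 hC
    linarith
  have key2 := mul_le_mul_of_nonneg_left key (sq_nonneg (χ z))
  have d5 := (abs_le.1 b5).1
  push_cast
  norm_num
  linarith [key2, d5, hW, hW2, h1P, h76]

theorem HydroSystem.divLE_one (hE : Elliptic c μ) (hS : HydroSystem c ε Ω s φ)
    (hε : 10000 * ε ≤ μ) (hχ : ContDiff ℝ ∞ χ) (hχc : HasCompactSupport χ)
    (hχΩ : ∀ z, χ z ≠ 0 → z ∈ Ω) :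
    DivLE (fun z => μ / 4 * (χ z ^ 2 * (gsq s z + hsq s z + hsq φ z)))
      (fun z => 7 / μ * (gsq χ z * (gsq s z + gsq φ z))) := by
  refine ((hS.divLE_D hE hε hχ hχc hχΩ 0).add (hS.divLE_D hE hε hχ hχc hχΩ 1)).absorb
    fun z => le_of_eq ?_
  unfold hsq
  simp only [gsq]
  ring

end

section

variable {c ε μ : ℝ} {Ω : Set ℂ} {s φ χ : ℂ → ℝ}

theorem gdot_sq_le (f g : ℂ → ℝ) (z : ℂ) : gdot f g z ^ 2 ≤ gsq f z * gsq g z := by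
  unfold gdot gsq
  linarith [sq_nonneg (D 0 f z * D 1 g z - D 1 f z * D 0 g z)]

theorem two_mul_abs_gdot_le (f g : ℂ → ℝ) (z : ℂ) : 2 * |gdot f g z| ≤ gsq f z + gsq g z := by
  have h1 := sq_nonneg (D 0 f z - D 0 g z)
  have h2 := sq_nonneg (D 1 f z - D 1 g z)
  have h3 := sq_nonneg (D 0 f z + D 0 g z)
  have h4 := sq_nonneg (D 1 f z + D 1 g z)
  rw [← abs_two, ← abs_mul, abs_le]
  unfold gdot gsq
  constructor <;> norm_num <;> linarith

/-- Sum of squares of quadratic gradient expressions. -/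
def quart (s φ : ℂ → ℝ) (z : ℂ) : ℝ := hsq φ z ^ 2 + hsq s z ^ 2 + gsq s z ^ 2

theorem quart_nonneg (s φ : ℂ → ℝ) (z : ℂ) : 0 ≤ quart s φ z := by unfold quart; positivity

theorem gagliardo_nirenberg_divLE {r : ℂ → ℝ} (hr : ContDiff ℝ ∞ r) (hχ : ContDiff ℝ ∞ χ)
    (hχc : HasCompactSupport χ) (hb : ∀ z, χ z ≠ 0 → |r z| ≤ ε) (j : Fin 2) :
    DivLE (fun z => χ z ^ 4 * D j r z ^ 4)
      (fun z => ε ^ 2 * (18 * (χ z ^ 4 * D j (D j r) z ^ 2)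
        + 32 * (χ z ^ 2 * gsq χ z * D j r z ^ 2))) := by
  refine .of_dir j (F := fun z => 2 * (χ z ^ 4 * (r z * D j r z ^ 3))) (by fun_prop)
    (hasCompactSupport_of_eq_zero hχc fun z hz => by simp [hz]) fun z => ?_
  refine (gagliardo_nirenberg_pointwise hr hχ j z).trans ?_
  gcongr ?_ + _
  by_cases hz : χ z = 0
  · simp [hz]
  have h1 : r z ^ 2 ≤ ε ^ 2 := sq_le_sq' (abs_le.1 (hb z hz)).1 (abs_le.1 (hb z hz)).2
  gcongr
  exact D_sq_le_gsq χ j z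

theorem HydroSystem.divLE_quart (hS : HydroSystem c ε Ω s φ)
    (hχ : ContDiff ℝ ∞ χ) (hχc : HasCompactSupport χ) (hχΩ : ∀ z, χ z ≠ 0 → z ∈ Ω) :
    DivLE (fun z => χ z ^ 4 * quart s φ z)
      (fun z => 128 * (ε ^ 2 * (χ z ^ 4 * (hsq s z + tsq s z + tsq φ z)
        + χ z ^ 2 * gsq χ z * (gsq s z + hsq s z + hsq φ z)))) := by
  have hs := hS.smooth_s
  have hφ := hS.smooth_φ
  have H1 := fun i j => gagliardo_nirenberg_divLE (contDiff_D hφ j) hχ hχc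
    (fun z hz => hS.small_Dφ z (hχΩ z hz) j) i
  have H2 := fun i j => gagliardo_nirenberg_divLE (contDiff_D hs j) hχ hχc
    (fun z hz => hS.small_Ds z (hχΩ z hz) j) i
  have H3 := fun i => gagliardo_nirenberg_divLE hs hχ hχc
    (fun z hz => hS.small_s z (hχΩ z hz)) i
  refine ((((((H1 0 0).add (H1 0 1)).add ((H1 1 0).add (H1 1 1))).add
    (((H2 0 0).add (H2 0 1)).add ((H2 1 0).add (H2 1 1)))).smul (a := 4) (by norm_num)).add
    (((H3 0).add (H3 1)).smul (a := 2) (by norm_num))).absorb fun z => ?_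
  have four : ∀ a b d e : ℝ, (a ^ 2 + b ^ 2 + (d ^ 2 + e ^ 2)) ^ 2
      ≤ 4 * (a ^ 4 + d ^ 4 + (b ^ 4 + e ^ 4)) := fun a b d e => by
    nlinarith [sq_nonneg (a ^ 2 - b ^ 2), sq_nonneg (a ^ 2 - d ^ 2), sq_nonneg (a ^ 2 - e ^ 2),
      sq_nonneg (b ^ 2 - d ^ 2), sq_nonneg (b ^ 2 - e ^ 2), sq_nonneg (d ^ 2 - e ^ 2)]
  have two : ∀ a b : ℝ, (a ^ 2 + b ^ 2) ^ 2 ≤ 2 * (a ^ 4 + b ^ 4) := fun a b => by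
    nlinarith [sq_nonneg (a ^ 2 - b ^ 2)]
  have q1 := four (D 0 (D 0 φ) z) (D 1 (D 0 φ) z) (D 0 (D 1 φ) z) (D 1 (D 1 φ) z)
  have q2 := four (D 0 (D 0 s) z) (D 1 (D 0 s) z) (D 0 (D 1 s) z) (D 1 (D 1 s) z)
  have q3 := two (D 0 s z) (D 1 s z)
  have hq : quart s φ z ≤ 4 * (D 0 (D 0 φ) z ^ 4 + D 0 (D 1 φ) z ^ 4
      + (D 1 (D 0 φ) z ^ 4 + D 1 (D 1 φ) z ^ 4) + (D 0 (D 0 s) z ^ 4 + D 0 (D 1 s) z ^ 4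
      + (D 1 (D 0 s) z ^ 4 + D 1 (D 1 s) z ^ 4))) + 2 * (D 0 s z ^ 4 + D 1 s z ^ 4) := by
    unfold quart hsq gsq
    linarith
  have hq' := mul_le_mul_of_nonneg_left hq (by positivity : 0 ≤ χ z ^ 4)
  have ht : ∀ f : ℂ → ℝ, D 0 (D 0 (D 0 f)) z ^ 2 + D 0 (D 0 (D 1 f)) z ^ 2
      + (D 1 (D 1 (D 0 f)) z ^ 2 + D 1 (D 1 (D 1 f)) z ^ 2) ≤ tsq f z := fun f => by
    unfold tsq hsq gsq
    nlinarith [sq_nonneg (D 1 (D 0 (D 0 f)) z), sq_nonneg (D 0 (D 1 (D 0 f)) z),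
      sq_nonneg (D 1 (D 0 (D 1 f)) z), sq_nonneg (D 0 (D 1 (D 1 f)) z)]
  have hh : D 0 (D 0 s) z ^ 2 + D 1 (D 1 s) z ^ 2 ≤ hsq s z := by
    unfold hsq gsq
    linarith [sq_nonneg (D 1 (D 0 s) z), sq_nonneg (D 0 (D 1 s) z)]
  have hE : ε ^ 2 * (χ z ^ 4 * (4 * 18 * (D 0 (D 0 (D 0 φ)) z ^ 2 + D 0 (D 0 (D 1 φ)) z ^ 2
      + (D 1 (D 1 (D 0 φ)) z ^ 2 + D 1 (D 1 (D 1 φ)) z ^ 2))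
      + 4 * 18 * (D 0 (D 0 (D 0 s)) z ^ 2 + D 0 (D 0 (D 1 s)) z ^ 2
      + (D 1 (D 1 (D 0 s)) z ^ 2 + D 1 (D 1 (D 1 s)) z ^ 2))
      + 2 * 18 * (D 0 (D 0 s) z ^ 2 + D 1 (D 1 s) z ^ 2)))
      ≤ ε ^ 2 * (χ z ^ 4 * (128 * (hsq s z + tsq s z + tsq φ z))) := by
    have := ht φ
    have := ht s
    have := hsq_nonneg s z
    have := tsq_nonneg s z
    have := tsq_nonneg φ z
    gcongr
    linarith
  have hg : 64 * (ε ^ 2 * (χ z ^ 2 * gsq χ z * gsq s z)) ≤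
      128 * (ε ^ 2 * (χ z ^ 2 * gsq χ z * gsq s z)) := by
    have h1 := gsq_nonneg χ z
    have h2 := gsq_nonneg s z
    gcongr
    norm_num
  have eφ : hsq φ z = D 0 (D 0 φ) z ^ 2 + D 0 (D 1 φ) z ^ 2
      + (D 1 (D 0 φ) z ^ 2 + D 1 (D 1 φ) z ^ 2) := by unfold hsq gsq; ring
  have es : hsq s z = D 0 (D 0 s) z ^ 2 + D 0 (D 1 s) z ^ 2
      + (D 1 (D 0 s) z ^ 2 + D 1 (D 1 s) z ^ 2) := by unfold hsq gsq; ring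
  have eg : gsq s z = D 0 s z ^ 2 + D 1 s z ^ 2 := rfl
  have eφ' := congrArg (fun t => ε ^ 2 * (χ z ^ 2 * gsq χ z * t)) eφ
  have es' := congrArg (fun t => ε ^ 2 * (χ z ^ 2 * gsq χ z * t)) es
  have eg' := congrArg (fun t => ε ^ 2 * (χ z ^ 2 * gsq χ z * t)) eg
  linarith

end

section

variable {c ε μ : ℝ} {Ω : Set ℂ} {s φ χ : ℂ → ℝ}

theorem HydroSystem.D_D_source_le (hS : HydroSystem c ε Ω s φ) (hμ : 0 < μ) (hμ1 : μ ≤ 1)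
    (hε : 10000 * ε ≤ μ) {z : ℂ} (hz : z ∈ Ω) (i j : Fin 2) :
    -(D i (D j (nlF s φ)) z * D i (D j s) z) ≤
      2 * ε * (gsq (D i (D j φ)) z + gsq (D i (D j s)) z) + (12 * ε + μ / 16) * D i (D j s) z ^ 2
        + 608 / μ * quart s φ z := by
  have hε0 : 0 ≤ ε := (abs_nonneg _).trans (hS.small_s z hz)
  rw [D_D_nlF hS.smooth_s hS.smooth_φ]
  beta_reduce
  obtain ⟨-, he1, he2⟩ := abs_exp_bounds (hS.small_s z hz) (by linarith)
  have b1 := (abs_le.1 (abs_gdot_mul_le (g := D i (D j φ)) (hS.small_Dφ z hz) (D i (D j s) z))).1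
  have b2 := (abs_le.1 (abs_gdot_mul_le (g := D i (D j s)) (hS.small_Ds z hz) (D i (D j s) z))).2
  have b3 : |(Real.exp (2 * s z) - 1) * D i (D j s) z ^ 2| ≤ 4 * ε * D i (D j s) z ^ 2 := by
    rw [abs_mul, abs_of_nonneg (sq_nonneg (D i (D j s) z))]
    gcongr
  have b3' := (abs_le.1 b3).1
  have g1 := two_mul_abs_gdot_le (D i φ) (D j φ) z
  have g2 := two_mul_abs_gdot_le (D i s) (D j s) z
  have g3 : |D i s z * D j s z| ≤ gsq s z := by
    have h1 := D_sq_le_gsq s i z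
    have h2 := D_sq_le_gsq s j z
    rw [abs_le]
    constructor <;> nlinarith [sq_nonneg (D i s z - D j s z), sq_nonneg (D i s z + D j s z)]
  have g4 : |Real.exp (2 * s z) * (D i s z * D j s z)| ≤ 3 * gsq s z := by
    rw [abs_mul, abs_of_pos (Real.exp_pos _)]
    gcongr
  have l1 := gsq_D_le_hsq φ i z
  have l2 := gsq_D_le_hsq φ j z
  have l3 := gsq_D_le_hsq s i z
  have l4 := gsq_D_le_hsq s j z
  have hbr : |2 * gdot (D i φ) (D j φ) z - 2 * gdot (D i s) (D j s) z
        + 4 * (Real.exp (2 * s z) * (D i s z * D j s z))|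
        ≤ 2 * hsq φ z + 2 * hsq s z + 12 * gsq s z := by
    obtain ⟨a1, a2⟩ := abs_le.1 (show |gdot (D i φ) (D j φ) z| ≤ hsq φ z by linarith)
    obtain ⟨a3, a4⟩ := abs_le.1 (show |gdot (D i s) (D j s) z| ≤ hsq s z by linarith)
    obtain ⟨a5, a6⟩ := abs_le.1 g4
    rw [abs_le]
    constructor <;> linarith
  have hbr2 := sq_le_sq' (abs_le.1 hbr).1 (abs_le.1 hbr).2
  have hq : (2 * hsq φ z + 2 * hsq s z + 12 * gsq s z) ^ 2 ≤ 152 * quart s φ z := by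
    unfold quart
    nlinarith [sq_nonneg (hsq φ z - hsq s z), sq_nonneg (6 * hsq φ z - gsq s z),
      sq_nonneg (6 * hsq s z - gsq s z)]
  generalize 2 * gdot (D i φ) (D j φ) z - 2 * gdot (D i s) (D j s) z
        + 4 * (Real.exp (2 * s z) * (D i s z * D j s z)) = br at *
  have w := two_mul_le_weighted (a := μ / 8) (b := 8 / μ) (by positivity) (by field_simp)
    (-D i (D j s) z) br
  have w2 : 8 / μ * br ^ 2 ≤ 8 / μ * (152 * quart s φ z) := by gcongr; exact hbr2.trans hq
  have e : 608 / μ * quart s φ z = 8 / μ * (152 * quart s φ z) / 2 := by ring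
  linarith

theorem gsq_sq (hχ : ContDiff ℝ ∞ χ) (z : ℂ) :
    gsq (fun z => χ z ^ 2) z = 4 * (χ z ^ 2 * gsq χ z) := by
  unfold gsq
  rw [D_pow hχ, D_pow hχ]
  push_cast
  norm_num
  ring

theorem HydroSystem.divLE_D_D (hE : Elliptic c μ) (hS : HydroSystem c ε Ω s φ)
    (hε : 10000 * ε ≤ μ) (hχ : ContDiff ℝ ∞ χ) (hχc : HasCompactSupport χ)
    (hχΩ : ∀ z, χ z ≠ 0 → z ∈ Ω) (i j : Fin 2) :
    DivLE (fun z => μ / 4 * (χ z ^ 4 * (D i (D j s) z ^ 2 + gsq (D i (D j s)) z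
        + gsq (D i (D j φ)) z)))
      (fun z => 10 * ε * (χ z ^ 4 * hsq s z) + 700 / μ * (χ z ^ 4 * quart s φ z)
        + 30 / μ * (χ z ^ 2 * gsq χ z * (D i (D j s) z ^ 2 + D i (D j φ) z ^ 2))) := by
  have hs := hS.smooth_s
  have hφ := hS.smooth_φ
  have hμ := hE.pos
  have hμ1 := hE.le_one
  have hinv : 1 ≤ 1 / μ := by rw [le_div_iff₀ hμ]; linarith
  have hω : HasCompactSupport (fun z => χ z ^ 2) :=
    hasCompactSupport_of_eq_zero hχc fun z hz => by simp [hz]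
  suffices H : DivLE (fun z => - ((χ z ^ 2) ^ 2 * ((lapR (D i (D j s)) z - 2 * D i (D j s) z
      - c * D 1 (D i (D j φ)) z) * D i (D j s) z
          + (lapR (D i (D j φ)) z + c * D 1 (D i (D j s)) z) * D i (D j φ) z)))
      (fun z => μ / 4 * (χ z ^ 4 * (D i (D j s) z ^ 2 + gsq (D i (D j s)) z
        + gsq (D i (D j φ)) z)) + 10 * ε * (χ z ^ 4 * hsq s z) + 700 / μ * (χ z ^ 4 * quart s φ z)
        + 5 * (χ z ^ 2 * gsq χ z * (D i (D j s) z ^ 2 + D i (D j φ) z ^ 2))) by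
    refine ((hE.divLE (contDiff_D (contDiff_D hs j) i) (contDiff_D (contDiff_D hφ j) i)
      (χ := fun z => χ z ^ 2) (by fun_prop) hω).add H).absorb fun z => ?_
    rw [gsq_sq hχ]
    have hW : 0 ≤ χ z ^ 2 * gsq χ z * (D i (D j s) z ^ 2 + D i (D j φ) z ^ 2) := by
      have := gsq_nonneg χ z
      positivity
    have := mul_le_mul_of_nonneg_right hinv hW
    have e1 : 30 / μ * (χ z ^ 2 * gsq χ z * (D i (D j s) z ^ 2 + D i (D j φ) z ^ 2)) =
      6 / μ * (4 * (χ z ^ 2 * gsq χ z) * (D i (D j s) z ^ 2 + D i (D j φ) z ^ 2)) +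
      6 * (1 / μ * (χ z ^ 2 * gsq χ z * (D i (D j s) z ^ 2 + D i (D j φ) z ^ 2))) := by ring
    linarith
  refine .of_dir i (F := fun z => - (χ z ^ 4 * (D j (nlG s φ) z * D i (D j φ) z))) (by fun_prop)
      (hasCompactSupport_of_eq_zero hχc fun z hz => by simp [hz]) fun z => ?_
  simp (disch := fun_prop) only [D_neg, D_mul, D_pow]
  by_cases hz : χ z = 0
  · simp [hz]
  have hz := hχΩ z hz
  rw [D_lin_s hS.isOpen (contDiff_D hs j) (contDiff_D hφ j)
    (D_lin_s hS.isOpen hs hφ hS.eq_s j) i z hz,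
    D_lin_φ hS.isOpen (contDiff_D hs j) (contDiff_D hφ j)
    (D_lin_φ hS.isOpen hs hφ hS.eq_φ j) i z hz]
  have hε0 : 0 ≤ ε := (abs_nonneg _).trans (hS.small_s z hz)
  have hP := mul_le_mul_of_nonneg_left (hS.D_D_source_le hμ hμ1 hε hz i j)
    (by positivity : 0 ≤ χ z ^ 4)
  have hG : D j (nlG s φ) z = -2 * (gdot φ (D j s) z + gdot s (D j φ) z) := by
    rw [D_nlG hs hφ]
  rw [hG]
  have hgd : gdot s (D j φ) z ^ 2 ≤ quart s φ z / 2 := by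
    have h1 := gdot_sq_le s (D j φ) z
    have h2 := gsq_D_le_hsq φ j z
    have h3 := gsq_nonneg s z
    have h4 : gsq s z * gsq (D j φ) z ≤ gsq s z * hsq φ z := by gcongr
    unfold quart
    nlinarith [sq_nonneg (gsq s z - hsq φ z), sq_nonneg (hsq s z)]
  have hχq : (χ z * D i χ z * D i (D j φ) z) ^ 2 ≤ χ z ^ 2 * gsq χ z
      * (D i (D j s) z ^ 2 + D i (D j φ) z ^ 2) := by
    rw [mul_pow, mul_pow]
    have := D_sq_le_gsq χ i z
    have := gsq_nonneg χ z
    gcongr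
    exact le_add_of_nonneg_left (sq_nonneg _)
  have l1 := gsq_D_le_hsq s j z
  have l2 := D_sq_le_gsq (D i (D j φ)) i z
  have k1 : |gdot φ (D j s) z * D i (D i (D j φ)) z| ≤ _ :=
    abs_gdot_mul_le (hS.small_Dφ z hz) _
  have k2 := two_mul_le_weighted (a := μ / 16) (b := 16 / μ) (by positivity) (by field_simp)
    (-D i (D i (D j φ)) z) (gdot s (D j φ) z)
  have k3 : 16 / μ * gdot s (D j φ) z ^ 2 ≤ 16 / μ * (quart s φ z / 2) := by gcongr
  have key : -2 * (gdot φ (D j s) z + gdot s (D j φ) z) * D i (D i (D j φ)) z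
      ≤ 2 * ε * hsq s z + (2 * ε + μ / 16) * gsq (D i (D j φ)) z + 8 / μ * quart s φ z := by
    have k1' := (abs_le.1 k1).1
    have f1 : ε * gsq (D j s) z ≤ ε * hsq s z := by gcongr
    have f2 : ε * D i (D i (D j φ)) z ^ 2 ≤ ε * gsq (D i (D j φ)) z := by gcongr
    have f3 : μ * D i (D i (D j φ)) z ^ 2 ≤ μ * gsq (D i (D j φ)) z := by gcongr
    have e : 8 / μ * quart s φ z = 16 / μ * (quart s φ z / 2) := by ring
    linarith
  have key' := mul_le_mul_of_nonneg_left key (by positivity : 0 ≤ χ z ^ 4)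
  have m1 : |(D 0 φ z * (χ z ^ 2 * D 0 (D j s) z) + D 1 φ z * (χ z ^ 2 * D 1 (D j s) z))
      * (χ z * D i χ z * D i (D j φ) z)| ≤ _ :=
    abs_dot_mul_le (hS.small_Dφ z hz 0) (hS.small_Dφ z hz 1)
  have m2 := two_mul_le_weighted (a := 1) (b := 1) (by norm_num) (by norm_num)
    (-(χ z * D i χ z * D i (D j φ) z)) (χ z ^ 2 * gdot s (D j φ) z)
  have m3 := mul_le_mul_of_nonneg_left hgd (by positivity : 0 ≤ χ z ^ 4)
  have m4 : ε * (χ z * D i χ z * D i (D j φ) z) ^ 2 ≤ 1 / 8 * (χ z * D i χ z * D i (D j φ) z) ^ 2 := by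
    gcongr; linarith
  have key2 : -(4 * χ z ^ 3 * D i χ z * (-2 * (gdot φ (D j s) z + gdot s (D j φ) z))
      * D i (D j φ) z) * (-1) ≤ 8 * ε * (χ z ^ 4 * hsq s z) + 2 * (χ z ^ 4 * quart s φ z)
      + 5 * (χ z ^ 2 * gsq χ z * (D i (D j s) z ^ 2 + D i (D j φ) z ^ 2)) := by
    have m1' := (abs_le.1 m1).1
    have e1 : ε * (χ z ^ 4 * gsq (D j s) z) ≤ ε * (χ z ^ 4 * hsq s z) := by gcongr
    have e2 : (D 0 φ z * (χ z ^ 2 * D 0 (D j s) z) + D 1 φ z * (χ z ^ 2 * D 1 (D j s) z))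
      * (χ z * D i χ z * D i (D j φ) z) = χ z ^ 3 * D i χ z * gdot φ (D j s) z * D i (D j φ) z := by
      unfold gdot; ring
    have e3 : (χ z ^ 2 * D 0 (D j s) z) ^ 2 + (χ z ^ 2 * D 1 (D j s) z) ^ 2
      = χ z ^ 4 * gsq (D j s) z := by unfold gsq; ring
    rw [e2, e3] at m1'
    linarith
  have hq := mul_nonneg (by positivity : 0 ≤ χ z ^ 4) (quart_nonneg s φ z)
  have hq' := mul_le_mul_of_nonneg_right hinv hq
  have eq1 : 700 / μ * (χ z ^ 4 * quart s φ z) = χ z ^ 4 * (608 / μ * quart s φ z)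
    + χ z ^ 4 * (8 / μ * quart s φ z) + 84 * (1 / μ * (χ z ^ 4 * quart s φ z)) := by ring
  have n1 : ε * (χ z ^ 4 * gsq (D i (D j s)) z) ≤ μ / 10000 * (χ z ^ 4 * gsq (D i (D j s)) z) := by
    have := gsq_nonneg (D i (D j s)) z
    gcongr; linarith
  have n2 : ε * (χ z ^ 4 * gsq (D i (D j φ)) z) ≤ μ / 10000 * (χ z ^ 4 * gsq (D i (D j φ)) z) := by
    have := gsq_nonneg (D i (D j φ)) z
    gcongr; linarith
  have n3 : ε * (χ z ^ 4 * D i (D j s) z ^ 2) ≤ μ / 10000 * (χ z ^ 4 * D i (D j s) z ^ 2) := by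
    gcongr; linarith
  have n4 : 0 ≤ μ * (χ z ^ 4 * gsq (D i (D j s)) z) := by
    have := gsq_nonneg (D i (D j s)) z
    positivity
  have n5 : 0 ≤ μ * (χ z ^ 4 * gsq (D i (D j φ)) z) := by
    have := gsq_nonneg (D i (D j φ)) z
    positivity
  have n6 : 0 ≤ μ * (χ z ^ 4 * D i (D j s) z ^ 2) := by positivity
  push_cast
  norm_num
  linarith

theorem HydroSystem.divLE_two (hE : Elliptic c μ) (hS : HydroSystem c ε Ω s φ)
    (hε0 : 0 ≤ ε) (hε : 10000 * ε ≤ μ) (hχ : ContDiff ℝ ∞ χ) (hχc : HasCompactSupport χ)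
    (hχΩ : ∀ z, χ z ≠ 0 → z ∈ Ω) :
    DivLE (fun z => μ / 8 * (χ z ^ 4 * (hsq s z + tsq s z + tsq φ z)))
      (fun z => 31 / μ * (χ z ^ 2 * gsq χ z * (gsq s z + hsq s z + hsq φ z))) := by
  have hμ := hE.pos
  have hμ1 := hE.le_one
  have H := hS.divLE_D_D hE hε hχ hχc hχΩ
  refine ((((H 0 0).add (H 0 1)).add ((H 1 0).add (H 1 1))).add
    ((hS.divLE_quart hχ hχc hχΩ).smul (a := 2800 / μ) (by positivity))).absorb fun z => ?_
  have e : hsq s z + tsq s z + tsq φ z = D 0 (D 0 s) z ^ 2 + gsq (D 0 (D 0 s)) z + gsq (D 0 (D 0 φ)) z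
      + (D 0 (D 1 s) z ^ 2 + gsq (D 0 (D 1 s)) z + gsq (D 0 (D 1 φ)) z)
      + (D 1 (D 0 s) z ^ 2 + gsq (D 1 (D 0 s)) z + gsq (D 1 (D 0 φ)) z)
      + (D 1 (D 1 s) z ^ 2 + gsq (D 1 (D 1 s)) z + gsq (D 1 (D 1 φ)) z) := by
    unfold tsq hsq
    simp only [gsq]
    ring
  have e' := congrArg (fun t => μ / 4 * (χ z ^ 4 * t)) e
  have eφ : hsq φ z = D 0 (D 0 φ) z ^ 2 + D 0 (D 1 φ) z ^ 2
      + (D 1 (D 0 φ) z ^ 2 + D 1 (D 1 φ) z ^ 2) := by unfold hsq gsq; ring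
  have es : hsq s z = D 0 (D 0 s) z ^ 2 + D 0 (D 1 s) z ^ 2
      + (D 1 (D 0 s) z ^ 2 + D 1 (D 1 s) z ^ 2) := by unfold hsq gsq; ring
  have ed := congrArg₂ (fun t u => 30 / μ * (χ z ^ 2 * gsq χ z * (t + u))) es eφ
  have hA := gsq_nonneg s z
  have hB := hsq_nonneg s z
  have hC := hsq_nonneg φ z
  have hT := tsq_nonneg s z
  have hT' := tsq_nonneg φ z
  have hX := gsq_nonneg χ z
  have hε2 : 2800 / μ * (128 * ε ^ 2) ≤ μ / 200 := by
    rw [div_mul_eq_mul_div, div_le_iff₀ hμ]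
    nlinarith [mul_le_mul hε hε (by positivity) hμ.le]
  have hε3 : μ / 200 ≤ 1 / μ := by
    rw [le_div_iff₀ hμ]; nlinarith
  have r1 : 2800 / μ * (128 * ε ^ 2) * (χ z ^ 4 * (hsq s z + tsq s z + tsq φ z))
      ≤ μ / 200 * (χ z ^ 4 * (hsq s z + tsq s z + tsq φ z)) := by gcongr
  have r2 : 2800 / μ * (128 * ε ^ 2) * (χ z ^ 2 * gsq χ z * (gsq s z + hsq s z + hsq φ z))
      ≤ 1 / μ * (χ z ^ 2 * gsq χ z * (gsq s z + hsq s z + hsq φ z)) := by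
    gcongr; exact hε2.trans hε3
  have r3 : 40 * ε * (χ z ^ 4 * hsq s z) ≤ μ / 200 * (χ z ^ 4 * (hsq s z + tsq s z + tsq φ z)) := by
    gcongr
    · linarith
    · linarith
  have r4 : 0 ≤ μ * (χ z ^ 4 * (hsq s z + tsq s z + tsq φ z)) := by positivity
  have r5 : 0 ≤ 30 / μ * (χ z ^ 2 * gsq χ z * gsq s z) := by positivity
  have s1 : 2800 / μ * (128 * (ε ^ 2 * (χ z ^ 4 * (hsq s z + tsq s z + tsq φ z)
        + χ z ^ 2 * gsq χ z * (gsq s z + hsq s z + hsq φ z)))) =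
      2800 / μ * (128 * ε ^ 2) * (χ z ^ 4 * (hsq s z + tsq s z + tsq φ z)) +
      2800 / μ * (128 * ε ^ 2) * (χ z ^ 2 * gsq χ z * (gsq s z + hsq s z + hsq φ z)) := by ring
  have s2 : 31 / μ * (χ z ^ 2 * gsq χ z * (gsq s z + hsq s z + hsq φ z)) =
      30 / μ * (χ z ^ 2 * gsq χ z * (hsq s z + hsq φ z)) + 30 / μ * (χ z ^ 2 * gsq χ z * gsq s z)
      + 1 / μ * (χ z ^ 2 * gsq χ z * (gsq s z + hsq s z + hsq φ z)) := by ring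
  have s3 : 2800 / μ * (χ z ^ 4 * quart s φ z) = 4 * (700 / μ * (χ z ^ 4 * quart s φ z)) := by ring
  rw [s1, s2, s3]
  linarith

end

section

/-- A fixed smooth bump, equal to `1` on the disc of radius `1/2` and supported in the unit disc. -/
def unitBump : ContDiffBump (0 : ℂ) := ⟨1 / 2, 1, by norm_num, by norm_num⟩

/-- The bump of radius `r` centred at `y`. -/
def cut (r : ℝ) (y z : ℂ) : ℝ := unitBump (r⁻¹ • (z - y))

theorem D_comp_smul_sub {f : ℂ → ℝ} (hf : ContDiff ℝ ∞ f) (a : ℝ) (y : ℂ) (j : Fin 2) :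
    D j (fun z => f (a • (z - y))) = fun z => a * D j f (a • (z - y)) := by
  funext z
  have h1 : HasFDerivAt (fun z : ℂ => a • (z - y)) (a • ContinuousLinearMap.id ℝ ℂ) z :=
    ((hasFDerivAt_id z).sub_const y).const_smul a
  have h2 := (diffAt hf (z := a • (z - y))).hasFDerivAt.comp z h1
  have h3 : fderiv ℝ (fun z => f (a • (z - y))) z = _ := h2.fderiv
  unfold D
  rw [h3]
  simp

theorem exists_bound_of_compactSupport {f : ℂ → ℝ} (hf : ContDiff ℝ ∞ f)
    (hc : HasCompactSupport f) : ∃ B, ∀ z, |f z| ≤ B :=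
  hf.continuous.bounded_above_of_compact_support hc

theorem contDiff_unitBump : ContDiff ℝ ∞ unitBump := unitBump.contDiff

@[fun_prop]
theorem contDiff_cut (r : ℝ) (y : ℂ) : ContDiff ℝ ∞ (cut r y) := by
  unfold cut
  exact contDiff_unitBump.comp (by fun_prop)

theorem cut_nonneg (r : ℝ) (y z : ℂ) : 0 ≤ cut r y z := unitBump.nonneg

theorem cut_le_one (r : ℝ) (y z : ℂ) : cut r y z ≤ 1 := unitBump.le_one

variable {r : ℝ} {y z : ℂ}

theorem cut_eq_one (hr : 0 < r) (h : ‖z - y‖ ≤ r / 2) : cut r y z = 1 := by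
  refine unitBump.one_of_mem_closedBall ?_
  rw [mem_closedBall_zero_iff, norm_smul, Real.norm_of_nonneg (inv_nonneg.2 hr.le)]
  change r⁻¹ * ‖z - y‖ ≤ 1 / 2
  rw [inv_mul_le_iff₀ hr]
  linarith

theorem cut_eq_zero (hr : 0 < r) (h : r ≤ ‖z - y‖) : cut r y z = 0 := by
  refine unitBump.zero_of_le_dist ?_
  rw [dist_zero_right, norm_smul, Real.norm_of_nonneg (inv_nonneg.2 hr.le)]
  change 1 ≤ r⁻¹ * ‖z - y‖
  rw [le_inv_mul_iff₀ hr]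
  linarith

theorem tsupport_cut_subset (hr : 0 < r) : tsupport (cut r y) ⊆ closedBall y r := by
  refine closure_minimal (fun z hz => ?_) isClosed_closedBall
  rw [mem_closedBall, dist_eq_norm]
  by_contra! h
  exact hz (cut_eq_zero hr h.le)

theorem hasCompactSupport_cut (hr : 0 < r) : HasCompactSupport (cut r y) :=
  (isCompact_closedBall y r).of_isClosed_subset (isClosed_tsupport _) (tsupport_cut_subset hr)

theorem D_cut_eq_zero (hr : 0 < r) (h : r < ‖z - y‖) (j : Fin 2) : D j (cut r y) z = 0 :=
  D_eq_zero_of_notMem (fun h' => by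
    have := tsupport_cut_subset hr h'
    rw [mem_closedBall, dist_eq_norm] at this
    linarith) j

theorem exists_cut_bounds : ∃ B : ℝ, 0 < B ∧ ∀ (r : ℝ) (y z : ℂ), 0 < r →
    (∀ j, |D j (cut r y) z| ≤ B / r) ∧ |D 1 (D 0 (cut r y)) z| ≤ B / r ^ 2 := by
  have hb := contDiff_unitBump
  have hc := unitBump.hasCompactSupport
  obtain ⟨B0, h0⟩ := exists_bound_of_compactSupport (contDiff_D hb 0) (hasCompactSupport_D hc 0)
  obtain ⟨B1, h1⟩ := exists_bound_of_compactSupport (contDiff_D hb 1) (hasCompactSupport_D hc 1)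
  obtain ⟨B2, h2⟩ := exists_bound_of_compactSupport (contDiff_D (contDiff_D hb 0) 1)
    (hasCompactSupport_D (hasCompactSupport_D hc 0) 1)
  have p0 := (abs_nonneg _).trans (h0 0)
  have p1 := (abs_nonneg _).trans (h1 0)
  have p2 := (abs_nonneg _).trans (h2 0)
  refine ⟨B0 + B1 + B2 + 1, by linarith, fun r y z hr => ⟨fun j => ?_, ?_⟩⟩
  · unfold cut
    rw [D_comp_smul_sub hb, abs_mul, abs_of_pos (inv_pos.2 hr), div_eq_inv_mul]
    gcongr
    fin_cases j
    · exact (h0 _).trans (by linarith)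
    · exact (h1 _).trans (by linarith)
  · unfold cut
    have hd : ContDiff ℝ ∞ (fun z => D 0 unitBump (r⁻¹ • (z - y))) :=
      (contDiff_D hb 0).comp (by fun_prop)
    rw [D_comp_smul_sub hb, D_mul contDiff_const hd, D_const, D_comp_smul_sub (contDiff_D hb 0)]
    simp only [zero_mul, zero_add]
    rw [abs_mul, abs_mul, abs_of_pos (inv_pos.2 hr), div_eq_inv_mul, ← mul_assoc]
    rw [show (r ^ 2)⁻¹ = r⁻¹ * r⁻¹ by rw [sq, mul_inv]]
    gcongr
    exact (h2 _).trans (by linarith)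

theorem gsq_cut_le {B : ℝ} (hB : ∀ j, |D j (cut r y) z| ≤ B / r) :
    gsq (cut r y) z ≤ 2 * B ^ 2 / r ^ 2 := by
  have h0 := sq_le_sq' (abs_le.1 (hB 0)).1 (abs_le.1 (hB 0)).2
  have h1 := sq_le_sq' (abs_le.1 (hB 1)).1 (abs_le.1 (hB 1)).2
  unfold gsq
  rw [div_pow] at h0 h1
  rw [mul_div_assoc]
  linarith

theorem gsq_cut_half_le {B : ℝ} (hr : 0 < r) (hB : ∀ j, |D j (cut (r / 2) y) z| ≤ B / (r / 2)) :
    gsq (cut (r / 2) y) z ≤ 8 * B ^ 2 / r ^ 2 * cut r y z ^ 2 := by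
  rcases le_or_gt ‖z - y‖ (r / 2) with h | h
  · rw [cut_eq_one hr h]
    refine (gsq_cut_le hB).trans (le_of_eq ?_)
    field_simp
    ring
  · unfold gsq
    rw [D_cut_eq_zero (by positivity) h, D_cut_eq_zero (by positivity) h]
    simp only [ne_eq, OfNat.ofNat_ne_zero, not_false_eq_true, zero_pow, add_zero]
    positivity

theorem integral_indicator_closedBall_const (hr : 0 < r) (a : ℝ) :
    ∫ z, (closedBall y r).indicator (fun _ => a) z = Real.pi * r ^ 2 * a := by
  rw [integral_indicator measurableSet_closedBall, setIntegral_const, Measure.real,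
    Complex.volume_closedBall, smul_eq_mul]
  congr 1
  simp [ENNReal.toReal_ofReal hr.le]
  ring

theorem integral_cut_sq_le (hr : 0 < r) : ∫ z, cut r y z ^ 2 ≤ Real.pi * r ^ 2 := by
  rw [← mul_one (Real.pi * r ^ 2), ← integral_indicator_closedBall_const (y := y) hr]
  refine integral_mono_of_nonneg (Eventually.of_forall fun z => by positivity)
    ((integrable_indicator_iff measurableSet_closedBall).2
      (integrableOn_const measure_closedBall_lt_top.ne))
    (Eventually.of_forall fun z => ?_)
  by_cases h : z ∈ closedBall y r
  · simp only [Set.indicator_of_mem h]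
    exact pow_le_one₀ (cut_nonneg _ _ _) (cut_le_one _ _ _)
  · simp only [Set.indicator_of_notMem h]
    rw [mem_closedBall, dist_eq_norm, not_le] at h
    simp [cut_eq_zero hr h.le]

end

section

theorem abs_D_D_cut_mul_le {B lam R : ℝ} {y : ℂ} (hB0 : 0 < B) (hR : 0 < R) (hlam : 0 < lam)
    (hB : ∀ z, (∀ j, |D j (cut (R / 8) y) z| ≤ B / (R / 8)) ∧
      |D 1 (D 0 (cut (R / 8) y)) z| ≤ B / (R / 8) ^ 2) {g : ℂ → ℝ} (hg : ContDiff ℝ ∞ g) (z : ℂ) :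
    |D 1 (D 0 (fun z => cut (R / 8) y z * g z)) z| ≤ (64 * B + 1) * (2 * lam * cut R y z ^ 2
      + lam⁻¹ * ((R ^ 4)⁻¹ * (cut R y z ^ 2 * g z ^ 2) + (R ^ 2)⁻¹ * (cut (R / 2) y z ^ 2 * gsq g z)
        + cut (R / 4) y z ^ 4 * hsq g z)) := by
  have hnn : 0 ≤ gsq g z ∧ 0 ≤ hsq g z := ⟨gsq_nonneg _ _, hsq_nonneg _ _⟩
  rcases le_or_gt ‖z - y‖ (R / 8) with h | h
  · rw [cut_eq_one (r := R) hR (by linarith), cut_eq_one (r := R / 2) (by positivity) (by linarith),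
      cut_eq_one (r := R / 4) (by positivity) (by linarith)]
    have hexp : D 1 (D 0 (fun z => cut (R / 8) y z * g z)) z =
        D 1 (D 0 (cut (R / 8) y)) z * g z + D 0 (cut (R / 8) y) z * D 1 g z
        + D 1 (cut (R / 8) y) z * D 0 g z + cut (R / 8) y z * D 1 (D 0 g) z := by
      simp (disch := fun_prop) only [D_mul, D_add]
      ring
    obtain ⟨h1, h2⟩ := hB z
    have h10 := h1 0
    have h11 := h1 1
    have hle : |D 1 (D 0 (fun z => cut (R / 8) y z * g z)) z| ≤ (64 * B + 1) *
        ((R ^ 2)⁻¹ * |g z| + R⁻¹ * |D 1 g z| + R⁻¹ * |D 0 g z| + |D 1 (D 0 g) z|) := by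
      rw [hexp]
      have t1 : |D 1 (D 0 (cut (R / 8) y)) z * g z| ≤ (64 * B + 1) * ((R ^ 2)⁻¹ * |g z|) := by
        rw [abs_mul, ← mul_assoc]
        gcongr
        refine h2.trans ?_
        rw [div_pow, div_div_eq_mul_div, div_eq_mul_inv]
        gcongr
        linarith
      have t2 : ∀ j (x : ℝ), |D j (cut (R / 8) y) z * x| ≤ (64 * B + 1) * (R⁻¹ * |x|) := by
        intro j x
        rw [abs_mul, ← mul_assoc]
        gcongr
        refine (h1 j).trans ?_
        rw [div_div_eq_mul_div, div_eq_mul_inv]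
        gcongr
        linarith
      have t4 : |cut (R / 8) y z * D 1 (D 0 g) z| ≤ (64 * B + 1) * |D 1 (D 0 g) z| := by
        rw [abs_mul, abs_of_nonneg (cut_nonneg _ _ _)]
        gcongr
        linarith [cut_le_one (R / 8) y z]
      have a1 := abs_add_le (D 1 (D 0 (cut (R / 8) y)) z * g z + D 0 (cut (R / 8) y) z * D 1 g z
        + D 1 (cut (R / 8) y) z * D 0 g z) (cut (R / 8) y z * D 1 (D 0 g) z)
      have a2 := abs_add_le (D 1 (D 0 (cut (R / 8) y)) z * g z + D 0 (cut (R / 8) y) z * D 1 g z)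
        (D 1 (cut (R / 8) y) z * D 0 g z)
      have a3 := abs_add_le (D 1 (D 0 (cut (R / 8) y)) z * g z) (D 0 (cut (R / 8) y) z * D 1 g z)
      linarith [t2 0 (D 1 g z), t2 1 (D 0 g z)]
    refine hle.trans (mul_le_mul_of_nonneg_left ?_ (by positivity))
    have w : ∀ x : ℝ, 2 * |x| ≤ lam + lam⁻¹ * x ^ 2 := fun x => by
      have := two_mul_le_weighted hlam (mul_inv_cancel₀ hlam.ne') 1 |x|
      rw [sq_abs] at this
      linarith
    have w1 := w ((R ^ 2)⁻¹ * g z)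
    have w2 := w (R⁻¹ * D 1 g z)
    have w3 := w (R⁻¹ * D 0 g z)
    have w4 := w (D 1 (D 0 g) z)
    rw [abs_mul, abs_of_pos (by positivity : 0 < (R ^ 2)⁻¹)] at w1
    rw [abs_mul, abs_of_pos (by positivity : 0 < R⁻¹)] at w2 w3
    have hh : lam⁻¹ * D 1 (D 0 g) z ^ 2 ≤ lam⁻¹ * hsq g z := by
      gcongr
      exact (D_sq_le_gsq (D 0 g) 1 z).trans (gsq_D_le_hsq g 0 z)
    have p1 : 0 ≤ lam⁻¹ * ((R ^ 4)⁻¹ * g z ^ 2) := by positivity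
    have p2 : 0 ≤ lam⁻¹ * ((R ^ 2)⁻¹ * gsq g z) := by have := hnn.1; positivity
    have p3 : 0 ≤ lam⁻¹ * hsq g z := by have := hnn.2; positivity
    have e1 : ((R ^ 2)⁻¹ * g z) ^ 2 = (R ^ 4)⁻¹ * g z ^ 2 := by
      rw [mul_pow, inv_pow, ← pow_mul]
    have e2 : lam⁻¹ * (R⁻¹ * D 1 g z) ^ 2 + lam⁻¹ * (R⁻¹ * D 0 g z) ^ 2
        = lam⁻¹ * ((R ^ 2)⁻¹ * gsq g z) := by
      unfold gsq; rw [mul_pow, mul_pow, inv_pow]; ring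
    rw [e1] at w1
    linarith
  · have hopen : IsOpen {w : ℂ | R / 8 < ‖w - y‖} :=
      isOpen_lt continuous_const (by fun_prop)
    have e0 : ∀ w ∈ {w : ℂ | R / 8 < ‖w - y‖},
        (fun z => cut (R / 8) y z * g z) w = (fun _ => (0 : ℝ)) w := fun w hw => by
      simp [cut_eq_zero (by positivity) (le_of_lt hw)]
    have e1 : ∀ w ∈ {w : ℂ | R / 8 < ‖w - y‖},
        D 0 (fun z => cut (R / 8) y z * g z) w = (fun _ => (0 : ℝ)) w := fun w hw => by
      rw [D_eq_of_eqOn hopen e0 0 hw, D_const]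
    rw [D_eq_of_eqOn hopen e1 1 h, D_const, abs_zero]
    have := hnn.1
    have := hnn.2
    positivity

/-- Scale-invariant Sobolev inequality in localised form. -/
theorem exists_scaled_sobolev : ∃ C : ℝ, 0 < C ∧ ∀ (g : ℂ → ℝ) (y : ℂ) (R m K : ℝ),
    ContDiff ℝ ∞ g → 0 < R → 0 < m → 0 ≤ K →
    ∫ z, cut R y z ^ 2 * g z ^ 2 ≤ K * m ^ 2 →
    ∫ z, cut (R / 2) y z ^ 2 * gsq g z ≤ K * m ^ 2 / R ^ 2 →
    ∫ z, cut (R / 4) y z ^ 4 * hsq g z ≤ K * m ^ 2 / R ^ 4 →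
    |g y| ≤ C * (1 + K) * (m / R) := by
  obtain ⟨B, hB0, hB⟩ := exists_cut_bounds
  refine ⟨8 * (64 * B + 1), by positivity, fun g y R m K hg hR hm hK h0 h1 h2 => ?_⟩
  have hc : ∀ r : ℝ, 0 < r → HasCompactSupport (cut r y) := fun r hr => hasCompactSupport_cut hr
  have key := abs_le_integral_abs_D_D (g := fun z => cut (R / 8) y z * g z) (by fun_prop)
    ((hc _ (by positivity)).mul_right) y
  rw [cut_eq_one (by positivity) (by simp; positivity), one_mul] at key
  set lam := m / R ^ 3 with hlam
  have hlam0 : 0 < lam := by positivity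
  have i1 : Integrable (fun z => cut R y z ^ 2) := integrable_of_smooth (by fun_prop)
    (hasCompactSupport_of_eq_zero (hc R hR) fun z hz => by simp [hz])
  have i2 : Integrable (fun z => cut R y z ^ 2 * g z ^ 2) := integrable_of_smooth (by fun_prop)
    (hasCompactSupport_of_eq_zero (hc R hR) fun z hz => by simp [hz])
  have i3 : Integrable (fun z => cut (R / 2) y z ^ 2 * gsq g z) := integrable_of_smooth
    (by fun_prop) (hasCompactSupport_of_eq_zero (hc (R / 2) (by positivity)) fun z hz => by simp [hz])
  have i4 : Integrable (fun z => cut (R / 4) y z ^ 4 * hsq g z) := integrable_of_smooth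
    (by fun_prop) (hasCompactSupport_of_eq_zero (hc (R / 4) (by positivity)) fun z hz => by simp [hz])
  have i5 : Integrable (fun z => (R ^ 4)⁻¹ * (cut R y z ^ 2 * g z ^ 2)
      + (R ^ 2)⁻¹ * (cut (R / 2) y z ^ 2 * gsq g z)) :=
    (i2.const_mul (R ^ 4)⁻¹).add (i3.const_mul (R ^ 2)⁻¹)
  have i6 : Integrable (fun z => lam⁻¹ * ((R ^ 4)⁻¹ * (cut R y z ^ 2 * g z ^ 2)
      + (R ^ 2)⁻¹ * (cut (R / 2) y z ^ 2 * gsq g z) + cut (R / 4) y z ^ 4 * hsq g z)) :=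
    (i5.add i4).const_mul lam⁻¹
  have hmono := integral_mono_of_nonneg (μ := volume)
    (Eventually.of_forall fun z => abs_nonneg (D 1 (D 0 (fun z => cut (R / 8) y z * g z)) z))
    (((i1.const_mul (2 * lam)).add i6).const_mul (64 * B + 1))
    (Eventually.of_forall fun z => abs_D_D_cut_mul_le hB0 hR hlam0
      (fun z => hB (R / 8) y z (by positivity)) hg z)
  have e : ∫ z, (64 * B + 1) * (2 * lam * cut R y z ^ 2
      + lam⁻¹ * ((R ^ 4)⁻¹ * (cut R y z ^ 2 * g z ^ 2) + (R ^ 2)⁻¹ * (cut (R / 2) y z ^ 2 * gsq g z)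
        + cut (R / 4) y z ^ 4 * hsq g z)) = (64 * B + 1) * (2 * lam * (∫ z, cut R y z ^ 2)
      + lam⁻¹ * ((R ^ 4)⁻¹ * (∫ z, cut R y z ^ 2 * g z ^ 2)
        + (R ^ 2)⁻¹ * (∫ z, cut (R / 2) y z ^ 2 * gsq g z)
        + ∫ z, cut (R / 4) y z ^ 4 * hsq g z)) := by
    rw [integral_const_mul, integral_add (i1.const_mul (2 * lam)) i6,
      integral_const_mul, integral_const_mul, integral_add i5 i4,
      integral_add (i2.const_mul (R ^ 4)⁻¹) (i3.const_mul (R ^ 2)⁻¹),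
      integral_const_mul, integral_const_mul]
  refine key.trans (hmono.trans ?_)
  refine (le_of_eq e).trans ?_
  have hpi : ∫ z, cut R y z ^ 2 ≤ 4 * R ^ 2 :=
    (integral_cut_sq_le hR).trans (by gcongr; exact Real.pi_le_four)
  calc _ ≤ (64 * B + 1) * (2 * lam * (4 * R ^ 2) + lam⁻¹ * ((R ^ 4)⁻¹ * (K * m ^ 2)
        + (R ^ 2)⁻¹ * (K * m ^ 2 / R ^ 2) + K * m ^ 2 / R ^ 4)) := by gcongr
    _ = (64 * B + 1) * ((8 + 3 * K) * (m / R)) := by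
      rw [hlam]; field_simp; ring
    _ ≤ 8 * (64 * B + 1) * (1 + K) * (m / R) := by
      rw [mul_comm 8, mul_assoc, mul_assoc, ← mul_assoc 8]
      gcongr
      linarith

end

section

variable {c ε μ : ℝ} {s φ : ℂ → ℝ}

theorem integral_le_of_ball {f g h : ℂ → ℝ} {y : ℂ} {R a : ℝ} (hR : 0 < R)
    (hf : ∀ z, 0 ≤ f z) (hgh : Integrable g) (hh : ∀ z, f z ≤ g z + h z)
    (hb : ∀ z, h z ≤ (closedBall y R).indicator (fun _ => a) z) :
    ∫ z, f z ≤ (∫ z, g z) + Real.pi * R ^ 2 * a := by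
  have hi : Integrable ((closedBall y R).indicator (fun _ : ℂ => a)) :=
    (integrable_indicator_iff measurableSet_closedBall).2
      (integrableOn_const measure_closedBall_lt_top.ne)
  rw [← integral_indicator_closedBall_const (y := y) hR, ← integral_add hgh hi]
  exact integral_mono_of_nonneg (Eventually.of_forall hf) (hgh.add hi)
    (Eventually.of_forall fun z => (hh z).trans (add_le_add le_rfl (hb z)))

theorem HydroSystem.energy_levels {R1 : ℝ} (hE : Elliptic c μ)
    (hS : HydroSystem c ε {z | R1 < ‖z‖} s φ) (hε0 : 0 ≤ ε) (hε : 10000 * ε ≤ μ)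
    (hint : IntegrableOn (fun z => s z ^ 2) {z | R1 < ‖z‖}) :
    ∃ K : ℝ, 0 ≤ K ∧ ∀ (y : ℂ) (R σ m : ℝ), 1 ≤ R → R1 + R < ‖y‖ → 0 ≤ σ → σ ≤ m → R⁻¹ ≤ m →
      (∀ z, ‖z - y‖ ≤ R → |φ z| ≤ σ) →
      ∫ z, cut R y z ^ 2 * (s z ^ 2 + gsq s z + gsq φ z) ≤ K * m ^ 2 ∧
      ∫ z, cut (R / 2) y z ^ 2 * (gsq s z + hsq s z + hsq φ z) ≤ K * m ^ 2 / R ^ 2 ∧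
      ∫ z, cut (R / 4) y z ^ 4 * (hsq s z + tsq s z + tsq φ z) ≤ K * m ^ 2 / R ^ 4 := by
  obtain ⟨B, hB0, hB⟩ := exists_cut_bounds
  have hs := hS.smooth_s
  have hφ := hS.smooth_φ
  have hμ := hE.pos
  set S := ∫ z in {z : ℂ | R1 < ‖z‖}, s z ^ 2 with hSdef
  have hΩm : MeasurableSet {z : ℂ | R1 < ‖z‖} := hS.isOpen.measurableSet
  have hS0 : 0 ≤ S := setIntegral_nonneg hΩm fun z _ => by positivity
  set K0 := 4 / μ * (6 / μ * (2 * B ^ 2 * (S + Real.pi))) with hK0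
  set K1 := 4 / μ * (7 / μ * (8 * B ^ 2 * K0)) with hK1
  set K2 := 8 / μ * (31 / μ * (32 * B ^ 2 * K1)) with hK2
  have hpi := Real.pi_pos
  have k0 : 0 ≤ K0 := by positivity
  have k1 : 0 ≤ K1 := by positivity
  have k2 : 0 ≤ K2 := by positivity
  refine ⟨K0 + K1 + K2, by positivity, fun y R σ m hR hy hσ hσm hRm hφσ => ?_⟩
  have hR0 : 0 < R := by linarith
  have hm : 0 < m := (inv_pos.2 hR0).trans_le hRm
  have hsupp : ∀ r, 0 < r → r ≤ R → ∀ z, cut r y z ≠ 0 → z ∈ {z : ℂ | R1 < ‖z‖} := by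
    intro r hr hrR z hz
    have h1 : ‖z - y‖ < r := by
      by_contra! h
      exact hz (cut_eq_zero hr h)
    have h2 := norm_sub_norm_le y z
    rw [norm_sub_rev] at h2
    change R1 < ‖z‖
    linarith
  have hc : ∀ r : ℝ, 0 < r → HasCompactSupport (cut r y) := fun r hr => hasCompactSupport_cut hr
  have hr2 : 0 < R / 2 := by positivity
  have hr4 : 0 < R / 4 := by positivity
  have gc : ∀ r : ℝ, 0 < r → HasCompactSupport (gsq (cut r y)) := fun r hr => by
    unfold gsq
    have h0 := hasCompactSupport_D (hc r hr) 0
    have h1 := hasCompactSupport_D (hc r hr) 1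
    exact (hasCompactSupport_of_eq_zero h0 fun z hz => by simp [hz]).add
      (hasCompactSupport_of_eq_zero h1 fun z hz => by simp [hz])
  have I0 : Integrable (fun z => cut R y z ^ 2 * (s z ^ 2 + gsq s z + gsq φ z)) :=
    integrable_of_smooth (by fun_prop)
      (hasCompactSupport_of_eq_zero (hc R hR0) fun z hz => by simp [hz])
  have J0 : Integrable (fun z => gsq (cut R y) z * (s z ^ 2 + φ z ^ 2)) :=
    integrable_of_smooth (by fun_prop) (gc R hR0).mul_right
  have I1 : Integrable (fun z => cut (R / 2) y z ^ 2 * (gsq s z + hsq s z + hsq φ z)) :=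
    integrable_of_smooth (by fun_prop)
      (hasCompactSupport_of_eq_zero (hc (R / 2) hr2) fun z hz => by simp [hz])
  have J1 : Integrable (fun z => gsq (cut (R / 2) y) z * (gsq s z + gsq φ z)) :=
    integrable_of_smooth (by fun_prop) (gc (R / 2) hr2).mul_right
  have I2 : Integrable (fun z => cut (R / 4) y z ^ 4 * (hsq s z + tsq s z + tsq φ z)) :=
    integrable_of_smooth (by fun_prop)
      (hasCompactSupport_of_eq_zero (hc (R / 4) hr4) fun z hz => by simp [hz])
  have J2 : Integrable (fun z => cut (R / 4) y z ^ 2 * gsq (cut (R / 4) y) z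
      * (gsq s z + hsq s z + hsq φ z)) :=
    integrable_of_smooth (by fun_prop) ((gc (R / 4) hr4).mul_left).mul_right
  have L0 := (hS.divLE_zero hE hε (by fun_prop) (hc R hR0) (hsupp R hR0 le_rfl)).integral_le
    (I0.const_mul _) (J0.const_mul _)
  have L1 := (hS.divLE_one hE hε (by fun_prop) (hc (R / 2) hr2)
    (hsupp (R / 2) hr2 (by linarith))).integral_le (I1.const_mul _) (J1.const_mul _)
  have L2 := (hS.divLE_two hE hε0 hε (by fun_prop) (hc (R / 4) hr4)
    (hsupp (R / 4) hr4 (by linarith))).integral_le (I2.const_mul _) (J2.const_mul _)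
  rw [integral_const_mul, integral_const_mul] at L0 L1 L2
  have hsqm : ∀ x : ℝ, x ∈ Set.Icc 0 m → x ^ 2 ≤ m ^ 2 := fun x hx => by
    have := hx.1
    have := hx.2
    gcongr
  have B0 : ∫ z, gsq (cut R y) z * (s z ^ 2 + φ z ^ 2) ≤ 2 * B ^ 2 * (S + Real.pi) * m ^ 2 := by
    have hgi : Integrable ({z : ℂ | R1 < ‖z‖}.indicator fun z => 2 * B ^ 2 / R ^ 2 * s z ^ 2) :=
      (integrable_indicator_iff hΩm).2 (hint.const_mul _)
    have hbd : ∀ z, gsq (cut R y) z ≤ 2 * B ^ 2 / R ^ 2 := fun z => gsq_cut_le (hB R y z hR0).1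
    have hout : ∀ z, R < ‖z - y‖ → gsq (cut R y) z = 0 := fun z hz => by
      unfold gsq; simp [D_cut_eq_zero hR0 hz]
    have := integral_le_of_ball (f := fun z => gsq (cut R y) z * (s z ^ 2 + φ z ^ 2))
      (h := fun z => gsq (cut R y) z * φ z ^ 2) (y := y) (a := 2 * B ^ 2 / R ^ 2 * σ ^ 2)
      hR0 (fun z => by have := gsq_nonneg (cut R y) z; positivity) hgi
      (fun z => by
        rw [mul_add]
        gcongr
        rcases le_or_gt ‖z - y‖ R with h | h
        · have h2 := norm_sub_norm_le y z
          rw [norm_sub_rev] at h2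
          rw [Set.indicator_of_mem (show z ∈ {z : ℂ | R1 < ‖z‖} by change R1 < ‖z‖; linarith)]
          have := hbd z
          gcongr
        · rw [hout z h, zero_mul]
          exact Set.indicator_nonneg (fun z _ => by positivity) z)
      (fun z => by
        rcases le_or_gt ‖z - y‖ R with h | h
        · rw [Set.indicator_of_mem (by rwa [mem_closedBall, dist_eq_norm])]
          have h1 := hbd z
          have h2 := sq_le_sq' (abs_le.1 (hφσ z h)).1 (abs_le.1 (hφσ z h)).2
          have h3 := gsq_nonneg (cut R y) z
          gcongr
        · rw [hout z h, zero_mul]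
          exact Set.indicator_nonneg (fun z _ => by positivity) z)
    refine this.trans ?_
    rw [integral_indicator hΩm, integral_const_mul, ← hSdef]
    have h1 := hsqm _ ⟨by positivity, hRm⟩
    have h2 := hsqm _ ⟨hσ, hσm⟩
    calc _ = 2 * B ^ 2 * (S * R⁻¹ ^ 2 + Real.pi * σ ^ 2) := by field_simp
      _ ≤ 2 * B ^ 2 * (S * m ^ 2 + Real.pi * m ^ 2) := by gcongr
      _ = _ := by ring
  have E0 : ∫ z, cut R y z ^ 2 * (s z ^ 2 + gsq s z + gsq φ z) ≤ K0 * m ^ 2 := by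
    calc _ = 4 / μ * (μ / 4 * ∫ z, cut R y z ^ 2 * (s z ^ 2 + gsq s z + gsq φ z)) := by field_simp
      _ ≤ 4 / μ * (6 / μ * (2 * B ^ 2 * (S + Real.pi) * m ^ 2)) := by
        refine mul_le_mul_of_nonneg_left (L0.trans ?_) (by positivity)
        gcongr
      _ = _ := by rw [hK0]; ring
  have E1 : ∫ z, cut (R / 2) y z ^ 2 * (gsq s z + hsq s z + hsq φ z) ≤ K1 * m ^ 2 / R ^ 2 := by
    have B1 : ∫ z, gsq (cut (R / 2) y) z * (gsq s z + gsq φ z) ≤ 8 * B ^ 2 / R ^ 2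
        * ∫ z, cut R y z ^ 2 * (s z ^ 2 + gsq s z + gsq φ z) := by
      rw [← integral_const_mul]
      refine integral_mono J1 (I0.const_mul _) fun z => ?_
      have h1 := gsq_cut_half_le (r := R) (y := y) (z := z) hR0 (hB (R / 2) y z hr2).1
      have h2 := gsq_nonneg s z
      have h3 := gsq_nonneg φ z
      have h4 := sq_nonneg (s z)
      beta_reduce
      rw [← mul_assoc]
      refine mul_le_mul h1 (by linarith) (by linarith) (by positivity)
    calc _ = 4 / μ * (μ / 4 * ∫ z, cut (R / 2) y z ^ 2 * (gsq s z + hsq s z + hsq φ z)) := by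
          field_simp
      _ ≤ 4 / μ * (7 / μ * (8 * B ^ 2 / R ^ 2 * (K0 * m ^ 2))) := by
        refine mul_le_mul_of_nonneg_left (L1.trans ?_) (by positivity)
        refine mul_le_mul_of_nonneg_left (B1.trans ?_) (by positivity)
        gcongr
      _ = _ := by rw [hK1]; ring
  have E2 : ∫ z, cut (R / 4) y z ^ 4 * (hsq s z + tsq s z + tsq φ z) ≤ K2 * m ^ 2 / R ^ 4 := by
    have B2 : ∫ z, cut (R / 4) y z ^ 2 * gsq (cut (R / 4) y) z * (gsq s z + hsq s z + hsq φ z)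
        ≤ 8 * B ^ 2 / (R / 2) ^ 2
        * ∫ z, cut (R / 2) y z ^ 2 * (gsq s z + hsq s z + hsq φ z) := by
      rw [← integral_const_mul]
      refine integral_mono J2 (I1.const_mul _) fun z => ?_
      have h1 := gsq_cut_half_le (r := R / 2) (y := y) (z := z) hr2
        (hB (R / 2 / 2) y z (by positivity)).1
      rw [show R / 2 / 2 = R / 4 by ring] at h1
      have h2 := gsq_nonneg s z
      have h3 := hsq_nonneg s z
      have h4 := hsq_nonneg φ z
      have h5 : cut (R / 4) y z ^ 2 ≤ 1 := pow_le_one₀ (cut_nonneg _ _ _) (cut_le_one _ _ _)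
      have h6 := gsq_nonneg (cut (R / 4) y) z
      beta_reduce
      rw [← mul_assoc]
      refine mul_le_mul ?_ le_rfl (by positivity) (by positivity)
      refine (mul_le_mul_of_nonneg_right h5 h6).trans ?_
      rw [one_mul]
      exact h1
    calc _ = 8 / μ * (μ / 8 * ∫ z, cut (R / 4) y z ^ 4 * (hsq s z + tsq s z + tsq φ z)) := by
          field_simp
      _ ≤ 8 / μ * (31 / μ * (8 * B ^ 2 / (R / 2) ^ 2 * (K1 * m ^ 2 / R ^ 2))) := by
        refine mul_le_mul_of_nonneg_left (L2.trans ?_) (by positivity)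
        refine mul_le_mul_of_nonneg_left (B2.trans ?_) (by positivity)
        gcongr
      _ = _ := by rw [hK2]; field_simp; ring
  refine ⟨E0.trans ?_, E1.trans ?_, E2.trans ?_⟩
  · gcongr; linarith
  · gcongr; linarith
  · gcongr; linarith

/-- Interior gradient estimate: the modulus and all gradients at `y` are controlled by the size of
the phase on a disc of radius comparable to `‖y‖`. -/
theorem HydroSystem.gradient_bound {R1 : ℝ} (hE : Elliptic c μ)
    (hS : HydroSystem c ε {z | R1 < ‖z‖} s φ) (hε0 : 0 ≤ ε) (hε : 10000 * ε ≤ μ)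
    (hint : IntegrableOn (fun z => s z ^ 2) {z | R1 < ‖z‖}) :
    ∃ C R2 : ℝ, 0 < C ∧ 0 < R2 ∧ ∀ y : ℂ, R2 ≤ ‖y‖ → ∀ σ : ℝ, 0 ≤ σ →
      (∀ z, ‖z - y‖ ≤ ‖y‖ / 2 → |φ z| ≤ σ) →
      |s y| ≤ C / ‖y‖ * (σ + 1 / ‖y‖) ∧ ∀ j, |D j s y| ≤ C / ‖y‖ * (σ + 1 / ‖y‖) ∧
        |D j φ y| ≤ C / ‖y‖ * (σ + 1 / ‖y‖) := by
  obtain ⟨K, hK, hlev⟩ := hS.energy_levels hE hε0 hε hint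
  obtain ⟨A, hA, hsob⟩ := exists_scaled_sobolev
  have hs := hS.smooth_s
  have hφ := hS.smooth_φ
  refine ⟨4 * (A * (1 + K)), max (2 * |R1| + 1) 2, by positivity,
    lt_max_of_lt_right (by norm_num), fun y hy σ hσ hφσ => ?_⟩
  have hy1 := (le_max_left _ _).trans hy
  have hy2 := (le_max_right _ _).trans hy
  set R := ‖y‖ / 2 with hR
  have hR1 : 1 ≤ R := by rw [hR]; linarith
  have hR0 : 0 < R := by linarith
  have hyp : 0 < ‖y‖ := by linarith
  obtain ⟨e0, e1, e2⟩ := hlev y R σ (σ + R⁻¹) hR1 (by rw [hR]; linarith [le_abs_self R1]) hσ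
    (le_add_of_nonneg_right (by positivity)) (le_add_of_nonneg_left hσ) hφσ
  have hm : 0 < σ + R⁻¹ := by positivity
  have hc : ∀ r : ℝ, 0 < r → HasCompactSupport (cut r y) := fun r hr => hasCompactSupport_cut hr
  have hr2 : 0 < R / 2 := by positivity
  have hr4 : 0 < R / 4 := by positivity
  have mono : ∀ (n : ℕ) (r : ℝ) (f g : ℂ → ℝ), n ≠ 0 → 0 < r → ContDiff ℝ ∞ f → ContDiff ℝ ∞ g →
      (∀ z, f z ≤ g z) → ∫ z, cut r y z ^ n * f z ≤ ∫ z, cut r y z ^ n * g z := by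
    intro n r f g hn hr hf hg hfg
    refine integral_mono (integrable_of_smooth (by fun_prop)
      (hasCompactSupport_of_eq_zero (hc r hr) fun z hz => by simp [hz, hn]))
      (integrable_of_smooth (by fun_prop)
      (hasCompactSupport_of_eq_zero (hc r hr) fun z hz => by simp [hz, hn])) fun z => ?_
    exact mul_le_mul_of_nonneg_left (hfg z) (pow_nonneg (cut_nonneg _ _ _) n)
  have fin : ∀ g : ℂ → ℝ, ContDiff ℝ ∞ g → (∀ z, g z ^ 2 ≤ s z ^ 2 + gsq s z + gsq φ z) →
      (∀ z, gsq g z ≤ gsq s z + hsq s z + hsq φ z) →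
      (∀ z, hsq g z ≤ hsq s z + tsq s z + tsq φ z) →
      |g y| ≤ 4 * (A * (1 + K)) / ‖y‖ * (σ + 1 / ‖y‖) := by
    intro g hg h0 h1 h2
    refine (hsob g y R (σ + R⁻¹) K hg hR0 hm hK
      ((mono 2 R (fun z => g z ^ 2) _ (by norm_num) hR0 (by fun_prop) (by fun_prop) h0).trans e0)
      ((mono 2 (R / 2) _ _ (by norm_num) hr2 (by fun_prop) (by fun_prop) h1).trans e1)
      ((mono 4 (R / 4) _ _ (by norm_num) hr4 (by fun_prop) (by fun_prop) h2).trans e2)).trans ?_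
    have : (σ + R⁻¹) / R ≤ 4 / ‖y‖ * (σ + 1 / ‖y‖) := by
      rw [hR]
      have : (σ + (‖y‖ / 2)⁻¹) / (‖y‖ / 2) = 2 / ‖y‖ * σ + 4 / ‖y‖ * (1 / ‖y‖) := by field_simp; ring
      rw [this, mul_add]
      gcongr
      norm_num
    calc _ ≤ A * (1 + K) * (4 / ‖y‖ * (σ + 1 / ‖y‖)) := by gcongr
      _ = _ := by ring
  have nn := fun z => (⟨gsq_nonneg s z, gsq_nonneg φ z, hsq_nonneg s z, hsq_nonneg φ z,
    tsq_nonneg s z, tsq_nonneg φ z, sq_nonneg (s z)⟩ : _ ∧ _ ∧ _ ∧ _ ∧ _ ∧ _ ∧ _)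
  have hht : ∀ (f : ℂ → ℝ) j z, hsq (D j f) z ≤ tsq f z := fun f j z => by
    unfold tsq
    fin_cases j
    · exact le_add_of_nonneg_right (hsq_nonneg _ _)
    · exact le_add_of_nonneg_left (hsq_nonneg _ _)
  refine ⟨fin s hs (fun z => ?_) (fun z => ?_) (fun z => ?_), fun j =>
    ⟨fin _ (contDiff_D hs j) (fun z => ?_) (fun z => ?_) (fun z => ?_),
     fin _ (contDiff_D hφ j) (fun z => ?_) (fun z => ?_) (fun z => ?_)⟩⟩
  all_goals obtain ⟨n1, n2, n3, n4, n5, n6, n7⟩ := nn z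
  · linarith
  · linarith
  · linarith
  · linarith [D_sq_le_gsq s j z]
  · linarith [gsq_D_le_hsq s j z]
  · linarith [hht s j z]
  · linarith [D_sq_le_gsq φ j z]
  · linarith [gsq_D_le_hsq φ j z]
  · linarith [hht φ j z]

end

section

/-- A smooth monotone transition from `0` (for `t ≤ 1 / 2`) to `1` (for `1 ≤ t`). -/
def step (t : ℝ) : ℝ := Real.smoothTransition (2 * t - 1)

/-- The derivative of the regularised logarithm. -/
def logKernel (t : ℝ) : ℝ := step t / t

/-- A smooth function on the line which equals the logarithm on `[1, ∞)`. -/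
def smoothLog (t : ℝ) : ℝ := ∫ τ in (1 : ℝ)..t, logKernel τ

theorem contDiff_step : ContDiff ℝ ∞ step :=
  Real.smoothTransition.contDiff.comp (by fun_prop : ContDiff ℝ ∞ fun t : ℝ => 2 * t - 1)

theorem step_eq_zero {t : ℝ} (h : t ≤ 1 / 2) : step t = 0 :=
  Real.smoothTransition.zero_of_nonpos (by linarith)

theorem step_eq_one {t : ℝ} (h : 1 ≤ t) : step t = 1 :=
  Real.smoothTransition.one_of_one_le (by linarith)

theorem step_mono : Monotone step := fun a b h =>
  Real.smoothTransition.monotone (by linarith)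

theorem contDiff_logKernel : ContDiff ℝ ∞ logKernel := by
  refine contDiff_iff_contDiffAt.2 fun t => ?_
  rcases eq_or_ne t 0 with rfl | ht
  · have : logKernel =ᶠ[nhds 0] fun _ => 0 := by
      filter_upwards [Iio_mem_nhds (show (0 : ℝ) < 1 / 2 by norm_num)] with t ht
      simp [logKernel, step_eq_zero (le_of_lt ht)]
    exact contDiffAt_const.congr_of_eventuallyEq this
  · exact contDiff_step.contDiffAt.div contDiffAt_id ht

theorem hasDerivAt_smoothLog (t : ℝ) : HasDerivAt smoothLog (logKernel t) t := by
  have hc := contDiff_logKernel.continuous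
  exact intervalIntegral.integral_hasDerivAt_right (hc.intervalIntegrable _ _)
    (hc.stronglyMeasurableAtFilter _ _) hc.continuousAt

theorem deriv_smoothLog : deriv smoothLog = logKernel :=
  funext fun t => (hasDerivAt_smoothLog t).deriv

theorem contDiff_smoothLog : ContDiff ℝ ∞ smoothLog := by
  rw [contDiff_infty_iff_deriv, deriv_smoothLog]
  exact ⟨fun t => (hasDerivAt_smoothLog t).differentiableAt, contDiff_logKernel⟩

theorem smoothLog_eq_log {t : ℝ} (h : 1 ≤ t) : smoothLog t = Real.log t := by
  have : ∫ τ in (1 : ℝ)..t, logKernel τ = ∫ τ in (1 : ℝ)..t, 1 / τ := by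
    refine intervalIntegral.integral_congr fun τ hτ => ?_
    rw [Set.uIcc_of_le h] at hτ
    simp [logKernel, step_eq_one hτ.1]
  rw [smoothLog, this, integral_one_div_of_pos one_pos (by linarith), div_one]

theorem mul_logKernel (t : ℝ) : t * logKernel t = step t := by
  rcases eq_or_ne t 0 with rfl | ht
  · simp [step_eq_zero]
  · rw [logKernel, mul_div_cancel₀ _ ht]

theorem logKernel_add (t : ℝ) : logKernel t + t * deriv logKernel t = deriv step t := by
  have hk := (contDiff_logKernel.differentiable (by simp) t).hasDerivAt
  have h := (hasDerivAt_id t).mul hk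
  have e : (id * logKernel) = step := funext mul_logKernel
  rw [e] at h
  rw [h.deriv]
  simp

theorem deriv_step_eq_zero {t : ℝ} (h : 1 < t) : deriv step t = 0 := by
  have : step =ᶠ[nhds t] fun _ => 1 := by
    filter_upwards [Ioi_mem_nhds h] with r hr
    exact step_eq_one (le_of_lt hr)
  rw [this.deriv_eq, deriv_const]

theorem exists_logKernel_bounds : ∃ C : ℝ, 0 ≤ C ∧ ∀ t, 0 ≤ t →
    |logKernel t| ≤ C / (1 + t) ∧ |deriv logKernel t| ≤ C / (1 + t) ^ 2 := by
  have hk := contDiff_logKernel.continuous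
  have hk' := contDiff_logKernel.continuous_deriv (by simp)
  obtain ⟨A, hA⟩ := (isCompact_Icc (a := (0 : ℝ)) (b := 2)).exists_bound_of_continuousOn
    hk.continuousOn
  obtain ⟨B, hB⟩ := (isCompact_Icc (a := (0 : ℝ)) (b := 2)).exists_bound_of_continuousOn
    hk'.continuousOn
  refine ⟨9 * (|A| + |B| + 1), by positivity, fun t ht => ?_⟩
  have hA0 := abs_nonneg A
  have hB0 := abs_nonneg B
  rcases le_or_gt t 2 with h2 | h2
  · have h3 := (hA t ⟨ht, h2⟩).trans (le_abs_self A)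
    have h4 := (hB t ⟨ht, h2⟩).trans (le_abs_self B)
    rw [Real.norm_eq_abs] at h3 h4
    rw [le_div_iff₀ (by positivity), le_div_iff₀ (by positivity)]
    constructor
    · calc _ ≤ |A| * (1 + 2) := by gcongr
        _ ≤ _ := by linarith
    · calc _ ≤ |B| * (1 + 2) ^ 2 := by gcongr
        _ ≤ _ := by linarith
  · have e1 : logKernel t = t⁻¹ := by rw [logKernel, step_eq_one (by linarith), one_div]
    have e2 : deriv logKernel t = -(t ^ 2)⁻¹ := by
      have := logKernel_add t
      rw [deriv_step_eq_zero (by linarith), e1] at this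
      field_simp
      field_simp at this
      linarith
    have ht0 : 0 < t := by linarith
    rw [e1, e2, abs_neg, abs_of_pos (inv_pos.2 ht0), abs_of_pos (inv_pos.2 (pow_pos ht0 2)),
      le_div_iff₀ (by positivity), le_div_iff₀ (by positivity), inv_mul_eq_div, inv_mul_eq_div,
      div_le_iff₀ ht0, div_le_iff₀ (by positivity)]
    constructor
    · nlinarith
    · nlinarith [mul_nonneg hA0 (sq_nonneg t), mul_nonneg hB0 (sq_nonneg t)]

theorem D_comp {h : ℝ → ℝ} {f : ℂ → ℝ} (hh : ContDiff ℝ ∞ h) (hf : ContDiff ℝ ∞ f) (j : Fin 2) :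
    D j (fun z => h (f z)) = fun z => deriv h (f z) * D j f z := by
  funext z
  have h1 := ((hh.differentiable (by simp)) (f z)).hasDerivAt
  have h2 := h1.comp_hasFDerivAt z (diffAt hf (z := z)).hasFDerivAt
  unfold D
  rw [show (fun z => h (f z)) = h ∘ f from rfl, h2.fderiv]
  simp

@[fun_prop]
theorem contDiff_re : ContDiff ℝ ∞ (fun z : ℂ => z.re) := Complex.reCLM.contDiff

@[fun_prop]
theorem contDiff_im : ContDiff ℝ ∞ (fun z : ℂ => z.im) := Complex.imCLM.contDiff

theorem D_re (j : Fin 2) : D j (fun z : ℂ => z.re) = fun _ => (dir j).re := by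
  funext z
  exact congrArg (fun L : ℂ →L[ℝ] ℝ => L (dir j)) Complex.reCLM.fderiv

theorem D_im (j : Fin 2) : D j (fun z : ℂ => z.im) = fun _ => (dir j).im := by
  funext z
  exact congrArg (fun L : ℂ →L[ℝ] ℝ => L (dir j)) Complex.imCLM.fderiv

/-- The anisotropic quadratic form adapted to `∂₀² + κ ∂₁²`. -/
def aniso (κ : ℝ) (z : ℂ) : ℝ := z.re ^ 2 + κ⁻¹ * z.im ^ 2

/-- A regularised fundamental solution of `∂₀² + κ ∂₁²` (up to a constant). -/
def fundSol (κ : ℝ) (z : ℂ) : ℝ := 2⁻¹ * smoothLog (aniso κ z)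

@[fun_prop]
theorem contDiff_aniso (κ : ℝ) : ContDiff ℝ ∞ (aniso κ) := by
  unfold aniso; fun_prop

@[fun_prop]
theorem contDiff_fundSol (κ : ℝ) : ContDiff ℝ ∞ (fundSol κ) := by
  unfold fundSol
  exact contDiff_const.mul (contDiff_smoothLog.comp (contDiff_aniso κ))

theorem D_zero_aniso (κ : ℝ) : D 0 (aniso κ) = fun z => 2 * z.re := by
  unfold aniso
  simp (disch := fun_prop) only [D_add, D_mul, D_pow, D_const, D_re, D_im]
  simp [dir]

theorem D_one_aniso (κ : ℝ) : D 1 (aniso κ) = fun z => 2 * (κ⁻¹ * z.im) := by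
  unfold aniso
  simp (disch := fun_prop) only [D_add, D_mul, D_pow, D_const, D_re, D_im]
  funext z
  simp [dir]
  ring

theorem D_zero_fundSol (κ : ℝ) : D 0 (fundSol κ) = fun z => logKernel (aniso κ z) * z.re := by
  have h : ContDiff ℝ ∞ (fun z => smoothLog (aniso κ z)) :=
    contDiff_smoothLog.comp (contDiff_aniso κ)
  unfold fundSol
  simp (disch := fun_prop) only [D_mul, D_const, D_comp contDiff_smoothLog, deriv_smoothLog,
    D_zero_aniso]
  funext z
  ring

theorem D_one_fundSol (κ : ℝ) :
    D 1 (fundSol κ) = fun z => logKernel (aniso κ z) * (κ⁻¹ * z.im) := by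
  have h : ContDiff ℝ ∞ (fun z => smoothLog (aniso κ z)) :=
    contDiff_smoothLog.comp (contDiff_aniso κ)
  unfold fundSol
  simp (disch := fun_prop) only [D_mul, D_const, D_comp contDiff_smoothLog, deriv_smoothLog,
    D_one_aniso]
  funext z
  ring

theorem D_D_zero_fundSol (κ : ℝ) : D 0 (D 0 (fundSol κ)) = fun z =>
    2 * deriv logKernel (aniso κ z) * z.re ^ 2 + logKernel (aniso κ z) := by
  have h : ContDiff ℝ ∞ (fun z => logKernel (aniso κ z)) :=
    contDiff_logKernel.comp (contDiff_aniso κ)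
  rw [D_zero_fundSol]
  simp (disch := fun_prop) only [D_mul, D_comp contDiff_logKernel, D_zero_aniso, D_re]
  funext z
  simp [dir]
  ring

theorem D_D_one_fundSol (κ : ℝ) : D 1 (D 1 (fundSol κ)) = fun z =>
    2 * deriv logKernel (aniso κ z) * (κ⁻¹ * z.im) ^ 2 + κ⁻¹ * logKernel (aniso κ z) := by
  have h : ContDiff ℝ ∞ (fun z => logKernel (aniso κ z)) :=
    contDiff_logKernel.comp (contDiff_aniso κ)
  rw [D_one_fundSol]
  simp (disch := fun_prop) only [D_mul, D_const, D_comp contDiff_logKernel, D_one_aniso, D_im]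
  funext z
  simp [dir]
  ring

/-- The mollifier obtained by applying `∂₀² + κ ∂₁²` to the regularised fundamental solution. -/
def mollifier (κ : ℝ) (z : ℂ) : ℝ := D 0 (D 0 (fundSol κ)) z + κ * D 1 (D 1 (fundSol κ)) z

@[fun_prop]
theorem contDiff_mollifier (κ : ℝ) : ContDiff ℝ ∞ (mollifier κ) := by
  unfold mollifier; fun_prop

variable {κ : ℝ}

theorem mollifier_eq (hκ : 0 < κ) (z : ℂ) : mollifier κ z = 2 * deriv step (aniso κ z) := by
  rw [mollifier, D_D_zero_fundSol, D_D_one_fundSol, ← logKernel_add]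
  have : aniso κ z = z.re ^ 2 + κ * (κ⁻¹ * z.im) ^ 2 := by
    unfold aniso; field_simp
  rw [mul_add, mul_add, ← mul_assoc, ← mul_assoc κ κ⁻¹, mul_inv_cancel₀ hκ.ne']
  linear_combination (-2 * deriv logKernel (aniso κ z)) * this

theorem normSq_le_aniso (hκ : 0 < κ) (hκ1 : κ ≤ 1) (z : ℂ) : ‖z‖ ^ 2 ≤ aniso κ z := by
  rw [Complex.sq_norm, Complex.normSq_apply, aniso]
  have : 1 ≤ κ⁻¹ := (one_le_inv₀ hκ).2 hκ1
  nlinarith [sq_nonneg z.im]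

theorem mollifier_nonneg (hκ : 0 < κ) (z : ℂ) : 0 ≤ mollifier κ z := by
  rw [mollifier_eq hκ]
  exact mul_nonneg zero_le_two step_mono.deriv_nonneg

theorem mollifier_eq_zero (hκ : 0 < κ) (hκ1 : κ ≤ 1) {z : ℂ} (hz : 1 < ‖z‖) :
    mollifier κ z = 0 := by
  have := normSq_le_aniso hκ hκ1 z
  rw [mollifier_eq hκ, deriv_step_eq_zero (by nlinarith), mul_zero]

theorem hasCompactSupport_mollifier (hκ : 0 < κ) (hκ1 : κ ≤ 1) :
    HasCompactSupport (mollifier κ) :=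
  HasCompactSupport.intro (isCompact_closedBall 0 1) fun z hz =>
    mollifier_eq_zero hκ hκ1 (by simpa using hz)

theorem integral_mollifier_pos (hκ : 0 < κ) (hκ1 : κ ≤ 1) : 0 < ∫ z, mollifier κ z := by
  obtain ⟨t, ht, h⟩ := exists_deriv_eq_slope step (show (1 / 2 : ℝ) < 1 by norm_num)
    contDiff_step.continuous.continuousOn
    (contDiff_step.differentiable (by simp)).differentiableOn
  rw [step_eq_one le_rfl, step_eq_zero le_rfl] at h
  refine (contDiff_mollifier κ).continuous.integral_pos_of_hasCompactSupport_nonneg_nonzero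
    (x := (Real.sqrt t : ℂ)) (hasCompactSupport_mollifier hκ hκ1) (mollifier_nonneg hκ) ?_
  have : aniso κ (Real.sqrt t : ℂ) = t := by
    simp [aniso, Real.sq_sqrt (show 0 ≤ t by linarith [ht.1])]
  rw [mollifier_eq hκ, this, h]
  norm_num

theorem aniso_nonneg (hκ : 0 < κ) (z : ℂ) : 0 ≤ aniso κ z := by
  unfold aniso; positivity

theorem exists_D_fundSol_bound (hκ : 0 < κ) :
    ∃ C : ℝ, 0 ≤ C ∧ ∀ j z, |D j (fundSol κ) z| ≤ C := by
  obtain ⟨C, hC, hb⟩ := exists_logKernel_bounds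
  refine ⟨C * (1 + κ⁻¹), by positivity, fun j z => ?_⟩
  have h0 := aniso_nonneg hκ z
  have h1 := (hb _ h0).1
  have hi : 0 < κ⁻¹ := by positivity
  have key : ∀ w : ℝ, |w| ≤ (1 + κ⁻¹) * (1 + aniso κ z) →
      |logKernel (aniso κ z) * w| ≤ C * (1 + κ⁻¹) := by
    intro w hw
    rw [abs_mul]
    calc _ ≤ C / (1 + aniso κ z) * ((1 + κ⁻¹) * (1 + aniso κ z)) := by gcongr
      _ = _ := by field_simp
  fin_cases j
  · change |D 0 _ z| ≤ _
    rw [D_zero_fundSol]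
    refine key _ (abs_le.2 ⟨?_, ?_⟩) <;> unfold aniso at h0 ⊢ <;>
      nlinarith [sq_nonneg (z.re - 1), sq_nonneg (z.re + 1), mul_nonneg hi.le (sq_nonneg z.im),
        mul_nonneg hi.le h0]
  · change |D 1 _ z| ≤ _
    rw [D_one_fundSol]
    refine key _ ?_
    rw [abs_mul, abs_of_pos hi]
    have : |z.im| ≤ 1 + z.im ^ 2 := abs_le.2 ⟨by nlinarith, by nlinarith⟩
    have h2 : κ⁻¹ * |z.im| ≤ κ⁻¹ * (1 + z.im ^ 2) := by gcongr
    unfold aniso at h0 ⊢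
    nlinarith [mul_nonneg hi.le h0, sq_nonneg z.re]

theorem integrable_lapR_fundSol_sq (hκ : 0 < κ) (hκ1 : κ ≤ 1) :
    Integrable (fun z => lapR (fundSol κ) z ^ 2) := by
  obtain ⟨C, hC, hb⟩ := exists_logKernel_bounds
  have hi : 0 < κ⁻¹ := by positivity
  have hbd : ∀ z, |lapR (fundSol κ) z| ≤ 3 * C * (1 + κ⁻¹) / (1 + aniso κ z) := by
    intro z
    have h0 := aniso_nonneg hκ z
    obtain ⟨h1, h2⟩ := hb _ h0
    have h3 : z.re ^ 2 + (κ⁻¹ * z.im) ^ 2 ≤ (1 + κ⁻¹) * (1 + aniso κ z) := by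
      unfold aniso
      nlinarith [mul_nonneg hi.le (sq_nonneg z.im), mul_nonneg hi.le (sq_nonneg z.re),
        mul_nonneg hi.le (mul_nonneg hi.le (sq_nonneg z.im)), sq_nonneg z.re]
    rw [lapR, D_D_zero_fundSol, D_D_one_fundSol]
    calc _ = |2 * (deriv logKernel (aniso κ z) * (z.re ^ 2 + (κ⁻¹ * z.im) ^ 2))
          + (1 + κ⁻¹) * logKernel (aniso κ z)| := by ring_nf
      _ ≤ 2 * (|deriv logKernel (aniso κ z)| * (z.re ^ 2 + (κ⁻¹ * z.im) ^ 2))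
          + (1 + κ⁻¹) * |logKernel (aniso κ z)| := by
        refine (abs_add_le _ _).trans ?_
        rw [abs_mul, abs_mul, abs_mul, abs_two, abs_of_nonneg (by positivity : 0 ≤ 1 + κ⁻¹),
          abs_of_nonneg (by positivity : 0 ≤ z.re ^ 2 + (κ⁻¹ * z.im) ^ 2)]
      _ ≤ 2 * (C / (1 + aniso κ z) ^ 2 * ((1 + κ⁻¹) * (1 + aniso κ z)))
          + (1 + κ⁻¹) * (C / (1 + aniso κ z)) := by gcongr
      _ = _ := by field_simp; ring
  have hI : Integrable (fun z : ℂ => (6 * C * (1 + κ⁻¹)) ^ 2 * (1 + ‖z‖) ^ (-4 : ℝ)) :=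
    (integrable_one_add_norm (by simp [Complex.finrank_real_complex]; norm_num)).const_mul _
  refine hI.mono' (by fun_prop : ContDiff ℝ ∞ _).continuous.aestronglyMeasurable
    (Eventually.of_forall fun z => ?_)
  have h0 := aniso_nonneg hκ z
  have h1 : |lapR (fundSol κ) z| ≤ 6 * C * (1 + κ⁻¹) / (1 + ‖z‖) ^ 2 := by
    refine (hbd z).trans ?_
    have := normSq_le_aniso hκ hκ1 z
    rw [div_le_div_iff₀ (by positivity) (by positivity)]
    have h2 : (1 + ‖z‖) ^ 2 ≤ 2 * (1 + aniso κ z) := by nlinarith [sq_nonneg (‖z‖ - 1)]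
    calc _ ≤ 3 * C * (1 + κ⁻¹) * (2 * (1 + aniso κ z)) := by gcongr
      _ = _ := by ring
  rw [norm_pow, Real.norm_eq_abs]
  calc _ ≤ (6 * C * (1 + κ⁻¹) / (1 + ‖z‖) ^ 2) ^ 2 := by gcongr
    _ = _ := by
      rw [Real.rpow_neg (by positivity), show (4 : ℝ) = (4 : ℕ) by norm_num, Real.rpow_natCast]
      field_simp

theorem fundSol_smul_eq (hκ : 0 < κ) (hκ1 : κ ≤ 1) {R : ℝ} (hR : 0 < R) {w : ℂ} (hw : R ≤ ‖w‖) :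
    fundSol κ ((-R⁻¹) • w) + Real.log R = 2⁻¹ * Real.log (aniso κ w) := by
  have h1 : aniso κ ((-R⁻¹) • w) = aniso κ w / R ^ 2 := by
    simp [aniso]
    field_simp
  have h2 := normSq_le_aniso hκ hκ1 w
  have h3 : R ^ 2 ≤ ‖w‖ ^ 2 := by gcongr
  rw [fundSol, h1, smoothLog_eq_log ((one_le_div (by positivity)).2 (h3.trans h2)),
    Real.log_div (by nlinarith [sq_pos_of_pos hR]) (by positivity), Real.log_pow]
  push_cast
  ring

end

section

theorem integral_mul_D {u v : ℂ → ℝ} (hu : ContDiff ℝ ∞ u) (hc : HasCompactSupport u)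
    (hv : ContDiff ℝ ∞ v) (j : Fin 2) : ∫ z, u z * D j v z = -∫ z, v z * D j u z := by
  have h := integral_D_eq_zero (f := fun z => u z * v z) (by fun_prop) hc.mul_right j
  have i1 : Integrable (fun z => v z * D j u z) :=
    integrable_of_smooth (by fun_prop) (hasCompactSupport_D hc j).mul_left
  have i2 : Integrable (fun z => u z * D j v z) :=
    integrable_of_smooth (by fun_prop) hc.mul_right
  have e : D j (fun z => u z * v z) = fun z => v z * D j u z + u z * D j v z := by
    rw [D_mul hu hv]
    funext z
    ring
  rw [e, integral_add i1 i2] at h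
  linarith

theorem integral_mul_D_D {u v : ℂ → ℝ} (hu : ContDiff ℝ ∞ u) (hc : HasCompactSupport u)
    (hv : ContDiff ℝ ∞ v) (j : Fin 2) :
    ∫ z, u z * D j (D j v) z = ∫ z, v z * D j (D j u) z := by
  rw [integral_mul_D hu hc (contDiff_D hv j)]
  have h := integral_mul_D (contDiff_D hu j) (hasCompactSupport_D hc j) hv j
  simp only [mul_comm (D j v _)]
  rw [h, neg_neg]

theorem integral_comp_smul_sub (F : ℂ → ℝ) (x : ℂ) {r : ℝ} (hr : 0 < r) :
    ∫ y, F ((-r⁻¹) • (y - x)) = r ^ 2 * ∫ z, F z := by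
  rw [integral_sub_right_eq_self (fun y => F ((-r⁻¹) • y)) x, Measure.integral_comp_smul,
    Complex.finrank_real_complex, smul_eq_mul]
  congr 1
  rw [neg_sq, inv_pow, inv_inv, abs_of_pos (by positivity)]

theorem integrable_comp_smul_sub {F : ℂ → ℝ} (hF : Integrable F) (x : ℂ) {r : ℝ} (hr : 0 < r) :
    Integrable (fun y => F ((-r⁻¹) • (y - x))) :=
  (hF.comp_smul (neg_ne_zero.2 (inv_pos.2 hr).ne')).comp_sub_right x

theorem exists_bound_of_tendsto_zero {φ : ℂ → ℝ} (hc : Continuous φ)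
    (hφ : Tendsto φ (cocompact ℂ) (nhds 0)) : ∃ B : ℝ, ∀ z, |φ z| ≤ B := by
  have h1 : ∀ᶠ z in cocompact ℂ, |φ z| < 1 := by
    filter_upwards [hφ.eventually (ball_mem_nhds 0 one_pos)] with z hz
    simpa using hz
  obtain ⟨K, hK, hKs⟩ := mem_cocompact.1 h1
  obtain ⟨B, hB⟩ := hK.exists_bound_of_continuousOn hc.continuousOn
  refine ⟨max B 1, fun z => ?_⟩
  by_cases hz : z ∈ K
  · exact (hB z hz).trans (le_max_left _ _)
  · exact (le_of_lt (hKs hz)).trans (le_max_right _ _)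

variable {κ c : ℝ} {φ η Q₀ Q₁ : ℂ → ℝ}

theorem tendsto_average (hκ : 0 < κ) (hκ1 : κ ≤ 1) (hsφ : ContDiff ℝ ∞ φ)
    (hφ : Tendsto φ (cocompact ℂ) (nhds 0)) (x : ℂ) :
    Tendsto (fun n : ℝ => ∫ z, φ (x - n • z) * mollifier κ z) atTop (nhds 0) := by
  obtain ⟨B, hB⟩ := exists_bound_of_tendsto_zero hsφ.continuous hφ
  have hm := integrable_of_smooth (contDiff_mollifier κ) (hasCompactSupport_mollifier hκ hκ1)
  rw [← integral_zero ℂ ℝ]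
  have hcφ := hsφ.continuous
  have hcm := (contDiff_mollifier κ).continuous
  refine tendsto_integral_filter_of_dominated_convergence (fun z => B * mollifier κ z)
    (Eventually.of_forall fun n => (by fun_prop : Continuous _).aestronglyMeasurable)
    (Eventually.of_forall fun n => Eventually.of_forall fun z => ?_) (hm.const_mul B) ?_
  · rw [norm_mul, Real.norm_eq_abs, Real.norm_eq_abs, abs_of_nonneg (mollifier_nonneg hκ z)]
    exact mul_le_mul_of_nonneg_right (hB _) (mollifier_nonneg hκ z)
  · have h0 : ∀ᵐ z : ℂ, z ≠ 0 := by simp [ae_iff]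
    filter_upwards [h0] with z hz
    rw [← zero_mul (mollifier κ z)]
    refine (hφ.comp ?_).mul_const _
    rw [← cobounded_eq_cocompact, ← tendsto_norm_atTop_iff_cobounded]
    refine tendsto_atTop_mono (f := fun n : ℝ => n * ‖z‖ - ‖x‖) (fun n => ?_)
      (tendsto_atTop_add_const_right _ _ (tendsto_id.atTop_mul_const (norm_pos_iff.2 hz)))
    have h1 := norm_sub_norm_le (n • z) x
    rw [norm_sub_rev, norm_smul, Real.norm_eq_abs] at h1
    have h2 := mul_le_mul_of_nonneg_right (le_abs_self n) (norm_nonneg z)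
    linarith

/-- Comparison of two averages of the phase at scales `R ≤ n`. -/
theorem abs_average_sub_le (hκ : 0 < κ) (hκ1 : κ ≤ 1) (hsφ : ContDiff ℝ ∞ φ)
    (hsη : ContDiff ℝ ∞ η) (hs₀ : ContDiff ℝ ∞ Q₀) (hs₁ : ContDiff ℝ ∞ Q₁)
    (hi₀ : Integrable Q₀) (hi₁ : Integrable Q₁) (hiη : Integrable (fun z => D 1 η z ^ 2))
    (heq : ∀ z, D 0 (D 0 φ) z + κ * D 1 (D 1 φ) z
      = D 0 Q₀ z + D 1 Q₁ z + c / 4 * D 1 (lapR η) z) :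
    ∃ C : ℝ, 0 ≤ C ∧ ∀ (x : ℂ) (R n : ℝ), 1 ≤ R → R ≤ n →
      |(∫ z, φ (x - R • z) * mollifier κ z) - ∫ z, φ (x - n • z) * mollifier κ z| ≤ C / R := by
  obtain ⟨C₁, hC₁, hD⟩ := exists_D_fundSol_bound hκ
  have hI := integrable_lapR_fundSol_sq hκ hκ1
  set I := ∫ z, lapR (fundSol κ) z ^ 2
  set E := ∫ z, D 1 η z ^ 2
  have hI0 : 0 ≤ I := integral_nonneg fun z => by positivity
  have hE0 : 0 ≤ E := integral_nonneg fun z => by positivity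
  have q0 : 0 ≤ ∫ z, |Q₀ z| := integral_nonneg fun z => by positivity
  have q1 : 0 ≤ ∫ z, |Q₁ z| := integral_nonneg fun z => by positivity
  refine ⟨2 * C₁ * ((∫ z, |Q₀ z|) + ∫ z, |Q₁ z|) + |c| / 4 * (E / 2 + 2 * I), by positivity,
    fun x R n hR hn => ?_⟩
  have hR0 : 0 < R := by linarith
  have hn0 : 0 < n := by linarith
  have hnR : n⁻¹ ≤ R⁻¹ := inv_anti₀ hR0 hn
  have hav : ∀ r : ℝ, 0 < r → ∫ z, φ (x - r • z) * mollifier κ z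
      = ∫ y, φ y * (r⁻¹ ^ 2 * mollifier κ ((-r⁻¹) • (y - x))) := by
    intro r hr
    have h := integral_comp_smul_sub (fun z => φ (x - r • z) * mollifier κ z) x hr
    have e : ∀ y, x - r • (-r⁻¹) • (y - x) = y := fun y => by
      rw [smul_smul, mul_neg, mul_inv_cancel₀ hr.ne']
      simp
    simp only [e] at h
    calc _ = r⁻¹ ^ 2 * (r ^ 2 * ∫ z, φ (x - r • z) * mollifier κ z) := by field_simp
      _ = _ := by
        rw [← h, ← integral_const_mul]
        congr 1
        funext y
        ring
  let k : ℝ → ℂ → ℝ := fun r y => fundSol κ ((-r⁻¹) • (y - x))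
  have hk : ∀ r, ContDiff ℝ ∞ (k r) := fun r => (contDiff_fundSol κ).comp (by fun_prop)
  have hDk : ∀ r j, D j (k r) = fun y => -r⁻¹ * D j (fundSol κ) ((-r⁻¹) • (y - x)) :=
    fun r j => D_comp_smul_sub (contDiff_fundSol κ) _ _ _
  have hcD : ∀ (r : ℝ) j, ContDiff ℝ ∞ (fun y => D j (fundSol κ) ((-r⁻¹) • (y - x))) := fun r j =>
    (contDiff_D (contDiff_fundSol κ) j).comp (by fun_prop)
  have hDDk : ∀ r j, D j (D j (k r))
      = fun y => r⁻¹ ^ 2 * D j (D j (fundSol κ)) ((-r⁻¹) • (y - x)) := by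
    intro r j
    rw [hDk, D_mul contDiff_const (hcD r j), D_const,
      D_comp_smul_sub (contDiff_D (contDiff_fundSol κ) j)]
    funext y
    ring
  let T : ℂ → ℝ := fun y => k R y - k n y + (Real.log R - Real.log n)
  have hkR := hk R
  have hkn := hk n
  have hT : ContDiff ℝ ∞ T := by fun_prop
  have hDT : ∀ j, D j T = fun y => D j (k R) y - D j (k n) y := fun j => by
    simp (disch := fun_prop) only [T, D_add, D_sub, D_const]
    simp
  have hDDT : ∀ j, D j (D j T) = fun y => D j (D j (k R)) y - D j (D j (k n)) y := fun j => by
    rw [hDT, D_sub (contDiff_D hkR j) (contDiff_D hkn j)]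
  have hTc : HasCompactSupport T := by
    refine HasCompactSupport.intro (isCompact_closedBall x n) fun y hy => ?_
    have h1 : n ≤ ‖y - x‖ := by
      rw [mem_closedBall, dist_eq_norm, not_le] at hy
      exact hy.le
    have h2 := fundSol_smul_eq hκ hκ1 hR0 (hn.trans h1)
    have h3 := fundSol_smul_eq hκ hκ1 hn0 h1
    simp only [T, k]
    linarith
  have hDTb : ∀ j y, |D j T y| ≤ 2 * C₁ / R := by
    intro j y
    rw [hDT, hDk, hDk]
    refine (abs_sub _ _).trans ?_
    rw [abs_mul, abs_mul, abs_neg, abs_neg, abs_of_pos (inv_pos.2 hR0),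
      abs_of_pos (inv_pos.2 hn0)]
    calc _ ≤ R⁻¹ * C₁ + R⁻¹ * C₁ := by gcongr <;> exact hD _ _
      _ = _ := by field_simp; ring
  have hlap : Integrable (fun y => lapR T y ^ 2) ∧ ∫ y, lapR T y ^ 2 ≤ 4 * I / R ^ 2 := by
    have hi : Integrable (fun y => lapR T y ^ 2) := by
      refine integrable_of_smooth (by fun_prop) ?_
      have h0 := hasCompactSupport_D (hasCompactSupport_D hTc 0) 0
      have h1 := hasCompactSupport_D (hasCompactSupport_D hTc 1) 1
      have : HasCompactSupport (lapR T) := h0.add h1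
      exact hasCompactSupport_of_eq_zero this fun z hz => by simp [hz]
    have iR := (integrable_comp_smul_sub hI x hR0).const_mul (2 * R⁻¹ ^ 4)
    have iN := (integrable_comp_smul_sub hI x hn0).const_mul (2 * n⁻¹ ^ 4)
    refine ⟨hi, (integral_mono hi (iR.add iN) fun y => ?_).trans ?_⟩
    · simp only [lapR, hDDT, hDDk, Pi.add_apply]
      set a := D 0 (D 0 (fundSol κ)) ((-R⁻¹) • (y - x))
      set b := D 1 (D 1 (fundSol κ)) ((-R⁻¹) • (y - x))
      set a' := D 0 (D 0 (fundSol κ)) ((-n⁻¹) • (y - x))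
      set b' := D 1 (D 1 (fundSol κ)) ((-n⁻¹) • (y - x))
      linarith [sq_nonneg (R⁻¹ ^ 2 * (a + b) + n⁻¹ ^ 2 * (a' + b'))]
    · simp only [Pi.add_apply]
      rw [integral_add iR iN, integral_const_mul, integral_const_mul,
        integral_comp_smul_sub (fun z => lapR (fundSol κ) z ^ 2) x hR0,
        integral_comp_smul_sub (fun z => lapR (fundSol κ) z ^ 2) x hn0]
      calc _ = 2 * R⁻¹ ^ 4 * (R ^ 2 * I) + 2 * n⁻¹ ^ 4 * (n ^ 2 * I) := rfl
        _ = 2 * I * R⁻¹ ^ 2 + 2 * I * n⁻¹ ^ 2 := by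
            field_simp
        _ ≤ 2 * I * R⁻¹ ^ 2 + 2 * I * R⁻¹ ^ 2 := by gcongr
        _ = _ := by field_simp; ring
  have icomp : ∀ f : ℂ → ℝ, ContDiff ℝ ∞ f → Integrable (fun y => T y * f y) := fun f hf =>
    integrable_of_smooth (by fun_prop) hTc.mul_right
  have icomp' : ∀ (f : ℂ → ℝ) j, ContDiff ℝ ∞ f → Integrable (fun y => f y * D j (D j T) y) :=
    fun f j hf => integrable_of_smooth (by fun_prop)
      (hasCompactSupport_D (hasCompactSupport_D hTc j) j).mul_left
  have hmol : ∀ r : ℝ, ContDiff ℝ ∞ (fun y => mollifier κ ((-r⁻¹) • (y - x))) := fun r =>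
    (contDiff_mollifier κ).comp (by fun_prop)
  have imol : ∀ r : ℝ, 0 < r →
      Integrable (fun y => φ y * (r⁻¹ ^ 2 * mollifier κ ((-r⁻¹) • (y - x)))) := fun r hr => by
    have := hmol r
    refine integrable_of_smooth (by fun_prop)
      (HasCompactSupport.intro (isCompact_closedBall x r) fun y hy => ?_)
    rw [mem_closedBall, dist_eq_norm, not_le] at hy
    rw [mollifier_eq_zero hκ hκ1, mul_zero, mul_zero]
    rw [norm_smul, norm_neg, norm_inv, Real.norm_eq_abs, abs_of_pos hr, inv_mul_eq_div]
    exact (one_lt_div hr).2 hy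
  have main : (∫ z, φ (x - R • z) * mollifier κ z) - ∫ z, φ (x - n • z) * mollifier κ z
      = -(∫ y, Q₀ y * D 0 T y) - (∫ y, Q₁ y * D 1 T y) + c / 4 * ∫ y, D 1 η y * lapR T y := by
    have hη1 : ∫ y, T y * D 1 (lapR η) y = ∫ y, D 1 η y * lapR T y := by
      rw [D_lapR hsη]
      simp only [lapR, mul_add]
      rw [integral_add (icomp _ (by fun_prop)) (icomp _ (by fun_prop)),
        integral_add (icomp' _ _ (by fun_prop)) (icomp' _ _ (by fun_prop)),
        integral_mul_D_D hT hTc (by fun_prop), integral_mul_D_D hT hTc (by fun_prop)]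
    calc _ = ∫ y, (φ y * D 0 (D 0 T) y + κ * (φ y * D 1 (D 1 T) y)) := by
          rw [hav R hR0, hav n hn0, ← integral_sub (imol R hR0) (imol n hn0)]
          congr 1
          funext y
          simp only [hDDT, hDDk, mollifier]
          ring
      _ = ∫ y, (T y * D 0 (D 0 φ) y + κ * (T y * D 1 (D 1 φ) y)) := by
          rw [integral_add (icomp' _ _ hsφ) ((icomp' _ _ hsφ).const_mul _),
            integral_add (icomp _ (by fun_prop)) ((icomp _ (by fun_prop)).const_mul _),
            integral_const_mul, integral_const_mul, integral_mul_D_D hT hTc hsφ,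
            integral_mul_D_D hT hTc hsφ]
      _ = ∫ y, (T y * D 0 Q₀ y + T y * D 1 Q₁ y + c / 4 * (T y * D 1 (lapR η) y)) := by
          congr 1
          funext y
          linear_combination T y * heq y
      _ = _ := by
          have j0 := icomp (D 0 Q₀) (by fun_prop)
          have j1 := icomp (D 1 Q₁) (by fun_prop)
          rw [integral_add (f := fun y => T y * D 0 Q₀ y + T y * D 1 Q₁ y) (j0.add j1)
              ((icomp _ (by fun_prop)).const_mul _),
            integral_add (icomp _ (by fun_prop)) (icomp _ (by fun_prop)), integral_const_mul, hη1,
            integral_mul_D hT hTc hs₀, integral_mul_D hT hTc hs₁]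
          ring
  have hQ : ∀ (Q : ℂ → ℝ) j, Integrable Q →
      |∫ y, Q y * D j T y| ≤ 2 * C₁ / R * ∫ y, |Q y| := by
    intro Q j hQ
    refine abs_integral_le_integral_abs.trans ?_
    rw [← integral_const_mul]
    refine integral_mono_of_nonneg (Eventually.of_forall fun y => abs_nonneg _)
      (hQ.abs.const_mul _) (Eventually.of_forall fun y => ?_)
    beta_reduce
    rw [abs_mul, mul_comm]
    exact mul_le_mul_of_nonneg_right (hDTb j y) (abs_nonneg _)
  have hη2 : |∫ y, D 1 η y * lapR T y| ≤ (E / 2 + 2 * I) / R := by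
    refine abs_integral_le_integral_abs.trans ?_
    have := integral_mono_of_nonneg (f := fun y => |D 1 η y * lapR T y|)
      (Eventually.of_forall fun y => abs_nonneg _)
      ((hiη.const_mul (R⁻¹ / 2)).add (hlap.1.const_mul (R / 2)))
      (Eventually.of_forall fun y => by
        simp only [Pi.add_apply]
        rw [abs_mul, ← sq_abs (D 1 η y), ← sq_abs (lapR T y)]
        have h := sq_nonneg (R⁻¹ * |D 1 η y| - |lapR T y|)
        have h2 : 0 ≤ R / 2 * (R⁻¹ * |D 1 η y| - |lapR T y|) ^ 2 := by positivity
        have h3 : R / 2 * (R⁻¹ * |D 1 η y| - |lapR T y|) ^ 2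
          = R⁻¹ / 2 * |D 1 η y| ^ 2 + R / 2 * |lapR T y| ^ 2 - |D 1 η y| * |lapR T y| := by
          field_simp
          ring
        linarith)
    refine this.trans ?_
    simp only [Pi.add_apply]
    rw [integral_add (hiη.const_mul _) (hlap.1.const_mul _), integral_const_mul,
      integral_const_mul]
    calc _ ≤ R⁻¹ / 2 * E + R / 2 * (4 * I / R ^ 2) := by gcongr; exact hlap.2
      _ = _ := by field_simp; ring
  rw [main]
  have h0 := hQ Q₀ 0 hi₀
  have h1 := hQ Q₁ 1 hi₁
  calc _ ≤ |∫ y, Q₀ y * D 0 T y| + |∫ y, Q₁ y * D 1 T y|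
        + |c| / 4 * |∫ y, D 1 η y * lapR T y| := by
        refine (abs_add_le _ _).trans (add_le_add ((abs_sub _ _).trans ?_) ?_)
        · rw [abs_neg]
        · rw [abs_mul, abs_div, abs_of_pos (by norm_num : (0 : ℝ) < 4)]
    _ ≤ 2 * C₁ / R * (∫ y, |Q₀ y|) + 2 * C₁ / R * (∫ y, |Q₁ y|)
        + |c| / 4 * ((E / 2 + 2 * I) / R) := by gcongr
    _ = _ := by field_simp

/-- Averages of the phase at scale `R` are of size `1 / R`, uniformly in the centre. -/
theorem abs_average_le (hκ : 0 < κ) (hκ1 : κ ≤ 1) (hsφ : ContDiff ℝ ∞ φ)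
    (hsη : ContDiff ℝ ∞ η) (hs₀ : ContDiff ℝ ∞ Q₀) (hs₁ : ContDiff ℝ ∞ Q₁)
    (hi₀ : Integrable Q₀) (hi₁ : Integrable Q₁) (hiη : Integrable (fun z => D 1 η z ^ 2))
    (heq : ∀ z, D 0 (D 0 φ) z + κ * D 1 (D 1 φ) z
      = D 0 Q₀ z + D 1 Q₁ z + c / 4 * D 1 (lapR η) z)
    (hφ : Tendsto φ (cocompact ℂ) (nhds 0)) :
    ∃ C : ℝ, 0 ≤ C ∧ ∀ (x : ℂ) (R : ℝ), 1 ≤ R →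
      |∫ z, φ (x - R • z) * mollifier κ z| ≤ C / R := by
  obtain ⟨C, hC, h⟩ := abs_average_sub_le hκ hκ1 hsφ hsη hs₀ hs₁ hi₀ hi₁ hiη heq
  refine ⟨C, hC, fun x R hR => ?_⟩
  have h1 := ((tendsto_average hκ hκ1 hsφ hφ x).const_sub
    (∫ z, φ (x - R • z) * mollifier κ z)).abs
  rw [sub_zero] at h1
  exact le_of_tendsto h1 ((eventually_ge_atTop R).mono fun n hn => h x R n hR hn)

end

section

theorem norm_le_of_dir {E : Type*} [NormedAddCommGroup E] [NormedSpace ℝ E] (L : ℂ →L[ℝ] E) :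
    ‖L‖ ≤ ‖L 1‖ + ‖L Complex.I‖ := by
  refine L.opNorm_le_bound (by positivity) fun v => ?_
  have : v = v.re • (1 : ℂ) + v.im • Complex.I := by
    simp [Complex.re_add_im]
  rw [this, map_add, map_smul, map_smul, ← this, add_mul]
  refine (norm_add_le _ _).trans (add_le_add ?_ ?_)
  · rw [norm_smul, mul_comm]
    exact mul_le_mul_of_nonneg_left (Complex.abs_re_le_norm v) (norm_nonneg _)
  · rw [norm_smul, mul_comm]
    exact mul_le_mul_of_nonneg_left (Complex.abs_im_le_norm v) (norm_nonneg _)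

theorem norm_fderiv_le_D (f : ℂ → ℝ) (z : ℂ) :
    ‖fderiv ℝ f z‖ ≤ |D 0 f z| + |D 1 f z| := by
  simpa [D, dir] using norm_le_of_dir (fderiv ℝ f z)

variable {κ C₁ C₂ R₂ B : ℝ} {φ : ℂ → ℝ}

/-- One step of the decay iteration. -/
theorem phase_improvement (hκ : 0 < κ) (hκ1 : κ ≤ 1) (hφ : ContDiff ℝ ∞ φ) (hC₁ : 0 < C₁)
    (hC₂ : 0 ≤ C₂)
    (hgrad : ∀ y : ℂ, R₂ ≤ ‖y‖ → ∀ σ : ℝ, 0 ≤ σ → (∀ z, ‖z - y‖ ≤ ‖y‖ / 2 → |φ z| ≤ σ) →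
      ∀ j, |D j φ y| ≤ C₁ / ‖y‖ * (σ + 1 / ‖y‖))
    (hav : ∀ (x : ℂ) (R : ℝ), 1 ≤ R → |∫ z, φ (x - R • z) * mollifier κ z| ≤ C₂ / R) :
    ∃ A r₁ : ℝ, 0 ≤ A ∧ 1 ≤ r₁ ∧ ∀ x : ℂ, r₁ ≤ ‖x‖ → ∀ σ : ℝ, 0 ≤ σ →
      (∀ z, ‖x‖ / 4 ≤ ‖z‖ → |φ z| ≤ σ) → |φ x| ≤ A / ‖x‖ + σ / 8 := by
  have hm := integral_mollifier_pos hκ hκ1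
  set m := ∫ z, mollifier κ z with hm_def
  set δ := min (1 / 4) (1 / (32 * C₁)) with hδ
  have hδ0 : 0 < δ := lt_min (by norm_num) (by positivity)
  have hδ1 : δ ≤ 1 / 4 := min_le_left _ _
  have hδ2 : C₁ * δ ≤ 1 / 32 := by
    calc _ ≤ C₁ * (1 / (32 * C₁)) := mul_le_mul_of_nonneg_left (min_le_right _ _) hC₁.le
      _ = _ := by field_simp
  refine ⟨C₂ / (δ * m) + 1 / 4, max (1 / δ) (2 * |R₂|), by positivity,
    le_max_of_le_left ((one_le_div hδ0).2 (by linarith)), fun x hx σ hσ hφσ => ?_⟩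
  have hx1 := (le_max_left _ _).trans hx
  have hx2 := (le_max_right _ _).trans hx
  have hx0 : 0 < ‖x‖ := lt_of_lt_of_le (by positivity) hx1
  set R := δ * ‖x‖ with hR
  have hR1 : 1 ≤ R := by rwa [div_le_iff₀ hδ0, mul_comm] at hx1
  have hRx : R ≤ ‖x‖ / 4 := by
    have := mul_le_mul_of_nonneg_right hδ1 hx0.le
    linarith
  set G := 4 * C₁ / ‖x‖ * (σ + 2 / ‖x‖) with hG
  have hball : ∀ w ∈ closedBall x R, ‖fderiv ℝ φ w‖ ≤ G := by
    intro w hw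
    rw [mem_closedBall, dist_eq_norm] at hw
    have h1 := norm_sub_norm_le x w
    rw [norm_sub_rev] at h1
    have h2 : 3 / 4 * ‖x‖ ≤ ‖w‖ := by linarith
    have hw0 : 0 < ‖w‖ := by linarith
    have h3 := hgrad w (by linarith [le_abs_self R₂]) σ hσ fun z hz => hφσ z (by
      have h4 := norm_sub_norm_le w z
      rw [norm_sub_rev] at h4
      linarith)
    have h4 : C₁ / ‖w‖ * (σ + 1 / ‖w‖) ≤ 2 * C₁ / ‖x‖ * (σ + 2 / ‖x‖) := by
      have : C₁ / ‖w‖ ≤ 2 * C₁ / ‖x‖ := by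
        rw [div_le_div_iff₀ hw0 hx0]
        nlinarith
      have : 1 / ‖w‖ ≤ 2 / ‖x‖ := by
        rw [div_le_div_iff₀ hw0 hx0]
        linarith
      gcongr
    refine (norm_fderiv_le_D φ w).trans ((add_le_add ((h3 0).trans h4) ((h3 1).trans h4)).trans ?_)
    rw [hG]
    apply le_of_eq
    ring
  have hdiff : ∀ z : ℂ, ‖z‖ ≤ 1 → |φ x - φ (x - R • z)| ≤ (σ + 2 / ‖x‖) / 8 := by
    intro z hz
    have hzR : ‖R • z‖ ≤ R := by
      rw [norm_smul, Real.norm_eq_abs, abs_of_pos (by linarith)]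
      exact mul_le_of_le_one_right (by linarith) hz
    have h := (convex_closedBall x R).norm_image_sub_le_of_norm_fderiv_le (𝕜 := ℝ)
      (fun w _ => diffAt hφ) hball (x := x - R • z) (y := x)
      (by rw [mem_closedBall, dist_eq_norm, sub_sub_cancel_left, norm_neg]; exact hzR)
      (mem_closedBall_self (by linarith))
    rw [Real.norm_eq_abs, sub_sub_cancel] at h
    have hG0 : 0 ≤ G := by positivity
    calc _ ≤ G * R := h.trans (mul_le_mul_of_nonneg_left hzR hG0)
      _ = C₁ * δ * (4 * (σ + 2 / ‖x‖)) := by rw [hG, hR]; field_simp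
      _ ≤ 1 / 32 * (4 * (σ + 2 / ‖x‖)) := by gcongr
      _ = _ := by ring
  have hcm := (contDiff_mollifier κ).continuous
  have hcs := hasCompactSupport_mollifier hκ hκ1
  have hcφ := hφ.continuous
  have im := integrable_of_smooth (contDiff_mollifier κ) hcs
  have i1 : Integrable (fun z => φ (x - R • z) * mollifier κ z) :=
    (by fun_prop : Continuous _).integrable_of_hasCompactSupport hcs.mul_left
  have i2 : Integrable (fun z => (φ x - φ (x - R • z)) * mollifier κ z) :=
    (by fun_prop : Continuous _).integrable_of_hasCompactSupport hcs.mul_left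
  have split : φ x * m = (∫ z, φ (x - R • z) * mollifier κ z)
      + ∫ z, (φ x - φ (x - R • z)) * mollifier κ z := by
    rw [← integral_add i1 i2, hm_def, ← integral_const_mul]
    congr 1
    funext z
    ring
  have h2 : |∫ z, (φ x - φ (x - R • z)) * mollifier κ z| ≤ (σ + 2 / ‖x‖) / 8 * m := by
    refine abs_integral_le_integral_abs.trans ?_
    rw [hm_def, ← integral_const_mul]
    refine integral_mono i2.abs (im.const_mul _) fun z => ?_
    beta_reduce
    rcases le_or_gt ‖z‖ 1 with hz | hz
    · rw [abs_mul, abs_of_nonneg (mollifier_nonneg hκ z)]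
      exact mul_le_mul_of_nonneg_right (hdiff z hz) (mollifier_nonneg hκ z)
    · simp [mollifier_eq_zero hκ hκ1 hz]
  have h3 : |φ x| * m ≤ C₂ / R + (σ + 2 / ‖x‖) / 8 * m := by
    rw [← abs_of_pos hm, ← abs_mul, abs_of_pos hm, split]
    exact (abs_add_le _ _).trans (add_le_add (hav x R hR1) h2)
  calc |φ x| = |φ x| * m / m := by field_simp
    _ ≤ (C₂ / R + (σ + 2 / ‖x‖) / 8 * m) / m := by gcongr
    _ = _ := by rw [hR]; field_simp; ring

theorem decay_of_improvement {A r₁ : ℝ} (hA : 0 ≤ A) (hr₁ : 1 ≤ r₁) (hB : ∀ z, |φ z| ≤ B)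
    (himp : ∀ x : ℂ, r₁ ≤ ‖x‖ → ∀ σ : ℝ, 0 ≤ σ → (∀ z, ‖x‖ / 4 ≤ ‖z‖ → |φ z| ≤ σ) →
      |φ x| ≤ A / ‖x‖ + σ / 8) :
    ∃ K : ℝ, 0 ≤ K ∧ ∀ y : ℂ, r₁ ≤ ‖y‖ → |φ y| ≤ K / ‖y‖ := by
  have hB0 : 0 ≤ B := (abs_nonneg _).trans (hB 0)
  have hr0 : 0 < r₁ := by linarith
  set K := B + 2 * A with hK
  have hK0 : 0 ≤ K := by positivity
  have iter : ∀ (n : ℕ) (y : ℂ), 4 ^ n * r₁ ≤ ‖y‖ → |φ y| ≤ K / 4 ^ n := by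
    intro n
    induction n with
    | zero => exact fun y _ => (hB y).trans (by rw [pow_zero, div_one]; linarith)
    | succ n ih =>
      intro y hy
      have h4 : (1 : ℝ) ≤ 4 ^ (n + 1) := one_le_pow₀ (by norm_num)
      have hy1 : r₁ ≤ ‖y‖ := (le_mul_of_one_le_left hr0.le h4).trans hy
      have h := himp y hy1 (K / 4 ^ n) (by positivity) fun z hz => ih z (by
        rw [pow_succ] at hy
        linarith)
      have h5 : A / ‖y‖ ≤ A / 4 ^ (n + 1) := by
        gcongr
        exact (le_mul_of_one_le_right (by positivity) hr₁).trans hy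
      calc _ ≤ A / 4 ^ (n + 1) + K / 4 ^ n / 8 := h.trans (by gcongr)
        _ = (A + K / 2) / 4 ^ (n + 1) := by field_simp; ring
        _ ≤ _ := by gcongr; linarith
  refine ⟨4 * K * r₁, by positivity, fun y hy => ?_⟩
  have hy0 : 0 < ‖y‖ := by linarith
  obtain ⟨n, hn, hn'⟩ := exists_nat_pow_near (x := ‖y‖ / r₁) (y := 4)
    ((one_le_div hr0).2 hy) (by norm_num)
  rw [le_div_iff₀ hr0] at hn
  rw [div_lt_iff₀ hr0, pow_succ] at hn'
  refine (iter n y hn).trans ?_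
  rw [div_le_div_iff₀ (by positivity) hy0]
  calc _ ≤ K * (4 ^ n * 4 * r₁) := by gcongr
    _ = _ := by ring

end

section

theorem D_D_nonpos_of_isLocalMax {P : ℂ → ℝ} (hP : ContDiff ℝ ∞ P) {p : ℂ} (h : IsLocalMax P p)
    (j : Fin 2) : D j (D j P) p ≤ 0 := by
  by_contra! hpos
  set g : ℝ → ℝ := fun t => P (p + t * dir j) with hg
  have d1 : deriv g = fun t : ℝ => D j P (p + t * dir j) :=
    funext fun t => (deriv_line hP p j t).deriv
  have d2 : deriv (deriv g) 0 = D j (D j P) p := by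
    rw [d1, (deriv_line (contDiff_D hP j) p j 0).deriv]
    simp
  have hcont : Continuous fun t : ℝ => p + t * dir j := by fun_prop
  have hmax : IsLocalMax g 0 := by
    have h0 : IsLocalMax P (p + (0 : ℝ) * dir j) := by simpa using h
    exact h0.comp_continuous (b := (0 : ℝ)) hcont.continuousAt
  have hmin : IsLocalMin g 0 := isLocalMin_of_deriv_deriv_pos (by rwa [d2]) hmax.deriv_eq_zero
    (hP.continuous.comp hcont).continuousAt
  have hc : g =ᶠ[nhds 0] fun _ => g 0 := by
    filter_upwards [hmax, hmin] with t h1 h2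
    exact le_antisymm h1 h2
  have : deriv (deriv g) 0 = 0 := by
    rw [hc.deriv.deriv_eq]
    simp
  linarith

theorem D_gsq {f : ℂ → ℝ} (hf : ContDiff ℝ ∞ f) (j : Fin 2) :
    D j (gsq f) = fun z => 2 * gdot f (D j f) z := by
  rw [gsq_eq_gdot, D_gdot hf hf]
  funext z
  rw [gdot_comm]
  ring

/-- Bochner's formula in the plane. -/
theorem lapR_gsq {f : ℂ → ℝ} (hf : ContDiff ℝ ∞ f) (z : ℂ) :
    lapR (gsq f) z = 2 * hsq f z + 2 * gdot f (lapR f) z := by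
  have h : ∀ j, D j (D j (gsq f)) z = 2 * gsq (D j f) z + 2 * gdot f (D j (D j f)) z := fun j => by
    rw [D_gsq hf]
    simp (disch := fun_prop) only [D_mul, D_const, D_gdot, gsq_eq_gdot]
    ring
  have e : gdot f (lapR f) z = gdot f (D 0 (D 0 f)) z + gdot f (D 1 (D 1 f)) z := by
    unfold lapR gdot
    simp (disch := fun_prop) only [D_add]
    ring
  rw [lapR, h, h, e, hsq]
  ring

theorem lapR_add {f g : ℂ → ℝ} (hf : ContDiff ℝ ∞ f) (hg : ContDiff ℝ ∞ g) (z : ℂ) :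
    lapR (fun z => f z + g z) z = lapR f z + lapR g z := by
  simp (disch := fun_prop) only [lapR, D_add]
  ring

theorem lapR_mul {f g : ℂ → ℝ} (hf : ContDiff ℝ ∞ f) (hg : ContDiff ℝ ∞ g) (z : ℂ) :
    lapR (fun z => f z * g z) z = f z * lapR g z + 2 * gdot f g z + g z * lapR f z := by
  unfold gdot
  simp (disch := fun_prop) only [lapR, D_mul, D_add]
  ring

theorem lapR_pow_two {f : ℂ → ℝ} (hf : ContDiff ℝ ∞ f) (z : ℂ) :
    lapR (fun z => f z ^ 2) z = 2 * gsq f z + 2 * (f z * lapR f z) := by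
  simp only [pow_two]
  rw [lapR_mul hf hf, gsq_eq_gdot]
  ring

/-- The deviation from modulus one of `a + i b`. -/
def defect (a b : ℂ → ℝ) (z : ℂ) : ℝ := 1 - a z ^ 2 - b z ^ 2

@[fun_prop]
theorem contDiff_defect {a b : ℂ → ℝ} (ha : ContDiff ℝ ∞ a) (hb : ContDiff ℝ ∞ b) :
    ContDiff ℝ ∞ (defect a b) := by
  unfold defect; fun_prop

/-- The travelling wave equation in terms of the real and imaginary parts. -/
structure WaveSystem (c : ℝ) (a b : ℂ → ℝ) : Prop where
  smooth_a : ContDiff ℝ ∞ a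
  smooth_b : ContDiff ℝ ∞ b
  eq_a : ∀ z, lapR a z = c * D 1 b z - defect a b z * a z
  eq_b : ∀ z, lapR b z = -c * D 1 a z - defect a b z * b z

variable {c : ℝ} {a b : ℂ → ℝ}

theorem D_defect (ha : ContDiff ℝ ∞ a) (hb : ContDiff ℝ ∞ b) (j : Fin 2) :
    D j (defect a b) = fun z => -2 * (a z * D j a z + b z * D j b z) := by
  unfold defect
  simp (disch := fun_prop) only [D_sub, D_const, D_pow]
  funext z
  push_cast
  ring

theorem WaveSystem.lapR_density_ge (hW : WaveSystem c a b) (hc : c ^ 2 ≤ 2) (z : ℂ) :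
    3 / 2 * (hsq a z + hsq b z) - 6 * (gsq a z + gsq b z)
      ≤ lapR (fun z => gsq a z + gsq b z) z := by
  have ha := hW.smooth_a
  have hb := hW.smooth_b
  rw [lapR_add (by fun_prop) (by fun_prop), lapR_gsq ha, lapR_gsq hb]
  have e1 : gdot a (lapR a) z + gdot b (lapR b) z
      = c * gdot a (D 1 b) z - c * gdot b (D 1 a) z - defect a b z * (gsq a z + gsq b z)
        + 1 / 2 * gsq (defect a b) z := by
    rw [show lapR a = _ from funext hW.eq_a, show lapR b = _ from funext hW.eq_b]
    unfold gdot gsq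
    simp (disch := fun_prop) only [D_sub, D_mul, D_const, D_defect ha hb]
    ring
  have young : ∀ x y : ℝ, |c * (x * y)| ≤ c ^ 2 * x ^ 2 + y ^ 2 / 4 := fun x y =>
    abs_le.2 ⟨by linarith [sq_nonneg (c * x + y / 2)], by linarith [sq_nonneg (c * x - y / 2)]⟩
  have y1 : ∀ f g : ℂ → ℝ, |c * gdot f g z| ≤ c ^ 2 * gsq f z + gsq g z / 4 := fun f g => by
    unfold gdot gsq
    rw [mul_add]
    refine (abs_add_le _ _).trans ?_
    linarith [young (D 0 f z) (D 0 g z), young (D 1 f z) (D 1 g z)]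
  have h1 := abs_le.1 (y1 a (D 1 b))
  have h2 := abs_le.1 (y1 b (D 1 a))
  have g1 := gsq_D_le_hsq a 1 z
  have g2 := gsq_D_le_hsq b 1 z
  have n1 := gsq_nonneg a z
  have n2 := gsq_nonneg b z
  have n3 := gsq_nonneg (defect a b) z
  have hη : defect a b z ≤ 1 := by unfold defect; nlinarith [sq_nonneg (a z), sq_nonneg (b z)]
  have h3 := mul_le_mul_of_nonneg_right hη (add_nonneg n1 n2)
  have h4 := mul_le_mul_of_nonneg_right hc (add_nonneg n1 n2)
  linarith [h1.1, h2.2]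

theorem WaveSystem.lapR_dist_ge (hW : WaveSystem c a b) (hc : c ^ 2 ≤ 2) {z : ℂ} {σ : ℝ}
    (hσ : σ ≤ 1) (ha1 : |a z - 1| ≤ σ) (hb1 : |b z| ≤ σ) :
    3 / 2 * (gsq a z + gsq b z) - 32 * σ ^ 2 ≤ lapR (fun z => (a z - 1) ^ 2 + b z ^ 2) z := by
  have ha := hW.smooth_a
  have hb := hW.smooth_b
  have hσ0 : 0 ≤ σ := (abs_nonneg _).trans hb1
  have hDa : ∀ j, D j (fun z => a z - 1) = D j a := fun j => by
    simp (disch := fun_prop) only [D_sub, D_const]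
    simp
  have e0 : lapR (fun z => a z - 1) z = lapR a z := by rw [lapR, lapR, hDa, hDa]
  have e1 : gsq (fun z => a z - 1) z = gsq a z := by rw [gsq, gsq, hDa, hDa]
  rw [lapR_add (by fun_prop) (by fun_prop), lapR_pow_two (by fun_prop), lapR_pow_two hb, e0, e1,
    hW.eq_a, hW.eq_b]
  have hη : |defect a b z| ≤ 4 * σ := by
    have : defect a b z = -(2 * (a z - 1) + (a z - 1) * (a z - 1) + b z * b z) := by
      unfold defect; ring
    rw [this, abs_neg]
    have t1 := abs_add_le (2 * (a z - 1) + (a z - 1) * (a z - 1)) (b z * b z)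
    have t2 := abs_add_le (2 * (a z - 1)) ((a z - 1) * (a z - 1))
    rw [abs_mul, abs_mul, abs_two] at t2
    rw [abs_mul] at t1
    nlinarith [mul_le_mul ha1 ha1 (abs_nonneg _) hσ0, mul_le_mul hb1 hb1 (abs_nonneg _) hσ0]
  have hr : |(a z - 1) * a z + b z * b z| ≤ 3 * σ := by
    have : (a z - 1) * a z + b z * b z = ((a z - 1) + (a z - 1) * (a z - 1)) + b z * b z := by
      ring
    rw [this]
    have t1 := abs_add_le ((a z - 1) + (a z - 1) * (a z - 1)) (b z * b z)
    have t2 := abs_add_le (a z - 1) ((a z - 1) * (a z - 1))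
    rw [abs_mul] at t2 t1
    nlinarith [mul_le_mul ha1 ha1 (abs_nonneg _) hσ0, mul_le_mul hb1 hb1 (abs_nonneg _) hσ0]
  have hprod : |defect a b z * ((a z - 1) * a z + b z * b z)| ≤ 12 * σ ^ 2 := by
    rw [abs_mul]
    calc _ ≤ 4 * σ * (3 * σ) := by gcongr
      _ = _ := by ring
  have young : ∀ x y : ℝ, |x| ≤ σ → |c * (x * y)| ≤ 2 * σ ^ 2 + y ^ 2 / 4 := fun x y hx => by
    have h1 : x ^ 2 ≤ σ ^ 2 := sq_le_sq' (abs_le.1 hx).1 (abs_le.1 hx).2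
    have h2 : c ^ 2 * x ^ 2 ≤ 2 * σ ^ 2 := by gcongr
    exact abs_le.2 ⟨by linarith [sq_nonneg (c * x + y / 2)],
      by linarith [sq_nonneg (c * x - y / 2)]⟩
  have y1 := abs_le.1 (young _ (D 1 b z) ha1)
  have y2 := abs_le.1 (young _ (D 1 a z) hb1)
  have g1 := D_sq_le_gsq a 1 z
  have g2 := D_sq_le_gsq b 1 z
  have hp := abs_le.1 hprod
  linarith [y1.1, y2.2, hp.2]

/-- Bernstein-type interior gradient estimate for solutions close to the constant `1`. -/
theorem WaveSystem.gradient_bound (hW : WaveSystem c a b) (hc : c ^ 2 ≤ 2) {x₀ : ℂ} {σ : ℝ}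
    (hσ : σ ≤ 1) (h : ∀ z, ‖z - x₀‖ ≤ 1 → |a z - 1| ≤ σ ∧ |b z| ≤ σ) :
    gsq a x₀ + gsq b x₀ ≤ 280 * σ ^ 2 := by
  have ha := hW.smooth_a
  have hb := hW.smooth_b
  let ζ : ℂ → ℝ := fun z => 1 - (z.re - x₀.re) ^ 2 - (z.im - x₀.im) ^ 2
  let e : ℂ → ℝ := fun z => gsq a z + gsq b z
  let v : ℂ → ℝ := fun z => (a z - 1) ^ 2 + b z ^ 2
  have hζ : ContDiff ℝ ∞ ζ := by fun_prop
  have he : ContDiff ℝ ∞ e := by fun_prop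
  have hv : ContDiff ℝ ∞ v := by fun_prop
  have hζn : ∀ z, ζ z = 1 - ‖z - x₀‖ ^ 2 := fun z => by
    rw [Complex.sq_norm, Complex.normSq_apply]
    simp only [ζ, Complex.sub_re, Complex.sub_im]
    ring
  let P : ℂ → ℝ := fun z => ζ z ^ 2 * e z + 60 * v z
  have hP : ContDiff ℝ ∞ P := by fun_prop
  have hv2 : ∀ z, ‖z - x₀‖ ≤ 1 → v z ≤ 2 * σ ^ 2 := fun z hz => by
    obtain ⟨h1, h2⟩ := h z hz
    have h3 := sq_le_sq' (abs_le.1 h1).1 (abs_le.1 h1).2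
    have h4 := sq_le_sq' (abs_le.1 h2).1 (abs_le.1 h2).2
    simp only [v]
    linarith
  have he0 : ∀ z, 0 ≤ e z := fun z => add_nonneg (gsq_nonneg _ _) (gsq_nonneg _ _)
  obtain ⟨p, hp, hmax⟩ := (isCompact_closedBall x₀ 1).exists_isMaxOn
    ⟨x₀, mem_closedBall_self zero_le_one⟩ hP.continuous.continuousOn
  have hPx : e x₀ ≤ P x₀ := by
    have : 0 ≤ v x₀ := by simp only [v]; positivity
    simp only [P, hζn, sub_self, norm_zero]
    linarith
  have hPp : P x₀ ≤ P p := hmax (mem_closedBall_self zero_le_one)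
  rw [mem_closedBall, dist_eq_norm] at hp
  have hvp := hv2 p hp
  refine hPx.trans (hPp.trans ?_)
  rcases hp.eq_or_lt with hp1 | hp1
  · have : ζ p = 0 := by rw [hζn, hp1]; norm_num
    simp only [P, this]
    nlinarith [sq_nonneg σ]
  have hloc : IsLocalMax P p :=
    hmax.isLocalMax (mem_of_superset (isOpen_ball.mem_nhds (by
      rwa [mem_ball, dist_eq_norm])) ball_subset_closedBall)
  have hlap : lapR P p ≤ 0 :=
    add_nonpos (D_D_nonpos_of_isLocalMax hP hloc 0) (D_D_nonpos_of_isLocalMax hP hloc 1)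
  have D0ζ : D 0 ζ = fun z => -2 * (z.re - x₀.re) := by
    simp (disch := fun_prop) only [ζ, D_sub, D_pow, D_const, D_re, D_im]
    funext z
    simp [dir]
  have D1ζ : D 1 ζ = fun z => -2 * (z.im - x₀.im) := by
    simp (disch := fun_prop) only [ζ, D_sub, D_pow, D_const, D_re, D_im]
    funext z
    simp [dir]
  have lapζ : lapR ζ p = -4 := by
    rw [lapR, D0ζ, D1ζ]
    simp (disch := fun_prop) only [D_mul, D_sub, D_const, D_re, D_im]
    simp [dir]
    norm_num
  have gζ : gsq ζ p = 4 * (1 - ζ p) := by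
    rw [gsq, D0ζ, D1ζ]
    simp only [ζ]
    ring
  have hζ0 : 0 ≤ ζ p := by rw [hζn]; nlinarith [norm_nonneg (p - x₀)]
  have hζ1 : ζ p ≤ 1 := by rw [hζn]; nlinarith [norm_nonneg (p - x₀)]
  have hDe : ∀ j, D j e = fun z => 2 * gdot a (D j a) z + 2 * gdot b (D j b) z := fun j => by
    simp (disch := fun_prop) only [e, D_add]
    simp only [D_gsq ha, D_gsq hb]
  have hcross : -(ζ p ^ 2 * (hsq a p + hsq b p)) - 64 * e p ≤ 4 * (ζ p * gdot ζ e p) := by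
    have young : ∀ t x y : ℝ, -(ζ p ^ 2 * y ^ 2) - 16 * (t ^ 2 * x ^ 2)
        ≤ 8 * (ζ p * (t * (x * y))) := fun t x y => by
      linarith [sq_nonneg (ζ p * y + 4 * (t * x))]
    have h64 : 16 * gsq ζ p * e p ≤ 64 * e p := by
      refine mul_le_mul_of_nonneg_right ?_ (he0 p)
      linarith
    have expand : 4 * (ζ p * gdot ζ e p) = 8 * (ζ p * (D 0 ζ p * (D 0 a p * D 0 (D 0 a) p)))
        + 8 * (ζ p * (D 0 ζ p * (D 1 a p * D 1 (D 0 a) p)))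
        + 8 * (ζ p * (D 1 ζ p * (D 0 a p * D 0 (D 1 a) p)))
        + 8 * (ζ p * (D 1 ζ p * (D 1 a p * D 1 (D 1 a) p)))
        + 8 * (ζ p * (D 0 ζ p * (D 0 b p * D 0 (D 0 b) p)))
        + 8 * (ζ p * (D 0 ζ p * (D 1 b p * D 1 (D 0 b) p)))
        + 8 * (ζ p * (D 1 ζ p * (D 0 b p * D 0 (D 1 b) p)))
        + 8 * (ζ p * (D 1 ζ p * (D 1 b p * D 1 (D 1 b) p))) := by
      rw [gdot, hDe, hDe]
      unfold gdot
      ring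
    have h16 : 16 * gsq ζ p * e p = 16 * (D 0 ζ p ^ 2 * D 0 a p ^ 2)
        + 16 * (D 0 ζ p ^ 2 * D 1 a p ^ 2) + 16 * (D 1 ζ p ^ 2 * D 0 a p ^ 2)
        + 16 * (D 1 ζ p ^ 2 * D 1 a p ^ 2) + 16 * (D 0 ζ p ^ 2 * D 0 b p ^ 2)
        + 16 * (D 0 ζ p ^ 2 * D 1 b p ^ 2) + 16 * (D 1 ζ p ^ 2 * D 0 b p ^ 2)
        + 16 * (D 1 ζ p ^ 2 * D 1 b p ^ 2) := by
      simp only [e, gsq]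
      ring
    have hH : ζ p ^ 2 * (hsq a p + hsq b p) = ζ p ^ 2 * D 0 (D 0 a) p ^ 2
        + ζ p ^ 2 * D 1 (D 0 a) p ^ 2 + ζ p ^ 2 * D 0 (D 1 a) p ^ 2
        + ζ p ^ 2 * D 1 (D 1 a) p ^ 2 + ζ p ^ 2 * D 0 (D 0 b) p ^ 2
        + ζ p ^ 2 * D 1 (D 0 b) p ^ 2 + ζ p ^ 2 * D 0 (D 1 b) p ^ 2
        + ζ p ^ 2 * D 1 (D 1 b) p ^ 2 := by
      simp only [hsq, gsq]
      ring
    rw [expand, hH]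
    linarith [young (D 0 ζ p) (D 0 a p) (D 0 (D 0 a) p),
      young (D 0 ζ p) (D 1 a p) (D 1 (D 0 a) p), young (D 1 ζ p) (D 0 a p) (D 0 (D 1 a) p),
      young (D 1 ζ p) (D 1 a p) (D 1 (D 1 a) p), young (D 0 ζ p) (D 0 b p) (D 0 (D 0 b) p),
      young (D 0 ζ p) (D 1 b p) (D 1 (D 0 b) p), young (D 1 ζ p) (D 0 b p) (D 0 (D 1 b) p),
      young (D 1 ζ p) (D 1 b p) (D 1 (D 1 b) p)]
  have hgζ2 : gdot (fun z => ζ z ^ 2) e p = 2 * (ζ p * gdot ζ e p) := by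
    unfold gdot
    simp (disch := fun_prop) only [D_pow]
    push_cast
    ring
  have hPlap : lapR P p = ζ p ^ 2 * lapR e p + 4 * (ζ p * gdot ζ e p)
      + e p * (2 * gsq ζ p - 8 * ζ p) + 60 * lapR v p := by
    have hsmul : ∀ f : ℂ → ℝ, ContDiff ℝ ∞ f → ∀ j,
        D j (fun z => 60 * f z) = fun z => 60 * D j f z := fun f hf j => by
      rw [D_mul contDiff_const hf, D_const]
      funext z
      ring
    have h60 : lapR (fun z => 60 * v z) p = 60 * lapR v p := by
      rw [lapR, hsmul v hv, hsmul v hv, hsmul _ (contDiff_D hv 0), hsmul _ (contDiff_D hv 1), lapR]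
      ring
    simp only [P]
    rw [lapR_add (by fun_prop) (by fun_prop), lapR_mul (by fun_prop) he, h60, hgζ2,
      lapR_pow_two hζ, lapζ]
    ring
  have k1 := mul_le_mul_of_nonneg_left (hW.lapR_density_ge hc p) (sq_nonneg (ζ p))
  have k2 := hW.lapR_dist_ge hc hσ (h p hp).1 (h p hp).2
  have hζ2 : ζ p ^ 2 ≤ 1 := pow_le_one₀ hζ0 hζ1
  have k3 : ζ p ^ 2 * e p ≤ e p := mul_le_of_le_one_left (he0 p) hζ2
  have k4 : e p * ζ p ≤ e p := mul_le_of_le_one_right (he0 p) hζ1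
  have k5 : 0 ≤ e p * gsq ζ p := mul_nonneg (he0 p) (gsq_nonneg _ _)
  have k6 : 0 ≤ ζ p ^ 2 * (hsq a p + hsq b p) :=
    mul_nonneg (sq_nonneg _) (add_nonneg (hsq_nonneg _ _) (hsq_nonneg _ _))
  have hep : e p ≤ 160 * σ ^ 2 := by
    change ζ p ^ 2 * (3 / 2 * (hsq a p + hsq b p) - 6 * e p) ≤ ζ p ^ 2 * lapR e p at k1
    change 3 / 2 * e p - 32 * σ ^ 2 ≤ lapR v p at k2
    rw [hPlap] at hlap
    linarith
  simp only [P]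
  linarith

end

section

/-- `a + ib = exp (s + iφ)` on `Ω`, with `s` and `φ` globally smooth. -/
structure Polar (Ω : Set ℂ) (a b s φ : ℂ → ℝ) : Prop where
  smooth_s : ContDiff ℝ ∞ s
  smooth_φ : ContDiff ℝ ∞ φ
  isOpen : IsOpen Ω
  eq_a : ∀ z ∈ Ω, a z = Real.exp (s z) * Real.cos (φ z)
  eq_b : ∀ z ∈ Ω, b z = Real.exp (s z) * Real.sin (φ z)

variable {c : ℝ} {Ω : Set ℂ} {a b s φ : ℂ → ℝ} {z : ℂ}

theorem Polar.mono {Ω' : Set ℂ} (h : Polar Ω a b s φ) (hΩ : IsOpen Ω') (hsub : Ω' ⊆ Ω) :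
    Polar Ω' a b s φ :=
  ⟨h.smooth_s, h.smooth_φ, hΩ, fun z hz => h.eq_a z (hsub hz), fun z hz => h.eq_b z (hsub hz)⟩

theorem Polar.D_a (h : Polar Ω a b s φ) (hz : z ∈ Ω) (j : Fin 2) :
    D j a z = Real.exp (s z) * (Real.cos (φ z) * D j s z - Real.sin (φ z) * D j φ z) := by
  have hs := h.smooth_s
  have hφ := h.smooth_φ
  rw [D_eq_of_eqOn h.isOpen h.eq_a j hz]
  simp (disch := fun_prop) only [D_mul, D_exp, D_cos]
  ring

theorem Polar.D_b (h : Polar Ω a b s φ) (hz : z ∈ Ω) (j : Fin 2) :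
    D j b z = Real.exp (s z) * (Real.sin (φ z) * D j s z + Real.cos (φ z) * D j φ z) := by
  have hs := h.smooth_s
  have hφ := h.smooth_φ
  rw [D_eq_of_eqOn h.isOpen h.eq_b j hz]
  simp (disch := fun_prop) only [D_mul, D_exp, D_sin]
  ring

theorem Polar.D_D_a (h : Polar Ω a b s φ) (hz : z ∈ Ω) (j : Fin 2) :
    D j (D j a) z = Real.exp (s z) *
      (Real.cos (φ z) * (D j (D j s) z + D j s z ^ 2 - D j φ z ^ 2)
        - Real.sin (φ z) * (D j (D j φ) z + 2 * (D j s z * D j φ z))) := by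
  have hs := h.smooth_s
  have hφ := h.smooth_φ
  rw [D_eq_of_eqOn h.isOpen (fun z hz => h.D_a hz j) j hz]
  simp (disch := fun_prop) only [D_mul, D_sub, D_exp, D_cos, D_sin]
  ring

theorem Polar.D_D_b (h : Polar Ω a b s φ) (hz : z ∈ Ω) (j : Fin 2) :
    D j (D j b) z = Real.exp (s z) *
      (Real.sin (φ z) * (D j (D j s) z + D j s z ^ 2 - D j φ z ^ 2)
        + Real.cos (φ z) * (D j (D j φ) z + 2 * (D j s z * D j φ z))) := by
  have hs := h.smooth_s
  have hφ := h.smooth_φ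
  rw [D_eq_of_eqOn h.isOpen (fun z hz => h.D_b hz j) j hz]
  simp (disch := fun_prop) only [D_mul, D_add, D_exp, D_cos, D_sin]
  ring

theorem Polar.sq_add_sq (h : Polar Ω a b s φ) (hz : z ∈ Ω) :
    a z ^ 2 + b z ^ 2 = Real.exp (s z) ^ 2 := by
  rw [h.eq_a z hz, h.eq_b z hz]
  linear_combination Real.exp (s z) ^ 2 * Real.sin_sq_add_cos_sq (φ z)

theorem Polar.D_sq_add_D_sq (h : Polar Ω a b s φ) (hz : z ∈ Ω) (j : Fin 2) :
    D j a z ^ 2 + D j b z ^ 2 = Real.exp (s z) ^ 2 * (D j s z ^ 2 + D j φ z ^ 2) := by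
  rw [h.D_a hz, h.D_b hz]
  linear_combination Real.exp (s z) ^ 2 * (D j s z ^ 2 + D j φ z ^ 2) *
    Real.sin_sq_add_cos_sq (φ z)

theorem Polar.current_eq (h : Polar Ω a b s φ) (hz : z ∈ Ω) (j : Fin 2) :
    a z * D j b z - b z * D j a z = Real.exp (s z) ^ 2 * D j φ z := by
  rw [h.D_a hz, h.D_b hz, h.eq_a z hz, h.eq_b z hz]
  linear_combination Real.exp (s z) ^ 2 * D j φ z * Real.sin_sq_add_cos_sq (φ z)

theorem Polar.defect_eq (h : Polar Ω a b s φ) (hz : z ∈ Ω) :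
    defect a b z = 1 - Real.exp (s z) ^ 2 := by
  rw [← h.sq_add_sq hz, defect]
  ring

theorem WaveSystem.polar_eq_s (hW : WaveSystem c a b) (h : Polar Ω a b s φ) (hz : z ∈ Ω) :
    lapR s z - 2 * s z - c * D 1 φ z = nlF s φ z := by
  have ea := hW.eq_a z
  have eb := hW.eq_b z
  rw [h.defect_eq hz, lapR, h.D_D_a hz, h.D_D_a hz, h.D_b hz, h.eq_a z hz] at ea
  rw [h.defect_eq hz, lapR, h.D_D_b hz, h.D_D_b hz, h.D_a hz, h.eq_b z hz] at eb
  have hexp : Real.exp (2 * s z) = Real.exp (s z) ^ 2 := by rw [sq, ← Real.exp_add]; ring_nf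
  have t := Real.sin_sq_add_cos_sq (φ z)
  refine mul_left_cancel₀ (Real.exp_ne_zero (s z)) ?_
  rw [nlF, gsq, gsq, hexp, lapR]
  linear_combination Real.cos (φ z) * ea + Real.sin (φ z) * eb
    - (Real.exp (s z) * (D 0 (D 0 s) z + D 0 s z ^ 2 - D 0 φ z ^ 2 + D 1 (D 1 s) z + D 1 s z ^ 2
      - D 1 φ z ^ 2 - c * D 1 φ z + 1 - Real.exp (s z) ^ 2)) * t

theorem WaveSystem.polar_eq_φ (hW : WaveSystem c a b) (h : Polar Ω a b s φ) (hz : z ∈ Ω) :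
    lapR φ z + c * D 1 s z = nlG s φ z := by
  have ea := hW.eq_a z
  have eb := hW.eq_b z
  rw [h.defect_eq hz, lapR, h.D_D_a hz, h.D_D_a hz, h.D_b hz, h.eq_a z hz] at ea
  rw [h.defect_eq hz, lapR, h.D_D_b hz, h.D_D_b hz, h.D_a hz, h.eq_b z hz] at eb
  have t := Real.sin_sq_add_cos_sq (φ z)
  refine mul_left_cancel₀ (Real.exp_ne_zero (s z)) ?_
  rw [nlG, gdot, lapR]
  linear_combination Real.cos (φ z) * eb - Real.sin (φ z) * ea
    - (Real.exp (s z) * (D 0 (D 0 φ) z + 2 * (D 0 s z * D 0 φ z) + D 1 (D 1 φ) z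
      + 2 * (D 1 s z * D 1 φ z) + c * D 1 s z)) * t

theorem exists_forall_of_tendsto {f : ℂ → ℝ} {l δ : ℝ} (hf : Tendsto f (cocompact ℂ) (nhds l))
    (hδ : 0 < δ) : ∃ R, 0 < R ∧ ∀ z, R ≤ ‖z‖ → |f z - l| ≤ δ := by
  have h := hf.eventually (closedBall_mem_nhds l hδ)
  rw [← cobounded_eq_cocompact, ← comap_norm_atTop, eventually_comap] at h
  obtain ⟨R, hR⟩ := eventually_atTop.1 h
  refine ⟨max R 1, by positivity, fun z hz => ?_⟩
  have := hR ‖z‖ ((le_max_left _ _).trans hz) z rfl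
  rwa [← Real.dist_eq]

theorem eventually_norm_gt (R : ℝ) : ∀ᶠ z : ℂ in cocompact ℂ, R < ‖z‖ :=
  tendsto_norm_cocompact_atTop.eventually_gt_atTop R

theorem isOpen_norm_gt (R : ℝ) : IsOpen {z : ℂ | R < ‖z‖} :=
  isOpen_lt continuous_const continuous_norm

/-- A complex function tending to `1` at infinity has a smooth logarithm near infinity. -/
theorem exists_polar (ha : ContDiff ℝ ∞ a) (hb : ContDiff ℝ ∞ b)
    (hla : Tendsto a (cocompact ℂ) (nhds 1)) (hlb : Tendsto b (cocompact ℂ) (nhds 0)) :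
    ∃ (s φ : ℂ → ℝ) (R : ℝ), 0 < R ∧ Polar {z | R < ‖z‖} a b s φ ∧
      Tendsto s (cocompact ℂ) (nhds 0) ∧ Tendsto φ (cocompact ℂ) (nhds 0) := by
  obtain ⟨R, hR, hRa⟩ := exists_forall_of_tendsto hla (δ := 1 / 2) (by norm_num)
  let q : ℂ → ℝ := fun z => 1 + (1 - cut (2 * R) 0 z) * (a z - 1)
  have hcut := contDiff_cut (2 * R) 0
  have hq : ContDiff ℝ ∞ q := by fun_prop
  have hq0 : ∀ z, 0 < q z := fun z => by
    rcases le_total ‖z‖ R with hz | hz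
    · have : cut (2 * R) 0 z = 1 := cut_eq_one (by positivity) (by rw [sub_zero]; linarith)
      simp [q, this]
    · have h1 := abs_le.1 (hRa z hz)
      have h2 := cut_nonneg (2 * R) 0 z
      have h3 := cut_le_one (2 * R) 0 z
      simp only [q]
      nlinarith
  have hqa : ∀ z, 2 * R < ‖z‖ → q z = a z := fun z hz => by
    have : cut (2 * R) 0 z = 0 := cut_eq_zero (by positivity) (by rw [sub_zero]; exact hz.le)
    simp [q, this]
  have hlq : Tendsto q (cocompact ℂ) (nhds 1) :=
    hla.congr' ((eventually_norm_gt (2 * R)).mono fun z hz => (hqa z hz).symm)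
  have hpos : ∀ z, 0 < q z ^ 2 + b z ^ 2 := fun z => by
    have := hq0 z
    positivity
  refine ⟨fun z => 2⁻¹ * Real.log (q z ^ 2 + b z ^ 2), fun z => Real.arctan (b z / q z), 2 * R,
    by positivity, ⟨?_, ?_, isOpen_norm_gt _, fun z hz => ?_, fun z hz => ?_⟩, ?_, ?_⟩
  · exact contDiff_const.mul (((hq.pow 2).add (hb.pow 2)).log fun z => (hpos z).ne')
  · exact Real.contDiff_arctan.comp (hb.div hq fun z => (hq0 z).ne')
  all_goals try
    have hexp : Real.exp (2⁻¹ * Real.log (q z ^ 2 + b z ^ 2))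
        = q z * √(1 + (b z / q z) ^ 2) := by
      have h1 := hq0 z
      have h2 : q z ^ 2 + b z ^ 2 = q z ^ 2 * (1 + (b z / q z) ^ 2) := by field_simp
      have h3 : √(q z ^ 2 + b z ^ 2) = Real.exp (2⁻¹ * Real.log (q z ^ 2 + b z ^ 2)) := by
        rw [Real.sqrt_eq_rpow, Real.rpow_def_of_pos (hpos z)]
        ring_nf
      rw [← h3, h2, Real.sqrt_mul (sq_nonneg _), Real.sqrt_sq h1.le]
    have hsq : 0 < √(1 + (b z / q z) ^ 2) := Real.sqrt_pos.2 (by positivity)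
    have h1 := hq0 z
  · rw [hexp, Real.cos_arctan, ← hqa z hz]
    field_simp
  · rw [hexp, Real.sin_arctan]
    field_simp
  · have := ((hlq.pow 2).add (hlb.pow 2)).log (by norm_num)
    simpa using this.const_mul 2⁻¹
  · have := (Real.continuous_arctan.tendsto _).comp (hlb.div hlq one_ne_zero)
    simpa [Function.comp_def] using this

end

section

variable {c : ℝ} {Ω : Set ℂ} {a b s φ : ℂ → ℝ} {z : ℂ}

theorem exists_elliptic (hc : c ^ 2 < 2) : ∃ μ, Elliptic c μ := by
  refine ⟨(2 - c ^ 2) / 3, by linarith, by linarith [sq_nonneg c], hc.le, fun x y => ?_⟩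
  set μ := (2 - c ^ 2) / 3 with hμ
  have h1 : 0 < 1 - μ := by linarith [sq_nonneg c]
  have h2 : c ^ 2 = 2 - 3 * μ := by rw [hμ]; ring
  have key : (1 - μ) * (2 * x ^ 2 + 2 * c * (x * y) + y ^ 2 - μ * (x ^ 2 + y ^ 2))
      = ((1 - μ) * y + c * x) ^ 2 + (μ * x) ^ 2 := by
    linear_combination -(x ^ 2) * h2
  have h3 : 0 ≤ (1 - μ) * (2 * x ^ 2 + 2 * c * (x * y) + y ^ 2 - μ * (x ^ 2 + y ^ 2)) := by
    rw [key]
    positivity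
  have := nonneg_of_mul_nonneg_right h3 h1
  linarith

theorem exp_sq_bounds {t : ℝ} (ht : |t| ≤ 1 / 4) :
    1 / 2 ≤ Real.exp t ^ 2 ∧ Real.exp t ^ 2 ≤ 2 ∧ |t| ≤ |1 - Real.exp t ^ 2| ∧
      |1 - Real.exp t ^ 2| ≤ 4 * |t| := by
  have h2 : Real.exp t ^ 2 = Real.exp (2 * t) := by rw [sq, ← Real.exp_add]; ring_nf
  have h1 := Real.abs_exp_sub_one_le (x := 2 * t) (by rw [abs_mul, abs_two]; linarith)
  rw [abs_mul, abs_two] at h1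
  have h3 := abs_le.1 h1
  have h4 := Real.add_one_le_exp (2 * t)
  have h5 := Real.add_one_le_exp (-(2 * t))
  have h6 : Real.exp (2 * t) * Real.exp (-(2 * t)) = 1 := by rw [← Real.exp_add]; simp
  have h7 := Real.exp_pos (2 * t)
  have ht' := abs_le.1 ht
  rw [h2]
  refine ⟨by linarith, ?_, ?_, by rw [abs_sub_comm]; linarith⟩
  · linarith
  · rcases le_total 0 t with h | h
    · rw [abs_of_nonneg h, abs_sub_comm]
      exact le_trans (by linarith) (le_abs_self _)
    · rw [abs_of_nonpos h]
      refine le_trans ?_ (le_abs_self _)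
      nlinarith

theorem Polar.D_sq_le (h : Polar Ω a b s φ) (hz : z ∈ Ω) (hs : |s z| ≤ 1 / 4) (j : Fin 2) :
    D j s z ^ 2 + D j φ z ^ 2 ≤ 2 * (gsq a z + gsq b z) := by
  have h1 := (exp_sq_bounds hs).1
  have h2 := h.D_sq_add_D_sq hz j
  have h3 := D_sq_le_gsq a j z
  have h4 := D_sq_le_gsq b j z
  have h5 := mul_le_mul_of_nonneg_right h1 (add_nonneg (sq_nonneg (D j s z)) (sq_nonneg (D j φ z)))
  linarith

/-- Near infinity, the logarithm of a solution tending to `1` solves the hydrodynamic system. -/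
theorem WaveSystem.exists_hydro (hW : WaveSystem c a b) (hc : c ^ 2 ≤ 2)
    (hla : Tendsto a (cocompact ℂ) (nhds 1)) (hlb : Tendsto b (cocompact ℂ) (nhds 0))
    {ε : ℝ} (hε : 0 < ε) (hε1 : ε ≤ 1 / 4) :
    ∃ (s φ : ℂ → ℝ) (R : ℝ), 0 < R ∧ Polar {z | R < ‖z‖} a b s φ ∧
      HydroSystem c ε {z | R < ‖z‖} s φ ∧ Tendsto φ (cocompact ℂ) (nhds 0) := by
  obtain ⟨s, φ, R₀, -, hP, hls, hlφ⟩ := exists_polar hW.smooth_a hW.smooth_b hla hlb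
  obtain ⟨R₁, -, h₁⟩ := exists_forall_of_tendsto hls hε
  obtain ⟨R₂, -, h₂⟩ := exists_forall_of_tendsto hlφ hε
  obtain ⟨R₃, -, h₃⟩ := exists_forall_of_tendsto hla (δ := ε / 25) (by positivity)
  obtain ⟨R₄, -, h₄⟩ := exists_forall_of_tendsto hlb (δ := ε / 25) (by positivity)
  let R := |R₀| + |R₁| + |R₂| + |R₃| + |R₄| + 1
  have b0 := le_abs_self R₀
  have b1 := le_abs_self R₁
  have b2 := le_abs_self R₂
  have b3 := le_abs_self R₃
  have b4 := le_abs_self R₄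
  have c0 := abs_nonneg R₀
  have c1 := abs_nonneg R₁
  have c2 := abs_nonneg R₂
  have c3 := abs_nonneg R₃
  have c4 := abs_nonneg R₄
  have hP' : Polar {z | R < ‖z‖} a b s φ := hP.mono (isOpen_norm_gt R) fun z hz => by
    change R < ‖z‖ at hz
    change R₀ < ‖z‖
    simp only [R] at hz
    linarith
  have hs : ∀ z, R < ‖z‖ → |s z| ≤ ε := fun z hz => by
    simpa using h₁ z (by simp only [R] at hz; linarith)
  have hφ : ∀ z, R < ‖z‖ → |φ z| ≤ ε := fun z hz => by
    simpa using h₂ z (by simp only [R] at hz; linarith)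
  have hD : ∀ z, R < ‖z‖ → ∀ j, D j s z ^ 2 + D j φ z ^ 2 ≤ ε ^ 2 := fun z hz j => by
    have hg := hW.gradient_bound hc (x₀ := z) (σ := ε / 25) (by linarith) fun w hw => by
      have hn : R - 1 < ‖w‖ := by
        have := norm_sub_norm_le z w
        rw [norm_sub_rev] at this
        linarith
      simp only [R] at hn
      exact ⟨h₃ w (by linarith), by simpa using h₄ w (by linarith)⟩
    have := hP'.D_sq_le hz ((hs z hz).trans hε1) j
    nlinarith [sq_nonneg ε]
  refine ⟨s, φ, R, by positivity, hP', ⟨hP.smooth_s, hP.smooth_φ, hP'.isOpen,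
    fun z hz => hW.polar_eq_s hP' hz, fun z hz => hW.polar_eq_φ hP' hz, hs, hφ,
    fun z hz j => ?_, fun z hz j => ?_⟩, hlφ⟩
  · exact abs_le_of_sq_le_sq (by linarith [hD z hz j, sq_nonneg (D j φ z)]) hε.le
  · exact abs_le_of_sq_le_sq (by linarith [hD z hz j, sq_nonneg (D j s z)]) hε.le

/-- The current `Im (conj U ∇U)` of `U = a + ib`. -/
def current (a b : ℂ → ℝ) (j : Fin 2) (z : ℂ) : ℝ := a z * D j b z - b z * D j a z

@[fun_prop]
theorem contDiff_current (ha : ContDiff ℝ ∞ a) (hb : ContDiff ℝ ∞ b) (j : Fin 2) :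
    ContDiff ℝ ∞ (current a b j) := by
  unfold current
  fun_prop

theorem WaveSystem.div_current (hW : WaveSystem c a b) (z : ℂ) :
    D 0 (current a b 0) z + D 1 (current a b 1) z = c / 2 * D 1 (defect a b) z := by
  have ha := hW.smooth_a
  have hb := hW.smooth_b
  have ea := hW.eq_a z
  have eb := hW.eq_b z
  rw [lapR] at ea eb
  rw [D_defect ha hb]
  unfold current
  simp (disch := fun_prop) only [D_sub, D_mul]
  linear_combination a z * eb - b z * ea

theorem WaveSystem.lapR_defect (hW : WaveSystem c a b) :
    lapR (defect a b) = fun z => -2 * c * current a b 1 z + 2 * defect a b z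
      - 2 * ((gsq a z + gsq b z) + defect a b z ^ 2) := by
  have ha := hW.smooth_a
  have hb := hW.smooth_b
  funext z
  have ea := hW.eq_a z
  have eb := hW.eq_b z
  rw [lapR] at ea eb
  rw [lapR, D_defect ha hb, D_defect ha hb]
  simp (disch := fun_prop) only [D_add, D_mul, D_const]
  unfold current gsq
  rw [defect] at *
  linear_combination -2 * a z * ea - 2 * b z * eb

theorem WaveSystem.phase_eq (hW : WaveSystem c a b) (hφ : ContDiff ℝ ∞ φ) (z : ℂ) :
    D 0 (D 0 φ) z + (1 - c ^ 2 / 2) * D 1 (D 1 φ) z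
      = D 0 (fun z => D 0 φ z - current a b 0 z) z
        + D 1 (fun z => (1 - c ^ 2 / 2) * (D 1 φ z - current a b 1 z)
          + c / 2 * ((gsq a z + gsq b z) + defect a b z ^ 2)) z
        + c / 4 * D 1 (lapR (defect a b)) z := by
  have ha := hW.smooth_a
  have hb := hW.smooth_b
  have hJ := contDiff_current ha hb
  have hη : ContDiff ℝ ∞ (defect a b) := by fun_prop
  have hG : ContDiff ℝ ∞ (fun z => (gsq a z + gsq b z) + defect a b z ^ 2) := by fun_prop
  have e1 : D 1 (fun z => (1 - c ^ 2 / 2) * (D 1 φ z - current a b 1 z)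
          + c / 2 * ((gsq a z + gsq b z) + defect a b z ^ 2)) z
      = (1 - c ^ 2 / 2) * (D 1 (D 1 φ) z - D 1 (current a b 1) z)
        + c / 2 * D 1 (fun z => (gsq a z + gsq b z) + defect a b z ^ 2) z := by
    rw [D_add (by fun_prop) (by fun_prop), D_mul (by fun_prop) (by fun_prop),
      D_mul (by fun_prop) hG, D_const, D_const, D_sub (by fun_prop) (by fun_prop)]
    ring
  have e2 : D 1 (lapR (defect a b)) z = -2 * c * D 1 (current a b 1) z + 2 * D 1 (defect a b) z
      - 2 * D 1 (fun z => (gsq a z + gsq b z) + defect a b z ^ 2) z := by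
    rw [hW.lapR_defect, D_sub (by fun_prop) (by fun_prop), D_add (by fun_prop) (by fun_prop),
      D_mul contDiff_const (hJ 1), D_mul contDiff_const hη, D_mul contDiff_const hG]
    simp only [D_const]
    ring
  rw [e1, e2, D_sub (by fun_prop) (by fun_prop)]
  linear_combination hW.div_current z

end

section

variable {c : ℝ} {a b s φ : ℂ → ℝ}

theorem integrable_of_abs_le_outside {f g : ℂ → ℝ} {R : ℝ} (hf : Continuous f)
    (hg : Integrable g) (h : ∀ z, R < ‖z‖ → |f z| ≤ g z) : Integrable f := by
  rw [← integrableOn_univ, show (Set.univ : Set ℂ) = closedBall 0 R ∪ {z | R < ‖z‖} by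
    ext z
    simp [le_or_gt]]
  refine (hf.continuousOn.integrableOn_compact (isCompact_closedBall 0 R)).union ?_
  refine Integrable.mono' hg.integrableOn hf.aestronglyMeasurable.restrict ?_
  exact (ae_restrict_iff' (isOpen_norm_gt R).measurableSet).2 (ae_of_all _ h)

theorem Polar.integrable_current_sub {R : ℝ} (hP : Polar {z | R < ‖z‖} a b s φ)
    (ha : ContDiff ℝ ∞ a) (hb : ContDiff ℝ ∞ b) (hs : ∀ z, R < ‖z‖ → |s z| ≤ 1 / 4)
    (hie : Integrable fun z => gsq a z + gsq b z) (hiη : Integrable fun z => defect a b z ^ 2)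
    (j : Fin 2) : Integrable fun z => D j φ z - current a b j z := by
  have hφ := hP.smooth_φ
  have hc : ContDiff ℝ ∞ fun z => D j φ z - current a b j z := by fun_prop
  refine integrable_of_abs_le_outside (R := R) hc.continuous (hiη.add (hie.const_mul 2))
    fun z hz => ?_
  have h1 : D j φ z - current a b j z = defect a b z * D j φ z := by
    rw [current, hP.current_eq hz, hP.defect_eq hz]
    ring
  have h2 := hP.D_sq_le hz (hs z hz) j
  simp only [Pi.add_apply]
  rw [h1, abs_mul, ← sq_abs (defect a b z)]
  nlinarith [sq_nonneg (|defect a b z| - |D j φ z|), sq_abs (D j φ z), sq_nonneg (D j s z),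
    sq_nonneg (|defect a b z|), sq_nonneg (D j φ z)]

theorem integrable_D_defect_sq (ha : ContDiff ℝ ∞ a) (hb : ContDiff ℝ ∞ b)
    (hla : Tendsto a (cocompact ℂ) (nhds 1)) (hlb : Tendsto b (cocompact ℂ) (nhds 0))
    (hie : Integrable fun z => gsq a z + gsq b z) :
    Integrable fun z => D 1 (defect a b) z ^ 2 := by
  obtain ⟨B, hB⟩ := exists_bound_of_tendsto_zero (φ := fun z => a z ^ 2 + b z ^ 2 - 1)
    (by fun_prop) (by simpa using ((hla.pow 2).add (hlb.pow 2)).sub_const 1)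
  have hη : ContDiff ℝ ∞ (fun z => D 1 (defect a b) z ^ 2) := by fun_prop
  refine (hie.const_mul (4 * (B + 1))).mono' hη.continuous.aestronglyMeasurable
    (ae_of_all _ fun z => ?_)
  have h1 : a z ^ 2 + b z ^ 2 ≤ B + 1 := by linarith [(abs_le.1 (hB z)).2]
  have h0 : 0 ≤ B + 1 := le_trans (by positivity) h1
  have h2 : D 1 a z ^ 2 + D 1 b z ^ 2 ≤ gsq a z + gsq b z :=
    add_le_add (D_sq_le_gsq a 1 z) (D_sq_le_gsq b 1 z)
  rw [Real.norm_of_nonneg (sq_nonneg _), D_defect ha hb]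
  calc _ ≤ 4 * ((a z ^ 2 + b z ^ 2) * (D 1 a z ^ 2 + D 1 b z ^ 2)) := by
        linarith [sq_nonneg (a z * D 1 b z - b z * D 1 a z)]
    _ ≤ 4 * ((B + 1) * (gsq a z + gsq b z)) := by gcongr
    _ = _ := by ring

/-- Decay of the logarithm `s + iφ` of a finite energy solution. -/
theorem WaveSystem.exists_polar_decay (hW : WaveSystem c a b) (hc : c ^ 2 < 2)
    (hla : Tendsto a (cocompact ℂ) (nhds 1)) (hlb : Tendsto b (cocompact ℂ) (nhds 0))
    (hie : Integrable fun z => gsq a z + gsq b z) (hiη : Integrable fun z => defect a b z ^ 2) :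
    ∃ (s φ : ℂ → ℝ) (R K : ℝ), 1 ≤ R ∧ 0 ≤ K ∧ Polar {z | R < ‖z‖} a b s φ ∧
      ∀ y, R < ‖y‖ → |s y| ≤ 1 / 4 ∧ |φ y| ≤ K / ‖y‖ ∧ |s y| ≤ K / ‖y‖ ^ 2 ∧
        ∀ j, |D j s y| ≤ K / ‖y‖ ^ 2 ∧ |D j φ y| ≤ K / ‖y‖ ^ 2 := by
  have ha := hW.smooth_a
  have hb := hW.smooth_b
  obtain ⟨μ, hE⟩ := exists_elliptic hc
  have hμ := hE.pos
  have hμ1 := hE.le_one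
  have hε1 : μ / 10000 ≤ 1 / 4 := by linarith
  obtain ⟨s, φ, R₁, hR₁, hP, hS, hlφ⟩ := hW.exists_hydro hc.le hla hlb (by positivity) hε1
  have hs4 : ∀ z, R₁ < ‖z‖ → |s z| ≤ 1 / 4 := fun z hz => (hS.small_s z hz).trans hε1
  have hsφ := hP.smooth_φ
  have hss := hP.smooth_s
  have hη : ContDiff ℝ ∞ (defect a b) := by fun_prop
  have hint : IntegrableOn (fun z => s z ^ 2) {z | R₁ < ‖z‖} := by
    refine Integrable.integrableOn (integrable_of_abs_le_outside (R := R₁) (by fun_prop) hiη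
      fun z hz => ?_)
    rw [abs_of_nonneg (sq_nonneg _), hP.defect_eq hz]
    exact sq_le_sq.2 (exp_sq_bounds (hs4 z hz)).2.2.1
  obtain ⟨C₁, R₂, hC₁, hR₂, hgrad⟩ := hS.gradient_bound hE (by positivity) (by linarith) hint
  have hκ : 0 < 1 - c ^ 2 / 2 := by linarith
  have hκ1 : 1 - c ^ 2 / 2 ≤ 1 := by linarith [sq_nonneg c]
  have hG := hP.integrable_current_sub ha hb hs4 hie hiη
  have hG₁ : Integrable fun z => (1 - c ^ 2 / 2) * (D 1 φ z - current a b 1 z)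
      + c / 2 * ((gsq a z + gsq b z) + defect a b z ^ 2) :=
    ((hG 1).const_mul (1 - c ^ 2 / 2)).add ((hie.add hiη).const_mul (c / 2))
  obtain ⟨C₂, hC₂, hav⟩ := abs_average_le hκ hκ1 hsφ hη (by fun_prop) (by fun_prop) (hG 0) hG₁
    (integrable_D_defect_sq ha hb hla hlb hie) (hW.phase_eq hsφ) hlφ
  obtain ⟨A, r₁, hA, hr₁, himp⟩ := phase_improvement hκ hκ1 hsφ hC₁ hC₂
    (fun y hy σ hσ h j => ((hgrad y hy σ hσ h).2 j).2) hav
  obtain ⟨B, hB⟩ := exists_bound_of_tendsto_zero hsφ.continuous hlφ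
  obtain ⟨K, hK, hdec⟩ := decay_of_improvement hA hr₁ hB himp
  refine ⟨s, φ, R₁ + R₂ + 2 * r₁, max K (C₁ * (2 * K + 1)), by linarith,
    le_max_of_le_left hK, hP.mono (isOpen_norm_gt _) fun z hz => ?_, fun y hy => ?_⟩
  · change _ < ‖z‖ at hz
    change _ < ‖z‖
    linarith
  have hy0 : 0 < ‖y‖ := by linarith
  have hloc : ∀ z, ‖z - y‖ ≤ ‖y‖ / 2 → |φ z| ≤ 2 * K / ‖y‖ := fun z hz => by
    have h1 : ‖y‖ / 2 ≤ ‖z‖ := by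
      have := norm_sub_norm_le y z
      rw [norm_sub_rev] at this
      linarith
    calc _ ≤ K / ‖z‖ := hdec z (by linarith)
      _ ≤ K / (‖y‖ / 2) := by gcongr
      _ = _ := by field_simp
  have h := hgrad y (by linarith) _ (by positivity) hloc
  have hle : C₁ / ‖y‖ * (2 * K / ‖y‖ + 1 / ‖y‖) ≤ max K (C₁ * (2 * K + 1)) / ‖y‖ ^ 2 := by
    calc _ = C₁ * (2 * K + 1) / ‖y‖ ^ 2 := by field_simp
      _ ≤ _ := by gcongr; exact le_max_right _ _
  refine ⟨hs4 y (by linarith), (hdec y (by linarith)).trans ?_, h.1.trans hle,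
    fun j => ⟨(h.2 j).1.trans hle, (h.2 j).2.trans hle⟩⟩
  gcongr
  exact le_max_left _ _

/-- Decay of a finite energy solution in terms of its real and imaginary parts. -/
theorem WaveSystem.exists_decay (hW : WaveSystem c a b) (hc : c ^ 2 < 2)
    (hla : Tendsto a (cocompact ℂ) (nhds 1)) (hlb : Tendsto b (cocompact ℂ) (nhds 0))
    (hie : Integrable fun z => gsq a z + gsq b z) (hiη : Integrable fun z => defect a b z ^ 2) :
    ∃ R K : ℝ, 1 ≤ R ∧ 0 ≤ K ∧ ∀ y, R < ‖y‖ →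
      |a y - 1| ≤ K / ‖y‖ ∧ |b y| ≤ K / ‖y‖ ∧ |defect a b y| ≤ K / ‖y‖ ^ 2 ∧
        ∀ j, |D j a y| ≤ K / ‖y‖ ^ 2 ∧ |D j b y| ≤ K / ‖y‖ ^ 2 := by
  obtain ⟨s, φ, R, K, hR, hK, hP, hdec⟩ := hW.exists_polar_decay hc hla hlb hie hiη
  refine ⟨R, 4 * K, hR, by positivity, fun y hy => ?_⟩
  obtain ⟨hs4, hφ, hs, hD⟩ := hdec y hy
  obtain ⟨-, e2, -, e4⟩ := exp_sq_bounds hs4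
  have hy1 : 1 ≤ ‖y‖ := hR.trans hy.le
  have hy0 : 0 < ‖y‖ := by linarith
  have hsq : K / ‖y‖ ^ 2 ≤ K / ‖y‖ := by
    gcongr
    exact le_self_pow₀ hy1 two_ne_zero
  have hcos := Real.abs_cos_le_one (φ y)
  have hsin := Real.abs_sin_le_one (φ y)
  have hexp0 := Real.exp_pos (s y)
  have hexp : Real.exp (s y) ≤ 2 := by nlinarith
  have hexp1 : |Real.exp (s y) - 1| ≤ 2 * |s y| := Real.abs_exp_sub_one_le (by linarith)
  have hsinφ : |Real.sin (φ y)| ≤ |φ y| := Real.abs_sin_le_abs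
  have hcosφ : |Real.cos (φ y) - 1| ≤ |φ y| := by
    have h1 := Real.one_sub_sq_div_two_le_cos (x := φ y)
    have h2 := Real.cos_le_one (φ y)
    have h3 := Real.neg_one_le_cos (φ y)
    rw [abs_sub_comm, abs_of_nonneg (by linarith)]
    rcases le_total |φ y| 2 with h | h
    · nlinarith [sq_abs (φ y), abs_nonneg (φ y)]
    · linarith
  have prod : ∀ x t k : ℝ, |x| ≤ 1 → |t| ≤ k → |x * t| ≤ k := fun x t k hx ht => by
    rw [abs_mul]
    exact (mul_le_of_le_one_left (abs_nonneg t) hx).trans ht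
  have hK4 : ∀ n : ℕ, 4 * K / ‖y‖ ^ n = 4 * (K / ‖y‖ ^ n) := fun n => by ring
  have hK4' : 4 * K / ‖y‖ = 4 * (K / ‖y‖) := by ring
  rw [hK4, hK4']
  refine ⟨?_, ?_, ?_, fun j => ⟨?_, ?_⟩⟩
  · rw [hP.eq_a y hy]
    have h1 := prod _ _ _ hcos hexp1
    have h2 : |Real.exp (s y) * Real.cos (φ y) - 1|
        ≤ |Real.cos (φ y) * (Real.exp (s y) - 1)| + |Real.cos (φ y) - 1| := by
      rw [show Real.exp (s y) * Real.cos (φ y) - 1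
        = Real.cos (φ y) * (Real.exp (s y) - 1) + (Real.cos (φ y) - 1) by ring]
      exact abs_add_le _ _
    linarith [abs_nonneg (φ y)]
  · rw [hP.eq_b y hy, abs_mul, abs_of_pos hexp0]
    nlinarith [abs_nonneg (Real.sin (φ y))]
  · rw [hP.defect_eq hy]
    linarith
  · have h1 := abs_sub (Real.cos (φ y) * D j s y) (Real.sin (φ y) * D j φ y)
    have h2 := prod _ _ _ hcos (hD j).1
    have h3 := prod _ _ _ hsin (hD j).2
    rw [hP.D_a hy, abs_mul, abs_of_pos hexp0]
    nlinarith [abs_nonneg (Real.cos (φ y) * D j s y - Real.sin (φ y) * D j φ y)]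
  · have h1 := abs_add_le (Real.sin (φ y) * D j s y) (Real.cos (φ y) * D j φ y)
    have h2 := prod _ _ _ hsin (hD j).1
    have h3 := prod _ _ _ hcos (hD j).2
    rw [hP.D_b hy, abs_mul, abs_of_pos hexp0]
    nlinarith [abs_nonneg (Real.sin (φ y) * D j s y + Real.cos (φ y) * D j φ y)]

end

section

variable {c : ℝ} {U : ℂ → ℂ}

theorem D_re_comp {f : ℂ → ℂ} (hf : ContDiff ℝ ∞ f) (j : Fin 2) (z : ℂ) :
    D j (fun z => (f z).re) z = (fderiv ℝ f z (dir j)).re := by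
  have h := (hf.differentiable (by simp) z).hasFDerivAt
  have h2 := Complex.reCLM.hasFDerivAt.comp z h
  rw [D, show (fun z => (f z).re) = Complex.reCLM ∘ f from rfl, h2.fderiv]
  rfl

theorem D_im_comp {f : ℂ → ℂ} (hf : ContDiff ℝ ∞ f) (j : Fin 2) (z : ℂ) :
    D j (fun z => (f z).im) z = (fderiv ℝ f z (dir j)).im := by
  have h := (hf.differentiable (by simp) z).hasFDerivAt
  have h2 := Complex.imCLM.hasFDerivAt.comp z h
  rw [D, show (fun z => (f z).im) = Complex.imCLM ∘ f from rfl, h2.fderiv]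
  rfl

theorem contDiff_fderiv_dir (hU : ContDiff ℝ ∞ U) (j : Fin 2) :
    ContDiff ℝ ∞ fun z => fderiv ℝ U z (dir j) :=
  (hU.fderiv_right (m := ∞) (by simp)).clm_apply contDiff_const

theorem contDiff_re_comp (hU : ContDiff ℝ ∞ U) : ContDiff ℝ ∞ fun z => (U z).re :=
  Complex.reCLM.contDiff.comp hU

theorem contDiff_im_comp (hU : ContDiff ℝ ∞ U) : ContDiff ℝ ∞ fun z => (U z).im :=
  Complex.imCLM.contDiff.comp hU

theorem lap_re (hU : ContDiff ℝ ∞ U) (z : ℂ) : (lap U z).re = lapR (fun z => (U z).re) z := by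
  have h : ∀ j, D j (fun z => (U z).re) = fun z => (fderiv ℝ U z (dir j)).re := fun j =>
    funext fun z => D_re_comp hU j z
  rw [lapR, h, h, D_re_comp (contDiff_fderiv_dir hU 0), D_re_comp (contDiff_fderiv_dir hU 1)]
  rfl

theorem lap_im (hU : ContDiff ℝ ∞ U) (z : ℂ) : (lap U z).im = lapR (fun z => (U z).im) z := by
  have h : ∀ j, D j (fun z => (U z).im) = fun z => (fderiv ℝ U z (dir j)).im := fun j =>
    funext fun z => D_im_comp hU j z
  rw [lapR, h, h, D_im_comp (contDiff_fderiv_dir hU 0), D_im_comp (contDiff_fderiv_dir hU 1)]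
  rfl

theorem one_sub_norm_sq (z : ℂ) :
    1 - ‖U z‖ ^ 2 = defect (fun z => (U z).re) (fun z => (U z).im) z := by
  rw [Complex.sq_norm, Complex.normSq_apply, defect]
  ring

theorem waveSystem_of_TW (hU : ContDiff ℝ ∞ U) (hTW : TW c U) :
    WaveSystem c (fun z => (U z).re) (fun z => (U z).im) := by
  refine ⟨contDiff_re_comp hU, contDiff_im_comp hU, fun z => ?_, fun z => ?_⟩
  · have h := congrArg Complex.re (hTW z)
    rw [one_sub_norm_sq] at h
    rw [← lap_re hU, D_im_comp hU]
    change _ = c * (pd2 U z).im - _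
    simp only [Complex.sub_re, Complex.neg_re, Complex.mul_re, Complex.mul_im, Complex.I_re,
      Complex.I_im, Complex.ofReal_re, Complex.ofReal_im, Complex.zero_re] at h
    linarith
  · have h := congrArg Complex.im (hTW z)
    rw [one_sub_norm_sq] at h
    rw [← lap_im hU, D_re_comp hU]
    change _ = -c * (pd2 U z).re - _
    simp only [Complex.sub_im, Complex.neg_im, Complex.mul_re, Complex.mul_im, Complex.I_re,
      Complex.I_im, Complex.ofReal_re, Complex.ofReal_im, Complex.zero_im] at h
    linarith

theorem gradSq_eq (hU : ContDiff ℝ ∞ U) (z : ℂ) :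
    gradSq U z = gsq (fun z => (U z).re) z + gsq (fun z => (U z).im) z := by
  rw [gradSq, Complex.sq_norm, Complex.sq_norm, Complex.normSq_apply, Complex.normSq_apply, gsq,
    gsq, D_re_comp hU, D_re_comp hU, D_im_comp hU, D_im_comp hU]
  change _ = (pd1 U z).re ^ 2 + (pd2 U z).re ^ 2 + ((pd1 U z).im ^ 2 + (pd2 U z).im ^ 2)
  ring

theorem integrable_of_memE (hU : memE U) :
    Integrable (fun z => gsq (fun z => (U z).re) z + gsq (fun z => (U z).im) z) ∧
      Integrable fun z => defect (fun z => (U z).re) (fun z => (U z).im) z ^ 2 := by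
  have ha := contDiff_re_comp hU.1
  have hb := contDiff_im_comp hU.1
  set a := fun z => (U z).re
  set b := fun z => (U z).im
  have hdens : ∀ z, energyDensity U z = 1 / 2 * (gsq a z + gsq b z) + 1 / 4 * defect a b z ^ 2 :=
    fun z => by rw [energyDensity, gradSq_eq hU.1, one_sub_norm_sq]
  have hg0 : ∀ z, 0 ≤ gsq a z + gsq b z := fun z => add_nonneg (gsq_nonneg _ _) (gsq_nonneg _ _)
  have h1 : ContDiff ℝ ∞ fun z => gsq a z + gsq b z := by fun_prop
  have h2 : ContDiff ℝ ∞ fun z => defect a b z ^ 2 := by fun_prop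
  have hcont : Continuous (energyDensity U) := by
    rw [funext hdens]
    exact (h1.continuous.const_mul _).add (h2.continuous.const_mul _)
  have hi : Integrable (energyDensity U) := by
    refine ⟨hcont.aestronglyMeasurable, ?_⟩
    rw [hasFiniteIntegral_iff_ofReal (ae_of_all _ fun z => ?_)]
    · exact hU.2
    · change 0 ≤ energyDensity U z
      rw [hdens]
      linarith [hg0 z, sq_nonneg (defect a b z)]
  refine ⟨(hi.const_mul 2).mono' h1.continuous.aestronglyMeasurable (ae_of_all _ fun z => ?_),
    (hi.const_mul 4).mono' h2.continuous.aestronglyMeasurable (ae_of_all _ fun z => ?_)⟩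
  · rw [Real.norm_of_nonneg (hg0 z), hdens]
    linarith [sq_nonneg (defect a b z)]
  · rw [Real.norm_of_nonneg (sq_nonneg _), hdens]
    linarith [hg0 z]

theorem abs_norm_sub_one_le (w : ℂ) : |‖w‖ - 1| ≤ |1 - ‖w‖ ^ 2| := by
  rw [show 1 - ‖w‖ ^ 2 = -((‖w‖ - 1) * (‖w‖ + 1)) by ring, abs_neg, abs_mul]
  refine le_mul_of_one_le_right (abs_nonneg _) ((le_abs_self _).trans' ?_)
  linarith [norm_nonneg w]

/-- A continuous function which is `O(‖z‖⁻ⁿ)` at infinity is `O((1 + ‖z‖)⁻ⁿ)` globally. -/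
theorem exists_global_decay {f : ℂ → ℝ} (hf : Continuous f) {R K : ℝ} {n : ℕ} (hR : 1 ≤ R)
    (hK : 0 ≤ K) (h : ∀ z, R < ‖z‖ → |f z| ≤ K / ‖z‖ ^ n) :
    ∃ M, 0 < M ∧ ∀ z, |f z| ≤ M / (1 + ‖z‖) ^ n := by
  obtain ⟨B, hB⟩ := (isCompact_closedBall (0 : ℂ) R).exists_bound_of_continuousOn hf.continuousOn
  refine ⟨|B| * (1 + R) ^ n + K * 2 ^ n + 1, by positivity, fun z => ?_⟩
  have h2 : 0 ≤ K * 2 ^ n := by positivity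
  have h3 : 0 ≤ |B| * (1 + R) ^ n := by positivity
  rw [le_div_iff₀ (by positivity)]
  rcases le_or_gt ‖z‖ R with hz | hz
  · have h1 : |f z| ≤ |B| := (hB z (by simpa using hz)).trans (le_abs_self B)
    have : |f z| * (1 + ‖z‖) ^ n ≤ |B| * (1 + R) ^ n := by gcongr
    linarith
  · have hz0 : 0 < ‖z‖ := by linarith
    have : |f z| * (1 + ‖z‖) ^ n ≤ K * 2 ^ n := by
      calc _ ≤ K / ‖z‖ ^ n * (2 * ‖z‖) ^ n := by
            gcongr
            · exact h z hz
            · linarith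
        _ = _ := by
            rw [mul_pow]
            field_simp
    linarith

end

end TravellingWave

/-- algebraic decay of travelling waves (Gravejat). -/
theorem algebraic_decay (c : ℝ) (hc : c ∈ Set.Ico 0 (Real.sqrt 2)) (U : ℂ → ℂ)
    (hU : memE U) (hTW : TW c U)
    (hlim : Filter.Tendsto U (Filter.cocompact ℂ) (nhds 1)) :
    ∃ M : ℝ, 0 < M ∧ ∀ z : ℂ,
      ‖U z - 1‖ ≤ M / (1 + ‖z‖) ∧
      ‖fderiv ℝ U z‖ ≤ M / (1 + ‖z‖) ^ 2 ∧
      |‖U z‖ - 1| ≤ M / (1 + ‖z‖) ^ 2 := by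
  have hc2 : c ^ 2 < 2 := by
    have := Real.sq_sqrt (show (0 : ℝ) ≤ 2 by norm_num)
    nlinarith [hc.1, hc.2]
  have hsm := hU.1
  have hla : Tendsto (fun z => (U z).re) (cocompact ℂ) (nhds 1) :=
    (Complex.continuous_re.tendsto 1).comp hlim
  have hlb : Tendsto (fun z => (U z).im) (cocompact ℂ) (nhds 0) :=
    (Complex.continuous_im.tendsto 1).comp hlim
  obtain ⟨hie, hiη⟩ := TravellingWave.integrable_of_memE hU
  obtain ⟨R, K, hR, hK, h⟩ :=
    (TravellingWave.waveSystem_of_TW hsm hTW).exists_decay hc2 hla hlb hie hiη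
  have hcU : Continuous U := hsm.continuous
  have hcD : Continuous (fderiv ℝ U) := hsm.continuous_fderiv (by simp)
  obtain ⟨M₁, hM₁, h₁⟩ := TravellingWave.exists_global_decay (f := fun z => ‖U z - 1‖) (n := 1)
    (by fun_prop) hR (show 0 ≤ 2 * K by positivity) fun z hz => by
      obtain ⟨ha, hb, -, -⟩ := h z hz
      have := Complex.norm_le_abs_re_add_abs_im (U z - 1)
      simp only [Complex.sub_re, Complex.sub_im, Complex.one_re, Complex.one_im, sub_zero] at this
      rw [abs_norm, pow_one, mul_div_assoc]
      linarith
  obtain ⟨M₂, hM₂, h₂⟩ := TravellingWave.exists_global_decay (f := fun z => ‖fderiv ℝ U z‖)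
    (n := 2) (by fun_prop) hR (show 0 ≤ 4 * K by positivity) fun z hz => by
      obtain ⟨-, -, -, hD⟩ := h z hz
      have hdir : ∀ j, ‖fderiv ℝ U z (TravellingWave.dir j)‖ ≤ 2 * (K / ‖z‖ ^ 2) := fun j => by
        have h1 := Complex.norm_le_abs_re_add_abs_im (fderiv ℝ U z (TravellingWave.dir j))
        rw [← TravellingWave.D_re_comp hsm, ← TravellingWave.D_im_comp hsm] at h1
        linarith [(hD j).1, (hD j).2]
      have h0 : ‖fderiv ℝ U z 1‖ ≤ _ := hdir 0
      have h1 : ‖fderiv ℝ U z Complex.I‖ ≤ _ := hdir 1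
      rw [abs_norm, mul_div_assoc]
      linarith [TravellingWave.norm_le_of_dir (fderiv ℝ U z)]
  obtain ⟨M₃, hM₃, h₃⟩ := TravellingWave.exists_global_decay (f := fun z => ‖U z‖ - 1) (n := 2)
    (by fun_prop) hR hK fun z hz => by
      obtain ⟨-, -, hη, -⟩ := h z hz
      rw [← TravellingWave.one_sub_norm_sq] at hη
      exact (TravellingWave.abs_norm_sub_one_le _).trans hη
  refine ⟨M₁ + M₂ + M₃, by positivity, fun z => ⟨?_, ?_, ?_⟩⟩
  · have := h₁ z
    rw [abs_norm, pow_one] at this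
    refine this.trans ?_
    gcongr
    linarith
  · have := h₂ z
    rw [abs_norm] at this
    refine this.trans ?_
    gcongr
    linarith
  · refine (h₃ z).trans ?_
    gcongr
    linarith
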